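/- arXiv:2201.07193 — 2 statements merged into one kernel-verified Lean document; each statement's English description precedes it below -/
import Mathlib

section
/- Let q be a prime power and n ≥ 2 an integer. The number of n-dimensional F_q-linear subspaces C of the matrix space F_q^{n×n} in which every nonzero matrix is invertible is at least (|GL_n(q)|^2 / (n·(q^n−1)^2)) · (1 + binom(n−1, 2) · (q^n−1)(q−2)/(q−1)), where binom(n−1,2) is the ordinary binomial coefficient. -/
section Bidiagonal

variable {I L : Type*} [AddCommGroup I] [DecidableEq I] [Field L]

/-- The matrix with entry `α m` at `(m, m)` and entry `-α m * γ m` at `(m + s, m + t)`. -/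
def bidiag (α γ : I → L) (s t k l : I) : L :=
  (if k = l then α k else 0) - (if l = k - s + t then α (k - s) * γ (k - s) else 0)

variable {α γ u v u' v' : I → L} {s t : I}

theorem bidiag_diag (hst : s ≠ t) (m : I) : bidiag α γ s t m m = α m := by
  have h : m ≠ m - s + t := by grind
  simp [bidiag, h]

theorem bidiag_shift (hst : s ≠ t) (m : I) :
    bidiag α γ s t (m + s) (m + t) = -(α m * γ m) := by
  simp [bidiag, hst]

theorem bidiag_off (hst : s ≠ t) (m : I) :
    bidiag α γ s t m (m - s + t) = -(α (m - s) * γ (m - s)) := by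
  have h : m ≠ m - s + t := by grind
  simp [bidiag, h]

theorem bidiag_eq_zero {k l : I} (h : k ≠ l) (h' : l ≠ k - s + t) : bidiag α γ s t k l = 0 := by
  simp [bidiag, h, h']

omit [AddCommGroup I] [DecidableEq I] in
theorem minor_eq_zero {N : I → I → L} (hN : ∀ k l, N k l = u k * v l - u' k * v' l)
    (k₁ k₂ k₃ l₁ l₂ l₃ : I) :
    N k₁ l₁ * (N k₂ l₂ * N k₃ l₃ - N k₂ l₃ * N k₃ l₂)
      - N k₁ l₂ * (N k₂ l₁ * N k₃ l₃ - N k₂ l₃ * N k₃ l₁)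
      + N k₁ l₃ * (N k₂ l₁ * N k₃ l₂ - N k₂ l₂ * N k₃ l₁) = 0 := by
  simp only [hN]
  ring

theorem bidiag_mul_eq (hs : s ≠ 0) (ht : t ≠ 0) (hst : s ≠ t) (hγ : ∀ m, γ m ≠ 0)
    (hN : ∀ k l, bidiag α γ s t k l = u k * v l - u' k * v' l) {m₁ m₂ : I}
    (h₁ : α m₁ ≠ 0) (hms : m₂ ≠ m₁ + s) (hmt : m₂ ≠ m₁ + t) :
    α m₁ * α m₂ = bidiag α γ s t m₁ m₂ * bidiag α γ s t m₂ m₁ := by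
  have h := minor_eq_zero hN m₁ m₂ (m₁ + s) m₁ m₂ (m₁ + t)
  rw [bidiag_diag hst, bidiag_diag hst, bidiag_shift hst,
    bidiag_eq_zero (k := m₁) (l := m₁ + t) (by grind) (by grind),
    bidiag_eq_zero (k := m₂) (l := m₁ + t) (by grind) (by grind),
    bidiag_eq_zero (k := m₁ + s) (l := m₁) (by grind) (by grind),
    bidiag_eq_zero (k := m₁ + s) (l := m₂) (by grind) (by grind)] at h
  have h' : α m₁ * γ m₁ ≠ 0 := mul_ne_zero h₁ (hγ _)
  apply mul_left_cancel₀ h'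
  linear_combination -h

/-- If `bidiag α γ s t` has rank at most two and `α` is not supported at one point, then the
support of `α` is a pair whose differences both lie in `{s, t}`. -/
theorem bidiag_support (hs : s ≠ 0) (ht : t ≠ 0) (hst : s ≠ t) (hγ : ∀ m, γ m ≠ 0)
    (hinv : ∀ a b : I, a + a = 0 → b + b = 0 → a ≠ 0 → b ≠ 0 → a = b)
    (h3 : s + s + s = 0 → ∀ m, γ m * γ (m + s) * γ (m + s + s) ≠ 1)
    (h4 : s + s + s + s = 0 → s + s ≠ 0 → ∀ m, γ m * γ (m + s) * γ (m + s + s) * γ (m + s + s + s) ≠ 1)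
    (hN : ∀ k l, bidiag α γ s t k l = u k * v l - u' k * v' l) {m₁ m₂ : I} (hm : m₁ ≠ m₂)
    (h₁ : α m₁ ≠ 0) (h₂ : α m₂ ≠ 0) :
    (m₂ = m₁ + s ∨ m₂ = m₁ + t) ∧ (m₁ = m₂ + s ∨ m₁ = m₂ + t) ∧
      ∀ m, α m ≠ 0 → m = m₁ ∨ m = m₂ := by
  have key : ∀ a b, a ≠ b → α a ≠ 0 → α b ≠ 0 → b = a + s ∨ b = a + t := by
    intro a b hab ha hb
    by_contra! hcon
    have e := bidiag_mul_eq hs ht hst hγ hN ha hcon.1 hcon.2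
    have hne : bidiag α γ s t a b ≠ 0 ∧ bidiag α γ s t b a ≠ 0 := by
      rw [← mul_ne_zero_iff, ← e]
      exact mul_ne_zero ha hb
    have hb' : b = a - s + t := by
      by_contra h
      exact hne.1 (bidiag_eq_zero hab h)
    have ha' : a = b - s + t := by
      by_contra h
      exact hne.2 (bidiag_eq_zero hab.symm h)
    have eab : bidiag α γ s t a b = -(α (a - s) * γ (a - s)) := by
      rw [hb', bidiag_off hst]
    have eba : bidiag α γ s t b a = -(α (b - s) * γ (b - s)) := by
      conv_lhs => rw [ha']
      rw [← ha', ← bidiag_off hst b, ← ha']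
    have hc : α (a - s) ≠ 0 := by
      intro h; rw [eab, h] at hne; simp at hne
    have hd : α (b - s) ≠ 0 := by
      intro h; rw [eba, h] at hne; simp at hne
    have htt : t = -s := by
      by_contra h
      have e2 := bidiag_mul_eq hs ht hst hγ hN ha (m₂ := a - s) (by
        intro h5
        have := hinv s (t - s) (by linear_combination (norm := module) -h5) (by linear_combination (norm := module) -hb' - ha') hs
          (sub_ne_zero.2 hst.symm)
        exact ht (by linear_combination (norm := module) -this - h5)) (fun h6 => h (by linear_combination (norm := module) -h6))
      rw [bidiag_eq_zero (k := a) (l := a - s)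
        (fun h => hs (by linear_combination (norm := module) h)) (fun h => ht (by linear_combination (norm := module) -h))] at e2
      simp [ha, hc] at e2
    have hs4 : s + s + s + s = 0 := by
      linear_combination (norm := module) hb' + ha' + (2 : ℤ) • htt
    have hs2 : s + s ≠ 0 := fun h => hst (by linear_combination (norm := module) h - htt)
    have e3 := bidiag_mul_eq hs ht hst hγ hN hc (m₂ := b - s)
      (fun h => hs (by linear_combination (norm := module) hs4 + h - hb' - htt))
      (fun h => hs (by linear_combination (norm := module) hb' - h))
    have ecd : bidiag α γ s t (a - s) (b - s) = -(α b * γ b) := by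
      have := bidiag_off (α := α) (γ := γ) hst (a - s)
      rwa [show a - s - s + t = b - s by linear_combination (norm := module) -hb',
        show a - s - s = b by linear_combination (norm := module) -hb' - htt] at this
    have edc : bidiag α γ s t (b - s) (a - s) = -(α a * γ a) := by
      have := bidiag_off (α := α) (γ := γ) hst (b - s)
      rwa [show b - s - s + t = a - s by linear_combination (norm := module) -ha',
        show b - s - s = a by linear_combination (norm := module) -ha' - htt] at this
    rw [ecd, edc] at e3
    rw [eab, eba] at e
    apply h4 hs4 hs2 a
    rw [show a + s + s + s = a - s by linear_combination (norm := module) hs4,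
      show a + s + s = b by linear_combination (norm := module) hs4 - hb' - htt,
      show a + s = b - s by linear_combination (norm := module) hs4 - hb' - htt]
    apply mul_left_cancel₀ (mul_ne_zero ha hb)
    linear_combination (-1 : L) * e - γ (b - s) * γ (a - s) * e3
  refine ⟨key _ _ hm h₁ h₂, key _ _ hm.symm h₂ h₁, fun m h₃ => ?_⟩
  by_contra! hcon
  have k12 := key _ _ hm h₁ h₂
  have k21 := key _ _ hm.symm h₂ h₁
  have k13 := key _ _ hcon.1.symm h₁ h₃
  have k31 := key _ _ hcon.1 h₃ h₁
  have k23 := key _ _ hcon.2.symm h₂ h₃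
  have k32 := key _ _ hcon.2 h₃ h₂
  have triple : ∀ b c, b = m₁ + s → c = m₁ + t → (c = b + s ∨ c = b + t) →
      (b = c + s ∨ b = c + t) → s + s + s = 0 ∧ t = s + s := by
    rintro b c hb hc (h | h) (h' | h')
    · exact absurd (by linear_combination (norm := module) hb - hc - h') ht
    · exact ⟨by linear_combination (norm := module) hc - hb - h' - (2 : ℤ) • h,
        by linear_combination (norm := module) h + hb - hc⟩
    · exact absurd (by linear_combination (norm := module) -h - hb + hc) hs
    · exact absurd (by linear_combination (norm := module) -h - hb + hc) hs
  obtain ⟨h3s, hts, a1, a2⟩ : s + s + s = 0 ∧ t = s + s ∧ α (m₁ + s) ≠ 0 ∧ α (m₁ + t) ≠ 0 := by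
    rcases k12 with e | e <;> rcases k13 with e' | e'
    · exact absurd (e'.trans e.symm) hcon.2
    · have := triple _ _ e e' k23 k32
      exact ⟨this.1, this.2, e ▸ h₂, e' ▸ h₃⟩
    · have := triple _ _ e' e k32 k23
      exact ⟨this.1, this.2, e' ▸ h₃, e ▸ h₂⟩
    · exact absurd (e'.trans e.symm) hcon.2
  rw [show m₁ + t = m₁ + s + s by linear_combination (norm := module) hts] at a2
  have h := minor_eq_zero hN m₁ (m₁ + s) (m₁ + s + s) m₁ (m₁ + s) (m₁ + s + s)
  have o1 := bidiag_off (α := α) (γ := γ) hst m₁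
  have o2 := bidiag_off (α := α) (γ := γ) hst (m₁ + s)
  have o3 := bidiag_off (α := α) (γ := γ) hst (m₁ + s + s)
  rw [show m₁ - s + t = m₁ + s by linear_combination (norm := module) hts,
    show m₁ - s = m₁ + s + s by linear_combination (norm := module) -h3s] at o1
  rw [show m₁ + s - s + t = m₁ + s + s by linear_combination (norm := module) hts,
    show m₁ + s - s = m₁ by abel] at o2
  rw [show m₁ + s + s - s + t = m₁ by linear_combination (norm := module) hts + h3s,
    show m₁ + s + s - s = m₁ + s by abel] at o3
  rw [bidiag_diag hst, bidiag_diag hst, bidiag_diag hst, o1, o2, o3,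
    bidiag_eq_zero (k := m₁) (l := m₁ + s + s)
      (fun h => hs (by linear_combination (norm := module) h3s + h))
      (fun h => ht (by linear_combination (norm := module) h3s - h)),
    bidiag_eq_zero (k := m₁ + s) (l := m₁)
      (fun h => hs (by linear_combination (norm := module) h)) (fun h => ht (by linear_combination (norm := module) -h)),
    bidiag_eq_zero (k := m₁ + s + s) (l := m₁ + s)
      (fun h => hs (by linear_combination (norm := module) h)) (fun h => ht (by linear_combination (norm := module) -h))] at h
  apply h3 h3s m₁
  apply mul_left_cancel₀ (mul_ne_zero h₁ (mul_ne_zero a1 a2))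
  linear_combination -h

/-- A rank one matrix `bidiag α γ s t` vanishes. -/
theorem bidiag_rank_one (hs : s ≠ 0) (ht : t ≠ 0) (hst : s ≠ t) (hγ : ∀ m, γ m ≠ 0)
    (hN : ∀ k l, bidiag α γ s t k l = u k * v l) (m : I) : α m = 0 := by
  have h : bidiag α γ s t m m * bidiag α γ s t (m + s) (m + t)
      = bidiag α γ s t m (m + t) * bidiag α γ s t (m + s) m := by
    simp only [hN]
    ring
  rw [bidiag_diag hst, bidiag_shift hst,
    bidiag_eq_zero (k := m) (l := m + t) (by grind) (by grind)] at h
  have := hγ m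
  grind

/-- If the matrix with two entries `bidiag α γ s t` (`α` supported at `m`) equals the difference of two
rank one matrices whose factors have shifted supports, then these factors are supported at one
point. -/
theorem bidiag_single {s' t' : I} (hs : s ≠ 0) (ht : t ≠ 0) (hst : s ≠ t) (hγ : ∀ m, γ m ≠ 0)
    (hs' : s' ≠ 0) (ht' : t' ≠ 0)
    (hinv : ∀ a b : I, a + a = 0 → b + b = 0 → a ≠ 0 → b ≠ 0 → a = b)
    (hN : ∀ k l, bidiag α γ s t k l = u k * v l - u' k * v' l)
    (hu : ∀ k, u' (k + s') = 0 ↔ u k = 0) (hv : ∀ k, v' (k + t') = 0 ↔ v k = 0) {m : I}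
    (hm : α m ≠ 0) (hα : ∀ k ≠ m, α k = 0) :
    (∃ k, ∀ l ≠ k, u l = 0) ∧ ∃ k, ∀ l ≠ k, v l = 0 := by
  have e00 := hN m m
  have e01 := hN m (m + t)
  have e10 := hN (m + s) m
  have e11 := hN (m + s) (m + t)
  rw [bidiag_diag hst] at e00
  rw [bidiag_eq_zero (by grind) (by grind)] at e01 e10
  rw [bidiag_shift hst] at e11
  have hz : ∀ k l, k ≠ m → k ≠ m + s → bidiag α γ s t k l = 0 := by
    intro k l h h'
    rw [bidiag, hα _ h, hα (k - s) (by grind)]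
    simp
  have hz' : ∀ k l, l ≠ m → l ≠ m + t → bidiag α γ s t k l = 0 := by
    intro k l h h'
    rw [bidiag]
    split_ifs with i1 i2 i2
    · grind
    · rw [hα _ (by grind)]; simp
    · rw [hα (k - s) (by grind)]; simp
    · simp
  have hγm := hγ m
  have hprod : (u m * u' (m + s) - u' m * u (m + s)) * (v m * v' (m + t) - v' m * v (m + t)) ≠ 0 := by
    have : (u m * u' (m + s) - u' m * u (m + s)) * (v m * v' (m + t) - v' m * v (m + t))
       = α m * (α m * γ m) := by
      have h1 : (u m * v m - u' m * v' m) * (u (m + s) * v (m + t) - u' (m + s) * v' (m + t))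
          - (u m * v (m + t) - u' m * v' (m + t)) * (u (m + s) * v m - u' (m + s) * v' m)
          = α m * (-(α m * γ m)) := by
        rw [← e00, ← e01, ← e11]; ring
      linear_combination -h1
    rw [this]
    exact mul_ne_zero hm (mul_ne_zero hm hγm)
  obtain ⟨hU, hV⟩ := mul_ne_zero_iff.1 hprod
  have supp_u : ∀ k, k ≠ m → k ≠ m + s → u k = 0 ∧ u' k = 0 := by
    intro k h h'
    have f0 := hN k m
    have f1 := hN k (m + t)
    rw [hz k _ h h'] at f0 f1
    constructor
    · apply mul_left_cancel₀ hV
      linear_combination v' m * f1 - v' (m + t) * f0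
    · apply mul_left_cancel₀ hV
      linear_combination v m * f1 - v (m + t) * f0
  have supp_v : ∀ k, k ≠ m → k ≠ m + t → v k = 0 ∧ v' k = 0 := by
    intro k h h'
    have f0 := hN m k
    have f1 := hN (m + s) k
    rw [hz' _ k h h'] at f0 f1
    constructor
    · apply mul_left_cancel₀ hU
      linear_combination u' m * f1 - u' (m + s) * f0
    · apply mul_left_cancel₀ hU
      linear_combination u m * f1 - u (m + s) * f0
  have both_u : u m ≠ 0 → u (m + s) ≠ 0 → s + s = 0 := by
    intro a b
    have a' := mt (hu m).1 a
    have b' := mt (hu _).1 b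
    have h1 : m + s' = m + s := by
      by_contra h
      exact a' (supp_u _ (by simpa using hs') h).2
    have h2 : m + s + s' = m := by
      by_contra h
      exact b' (supp_u _ h (by simpa using hs')).2
    linear_combination (norm := module) h2 - h1
  have both_v : v m ≠ 0 → v (m + t) ≠ 0 → t + t = 0 := by
    intro a b
    have a' := mt (hv m).1 a
    have b' := mt (hv _).1 b
    have h1 : m + t' = m + t := by
      by_contra h
      exact a' (supp_v _ (by simpa using ht') h).2
    have h2 : m + t + t' = m := by
      by_contra h
      exact b' (supp_v _ h (by simpa using ht')).2
    linear_combination (norm := module) h2 - h1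
  have fin_u : u m = 0 ∨ u (m + s) = 0 → ∃ k, ∀ l ≠ k, u l = 0 := by
    rintro (h | h)
    · exact ⟨m + s, fun l hl => if h' : l = m then h' ▸ h else (supp_u l h' hl).1⟩
    · exact ⟨m, fun l hl => if h' : l = m + s then h' ▸ h else (supp_u l hl h').1⟩
  have fin_v : v m = 0 ∨ v (m + t) = 0 → ∃ k, ∀ l ≠ k, v l = 0 := by
    rintro (h | h)
    · exact ⟨m + t, fun l hl => if h' : l = m then h' ▸ h else (supp_v l h' hl).1⟩
    · exact ⟨m, fun l hl => if h' : l = m + t then h' ▸ h else (supp_v l hl h').1⟩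
  have hu' : ∀ k, u' k = 0 ↔ u (k - s') = 0 := fun k => by simpa using hu (k - s')
  have hv' : ∀ k, v' k = 0 ↔ v (k - t') = 0 := fun k => by simpa using hv (k - t')
  have uv : (v m = 0 ∨ v (m + t) = 0) → u m = 0 ∨ u (m + s) = 0 := by
    rintro (h | h)
    · have h' : v' (m + t) = 0 := by
        rw [hv']
        by_cases h1 : m + t - t' = m
        · rw [h1, h]
        · exact (supp_v _ h1 (by grind)).1
      have : u m * v (m + t) = 0 := by rw [h'] at e01; linear_combination -e01
      rcases mul_eq_zero.1 this with h2 | h2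
      · exact Or.inl h2
      · simp [h, h2] at hV
    · have h' : v' m = 0 := by
        rw [hv']
        by_cases h1 : m - t' = m + t
        · rw [h1, h]
        · exact (supp_v _ (by grind) h1).1
      have : u (m + s) * v m = 0 := by rw [h'] at e10; linear_combination -e10
      rcases mul_eq_zero.1 this with h2 | h2
      · exact Or.inr h2
      · simp [h', h2] at hV
  have vu : (u m = 0 ∨ u (m + s) = 0) → v m = 0 ∨ v (m + t) = 0 := by
    rintro (h | h)
    · have h' : u' (m + s) = 0 := by
        rw [hu']
        by_cases h1 : m + s - s' = m
        · rw [h1, h]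
        · exact (supp_u _ h1 (by grind)).1
      have : u (m + s) * v m = 0 := by rw [h'] at e10; linear_combination -e10
      rcases mul_eq_zero.1 this with h2 | h2
      · simp [h, h2] at hU
      · exact Or.inl h2
    · have h' : u' m = 0 := by
        rw [hu']
        by_cases h1 : m - s' = m + s
        · rw [h1, h]
        · exact (supp_u _ (by grind) h1).1
      have : u m * v (m + t) = 0 := by rw [h'] at e01; linear_combination -e01
      rcases mul_eq_zero.1 this with h2 | h2
      · simp [h', h2] at hU
      · exact Or.inr h2
  have or_uv : (u m = 0 ∨ u (m + s) = 0) ∨ (v m = 0 ∨ v (m + t) = 0) := by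
    by_contra! h
    exact hst (hinv s t (both_u h.1.1 h.1.2) (both_v h.2.1 h.2.2) hs ht)
  rcases or_uv with h | h
  · exact ⟨fin_u h, fin_v (vu h)⟩
  · exact ⟨fin_u (uv h), fin_v h⟩

end Bidiagonal

section Expansion

variable {F L : Type*} [Field F] [Field L] [Algebra F L]

theorem sum_aut_ext [Finite L] {a b : Gal(L/F) → L} (h : ∀ x, ∑ g, a g * g x = ∑ g, b g * g x) :
    a = b := by
  have hli := (linearIndependent_toLinearMap F L L).comp
    (fun g : Gal(L/F) => (g : L →ₐ[F] L)) (fun g g' h => AlgEquiv.ext fun x => DFunLike.congr_fun h x)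
  rw [Fintype.linearIndependent_iff] at hli
  funext g
  refine sub_eq_zero.1 (hli (fun g => a g - b g) (LinearMap.ext fun x => ?_) g)
  simp [sub_mul, Finset.sum_sub_distrib, h x]

theorem exists_sum_aut [Finite F] [Finite L] (f : L →ₗ[F] L) :
    ∃ a : Gal(L/F) → L, ∀ x, f x = ∑ g, a g * g x := by
  have hli := (linearIndependent_toLinearMap F L L).comp
    (fun g : Gal(L/F) => (g : L →ₐ[F] L)) (fun g g' h => AlgEquiv.ext fun x => DFunLike.congr_fun h x)
  have hspan := hli.span_eq_top_of_card_eq_finrank' (by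
    rw [Module.finrank_linearMap_self, ← IsGalois.card_aut_eq_finrank, Nat.card_eq_fintype_card])
  have hf : f ∈ (⊤ : Submodule L (L →ₗ[F] L)) := trivial
  rw [← hspan, Submodule.mem_span_range_iff_exists_fun] at hf
  obtain ⟨a, ha⟩ := hf
  exact ⟨a, fun x => by simp [← ha]⟩

theorem sum_aut_ext₂ [Finite L] {M N : Gal(L/F) → Gal(L/F) → L}
    (h : ∀ x y, ∑ g, ∑ g', M g g' * g x * g' y = ∑ g, ∑ g', N g g' * g x * g' y) : M = N := by
  have h1 : ∀ y, (fun g => ∑ g', M g g' * g' y) = fun g => ∑ g', N g g' * g' y := fun y => by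
    apply sum_aut_ext (F := F)
    intro x
    simpa only [Finset.sum_mul, mul_right_comm] using h x y
  funext g
  exact sum_aut_ext (F := F) fun y => congrFun (h1 y) g

theorem norm_eq_one_of_prod_zpowers [Finite L] [Finite F] (D : Gal(L/F)) {c : L}
    (h : ∏ i ∈ Finset.range (orderOf D), (D ^ i) c = 1) : Algebra.norm F c = 1 := by
  classical
  let K := IntermediateField.fixedField (Subgroup.zpowers D)
  have hK : K.fixingSubgroup = Subgroup.zpowers D := IntermediateField.fixingSubgroup_fixedField _
  have h1 : Algebra.norm K c = 1 := by
    apply (algebraMap K L).injective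
    rw [Algebra.norm_eq_prod_automorphisms, map_one, ← h, Finset.prod_range]
    symm
    refine Fintype.prod_equiv ((finEquivZPowers (isOfFinOrder_of_finite D)).trans
      ((MulEquiv.subgroupCongr hK.symm).trans K.fixingSubgroupEquiv).toEquiv) _ _ fun i => ?_
    rfl
  rw [← Algebra.norm_norm (S := K), h1, map_one]

end Expansion

section Twist

variable (F L : Type*) [Field F] [Field L] [Algebra F L]

/-- The data `(c, s, t)` of a twisted multiplication `x y - c * s x * t y` on `L`. -/
@[ext] structure Twist where
  /-- the constant -/
  c : L
  /-- the left automorphism -/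
  s : Gal(L/F)
  /-- the right automorphism -/
  t : Gal(L/F)

variable {F L}

namespace Twist

/-- The twisted multiplication attached to `(c, s, t)`. -/
def mul (p : Twist F L) (x y : L) : L := x * y - p.c * p.s x * p.t y

/-- The twists giving generalized twisted fields that are not fields. -/
structure Valid (p : Twist F L) : Prop where
  s_ne : p.s ≠ 1
  t_ne : p.t ≠ 1
  s_ne_t : p.s ≠ p.t
  c_ne : p.c ≠ 0
  norm_ne : Algebra.norm F p.c ≠ 1

/-- The twist whose trilinear form is that of `p` with the first and third slots exchanged. -/
def rot (p : Twist F L) : Twist F L := ⟨p.s⁻¹ p.c, p.s⁻¹, p.s⁻¹ * p.t⟩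

/-- The opposite twist. -/
def op (p : Twist F L) : Twist F L := ⟨p.c, p.t, p.s⟩

theorem Valid.rot {p : Twist F L} (hp : p.Valid) : p.rot.Valid where
  s_ne := inv_ne_one.2 hp.s_ne
  t_ne := by rw [Twist.rot, Ne, inv_mul_eq_one]; exact hp.s_ne_t
  s_ne_t := by simpa [Twist.rot] using hp.t_ne
  c_ne := by simpa [Twist.rot] using hp.c_ne
  norm_ne := by rw [Twist.rot, Algebra.norm_eq_of_algEquiv]; exact hp.norm_ne

theorem Valid.op {p : Twist F L} (hp : p.Valid) : p.op.Valid :=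
  ⟨hp.t_ne, hp.s_ne, hp.s_ne_t.symm, hp.c_ne, hp.norm_ne⟩

theorem trace_mul (p : Twist F L) (x y z : L) :
    Algebra.trace F L (z * p.mul x y) = Algebra.trace F L (x * p.rot.mul z y) := by
  have h : Algebra.trace F L (z * (p.c * p.s x * p.t y)) =
      Algebra.trace F L (x * (p.s⁻¹ p.c * p.s⁻¹ z * p.s⁻¹ (p.t y))) := by
    rw [← Algebra.trace_eq_of_algEquiv p.s⁻¹]
    congr 1
    simp only [map_mul]
    rw [show p.s⁻¹ (p.s x) = x from p.s.symm_apply_apply x]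
    ring
  rw [Twist.mul, Twist.mul, mul_sub, mul_sub, map_sub, map_sub, h]
  congr 2
  ring

end Twist

/-- A map of the form `x ↦ u * g x` with `g` an automorphism of `L` over `F`. -/
def IsMono (F : Type*) {L : Type*} [Field F] [Field L] [Algebra F L] (f : L → L) : Prop :=
  ∃ (u : L) (g : Gal(L/F)), ∀ x, f x = u * g x

theorem isMono_of_support [Finite L] {f : L → L} {a : Gal(L/F) → L} (h : ∀ x, f x = ∑ g, a g * g x)
    {m : Gal(L/F)} (ha : ∀ g ≠ m, a g = 0) : IsMono F f :=
  ⟨a m, m, fun x => by rw [h, Finset.sum_eq_single m (fun g _ hg => by simp [ha g hg]) (by simp)]⟩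

variable [Finite F] [Finite L]

noncomputable local instance : CommGroup Gal(L/F) := IsCyclic.commGroup
noncomputable local instance : DecidableEq Gal(L/F) := Classical.decEq _
noncomputable local instance : DecidableEq (Additive Gal(L/F)) := Classical.decEq _

omit [Finite F] in
open Additive in
theorem bidiag_eq_of_isotopism (p p' : Twist F L) {A P Q : L → L} {α φ β : Additive Gal(L/F) → L}
    (hA : ∀ x, A x = ∑ g : Gal(L/F), α (ofMul g) * g x)
    (hP : ∀ x, P x = ∑ g : Gal(L/F), φ (ofMul g) * g x)
    (hQ : ∀ x, Q x = ∑ g : Gal(L/F), β (ofMul g) * g x)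
    (h : ∀ x y, A (p.mul x y) = p'.mul (P x) (Q y)) (k l : Additive Gal(L/F)) :
    bidiag α (fun g => g.toMul p.c) (ofMul p.s) (ofMul p.t) k l =
      φ k * β l - (p'.c * p'.s (φ (k - ofMul p'.s))) * p'.t (β (l - ofMul p'.t)) := by
  suffices H : (fun g g' : Gal(L/F) => bidiag α (fun g => g.toMul p.c) (ofMul p.s) (ofMul p.t)
        (ofMul g) (ofMul g')) = fun g g' => φ (ofMul g) * β (ofMul g') -
          (p'.c * p'.s (φ (ofMul g - ofMul p'.s))) * p'.t (β (ofMul g' - ofMul p'.t)) from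
    congrFun (congrFun H k.toMul) l.toMul
  apply sum_aut_ext₂ (F := F)
  intro x y
  have hsum : ∀ (R : L → L) (ψ : Additive Gal(L/F) → L) (r : Gal(L/F)) (z : L),
      (∀ x, R x = ∑ g : Gal(L/F), ψ (ofMul g) * g x) →
      r (R z) = ∑ g : Gal(L/F), r (ψ (ofMul g - ofMul r)) * g z := by
    intro R ψ r z hR
    rw [hR, map_sum]
    refine Fintype.sum_equiv (Equiv.mulRight r) _ _ fun g => ?_
    rw [map_mul]
    have e1 : (ofMul (Equiv.mulRight r g) - ofMul r : Additive Gal(L/F)) = ofMul g := by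
      simp
    rw [e1, show Equiv.mulRight r g = r * g from mul_comm g r]
    rfl
  have hl : ∑ g : Gal(L/F), ∑ g' : Gal(L/F), bidiag α (fun g => g.toMul p.c) (ofMul p.s) (ofMul p.t)
      (ofMul g) (ofMul g') * g x * g' y = A (p.mul x y) := by
    simp only [bidiag, sub_mul, Finset.sum_sub_distrib, Twist.mul, hA, map_sub, mul_sub, ite_mul,
      zero_mul]
    congr 1
    · refine Finset.sum_congr rfl fun g _ => ?_
      rw [Finset.sum_eq_single g (fun g' _ hg => if_neg fun h => hg (ofMul.injective h).symm)
        (by simp)]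
      simp [mul_assoc]
    · symm
      refine Fintype.sum_equiv (Equiv.mulRight p.s) _ _ fun g => ?_
      rw [Finset.sum_eq_single (g * p.t) (fun g' _ hg => if_neg fun h => hg ?_) (by simp)]
      · rw [if_pos]
        · simp
          ring
        · simp
      · apply ofMul.injective
        rw [h]
        simp
  have hr : ∑ g : Gal(L/F), ∑ g' : Gal(L/F), (φ (ofMul g) * β (ofMul g') -
          (p'.c * p'.s (φ (ofMul g - ofMul p'.s))) * p'.t (β (ofMul g' - ofMul p'.t))) * g x * g' y
      = p'.mul (P x) (Q y) := by
    simp only [Twist.mul, sub_mul, Finset.sum_sub_distrib, hsum P φ p'.s x hP,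
      hsum Q β p'.t y hQ]
    rw [hP, hQ, Finset.sum_mul_sum, mul_assoc p'.c, Finset.sum_mul_sum, Finset.mul_sum]
    simp only [Finset.mul_sum]
    congr 1
    · exact Finset.sum_congr rfl fun g _ => Finset.sum_congr rfl fun g' _ => by ring
    · exact Finset.sum_congr rfl fun g _ => Finset.sum_congr rfl fun g' _ => by ring
  rw [hl, hr, h]

/-- The triple `(A, P, Q)` is an isotopism between the multiplications of `p` and `p'`. -/
def IsIsotopism (p p' : Twist F L) (A P Q : L ≃ₗ[F] L) : Prop :=
  ∀ x y, A (p.mul x y) = p'.mul (P x) (Q y)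

omit [Finite F] [Finite L] in
theorem IsIsotopism.symm {p p' : Twist F L} {A P Q : L ≃ₗ[F] L} (h : IsIsotopism p p' A P Q) :
    IsIsotopism p' p A.symm P.symm Q.symm := fun x y => by
  rw [LinearEquiv.symm_apply_eq, h, LinearEquiv.apply_symm_apply, LinearEquiv.apply_symm_apply]

theorem eq_of_mul_self_eq_one {G : Type*} [Group G] [Finite G] [IsCyclic G] {a b : G}
    (ha : a * a = 1) (hb : b * b = 1) (ha' : a ≠ 1) (hb' : b ≠ 1) : a = b := by
  classical
  have := Fintype.ofFinite G
  by_contra hab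
  have h := IsCyclic.card_pow_eq_one_le (α := G) (n := 2) (by norm_num)
  have h3 : ({1, a, b} : Finset G).card = 3 := by
    rw [Finset.card_insert_of_notMem (by simp [ha'.symm, hb'.symm]), Finset.card_pair hab]
  have hsub : ({1, a, b} : Finset G) ⊆ Finset.univ.filter (fun a => a ^ 2 = 1) := by
    intro x hx
    simp only [Finset.mem_insert, Finset.mem_singleton] at hx
    rcases hx with rfl | rfl | rfl <;> simp [sq, *]
  have := Finset.card_le_card hsub
  omega

omit [Finite F] in
theorem add_involution_unique (a b : Additive Gal(L/F)) (ha : a + a = 0) (hb : b + b = 0)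
    (ha' : a ≠ 0) (hb' : b ≠ 0) : a = b :=
  eq_of_mul_self_eq_one (G := Gal(L/F)) ha hb ha' hb'

theorem Twist.Valid.three {p : Twist F L} (hp : p.Valid)
    (h : p.s * p.s * p.s = 1) (m : Gal(L/F)) :
    m p.c * (m * p.s) p.c * (m * p.s * p.s) p.c ≠ 1 := by
  intro he
  have ho : orderOf p.s = 3 := orderOf_eq_prime (by rw [← h, pow_succ, sq]) hp.s_ne
  refine hp.norm_ne (norm_eq_one_of_prod_zpowers p.s (m.injective ?_))
  rw [ho, map_one, ← he]
  simp [Finset.prod_range_succ]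

theorem Twist.Valid.four {p : Twist F L} (hp : p.Valid)
    (h : p.s * p.s * p.s * p.s = 1) (h2 : p.s * p.s ≠ 1) (m : Gal(L/F)) :
    m p.c * (m * p.s) p.c * (m * p.s * p.s) p.c * (m * p.s * p.s * p.s) p.c ≠ 1 := by
  intro he
  have ho : orderOf p.s = 2 ^ (1 + 1) :=
    orderOf_eq_prime_pow (by simpa [sq] using h2) (by rw [← h]; simp [pow_succ])
  refine hp.norm_ne (norm_eq_one_of_prod_zpowers p.s (m.injective ?_))
  rw [ho, map_one, ← he]
  simp [Finset.prod_range_succ, pow_succ]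

open Additive in
theorem IsIsotopism.isMono_or {p p' : Twist F L} {A P Q : L ≃ₗ[F] L} (hp : p.Valid)
    (h : IsIsotopism p p' A P Q) : IsMono F A ∨ ∃ (m D : Gal(L/F)) (a b : L), D ≠ 1 ∧ a ≠ 0 ∧ b ≠ 0 ∧
      (D = p.s ∨ D = p.t) ∧ (D⁻¹ = p.s ∨ D⁻¹ = p.t) ∧ ∀ x, A x = a * m x + b * m (D x) := by
  obtain ⟨α, hα⟩ := exists_sum_aut A.toLinearMap
  obtain ⟨φ, hφ⟩ := exists_sum_aut P.toLinearMap
  obtain ⟨β, hβ⟩ := exists_sum_aut Q.toLinearMap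
  have hN := bidiag_eq_of_isotopism p p' (A := A) (P := P) (Q := Q) (α := fun g => α g.toMul)
    (φ := fun g => φ g.toMul) (β := fun g => β g.toMul) hα hφ hβ h
  have hs : ofMul p.s ≠ 0 := hp.s_ne
  have ht : ofMul p.t ≠ 0 := hp.t_ne
  have hst : ofMul p.s ≠ ofMul p.t := hp.s_ne_t
  by_cases hex : ∃ m₁ m₂ : Additive Gal(L/F), m₁ ≠ m₂ ∧ α m₁.toMul ≠ 0 ∧ α m₂.toMul ≠ 0
  · obtain ⟨m₁, m₂, hm, h₁, h₂⟩ := hex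
    obtain ⟨k1, k2, k3⟩ := bidiag_support hs ht hst (fun m => by simpa using hp.c_ne)
      add_involution_unique (fun h m => hp.three h m.toMul) (fun h h' m => hp.four h h' m.toMul)
      hN hm h₁ h₂
    right
    refine ⟨m₁.toMul, m₁.toMul⁻¹ * m₂.toMul, α m₁.toMul, α m₂.toMul, ?_, h₁, h₂, ?_, ?_, fun x => ?_⟩
    · rw [Ne, inv_mul_eq_one]; exact hm
    · rcases k1 with rfl | rfl
      · left; simp
      · right; simp
    · rcases k2 with rfl | rfl
      · left; simp
      · right; simp
    · change A.toLinearMap x = _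
      rw [hα, Finset.sum_eq_add_of_mem m₁.toMul m₂.toMul (Finset.mem_univ _) (Finset.mem_univ _) hm]
      · simp [← AlgEquiv.mul_apply]
      · intro c _ hc
        rw [show α c = 0 from by_contra fun hc' => (k3 (ofMul c) hc').elim hc.1 hc.2, zero_mul]
  · left
    push Not at hex
    by_cases hz : ∃ m, α m ≠ 0
    · obtain ⟨m, hm⟩ := hz
      exact isMono_of_support (f := A) hα (m := m) fun g hg => hex (ofMul m) (ofMul g) hg.symm hm
    · push Not at hz
      exact isMono_of_support (f := A) hα (m := 1) fun g _ => hz g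

omit [Finite F] in
theorem four_terms {e₁ e₂ e₃ e₄ : Gal(L/F)} {w₁ w₂ w₃ w₄ : L} (h₁ : w₁ ≠ 0) (h₂ : w₂ ≠ 0)
    (h₃ : w₃ ≠ 0) (h₄ : w₄ ≠ 0) (h12 : e₁ ≠ e₂) (h13 : e₁ ≠ e₃) (h42 : e₄ ≠ e₂) (h43 : e₄ ≠ e₃)
    (hne : ¬ (e₁ = e₄ ∧ e₂ = e₃))
    (h : ∀ x, w₁ * e₁ x + w₂ * e₂ x + w₃ * e₃ x + w₄ * e₄ x = x) : False := by
  classical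
  have key : (fun g => Pi.single (M := fun _ => L) e₁ w₁ g + Pi.single (M := fun _ => L) e₂ w₂ g +
      Pi.single (M := fun _ => L) e₃ w₃ g + Pi.single (M := fun _ => L) e₄ w₄ g) =
      Pi.single (M := fun _ => L) (1 : Gal(L/F)) 1 := by
    apply sum_aut_ext (F := F)
    intro x
    simp [Pi.single_apply, add_mul, Finset.sum_add_distrib, h]
  by_cases h14 : e₁ = e₄
  · have h23 : e₂ ≠ e₃ := fun h => hne ⟨h14, h⟩
    have k2 := congrFun key e₂
    have k3 := congrFun key e₃
    simp only [Pi.single_apply, h12.symm, h23, h42.symm, h13.symm, h23.symm, h43.symm, if_false, if_true] at k2 k3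
    have a2 : e₂ = 1 := by by_contra hc; simp [hc, h₂] at k2
    have a3 : e₃ = 1 := by by_contra hc; simp [hc, h₃] at k3
    exact h23 (a2.trans a3.symm)
  · have k1 := congrFun key e₁
    have k4 := congrFun key e₄
    simp only [Pi.single_apply, h12, h13, h42, h43, h14, Ne.symm h14, if_false, if_true] at k1 k4
    have a1 : e₁ = 1 := by by_contra hc; simp [hc, h₁] at k1
    have a4 : e₄ = 1 := by by_contra hc; simp [hc, h₄] at k4
    exact h14 (a1.trans a4.symm)

omit [Finite F] [Finite L] in
theorem IsMono.symm {f : L ≃ₗ[F] L} (h : IsMono F f) : IsMono F f.symm := by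
  obtain ⟨u, g, hf⟩ := h
  have hu : u ≠ 0 := fun hu => f.map_ne_zero_iff.2 one_ne_zero (by simpa [hu] using hf 1)
  refine ⟨g.symm u⁻¹, g.symm, fun x => ?_⟩
  rw [LinearEquiv.symm_apply_eq, hf]
  simp [hu]

theorem IsIsotopism.isMono_of_sq_ne {p p' : Twist F L} {A P Q : L ≃ₗ[F] L} (hp : p.Valid)
    (hp' : p'.Valid) (h : IsIsotopism p p' A P Q) (hs : p.s * p.s ≠ 1) (ht : p.t * p.t ≠ 1) :
    IsMono F A := by
  rcases h.isMono_or hp with h1 | ⟨m, D, a, b, hD1, ha, hb, hD, -, hA⟩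
  · exact h1
  rcases h.symm.isMono_or hp' with h1 | ⟨m', D', a', b', hD1', ha', hb', -, -, hA'⟩
  · exact h1.symm
  exfalso
  have hDD : D * D ≠ 1 := by rcases hD with rfl | rfl <;> assumption
  have hcomm : ∀ (g g' : Gal(L/F)) x, g (g' x) = g' (g x) := fun g g' x => by
    rw [← AlgEquiv.mul_apply, ← AlgEquiv.mul_apply, show g * g' = g' * g from mul_comm g g']
  refine four_terms (e₁ := m * m') (e₂ := m * m' * D') (e₃ := m * m' * D) (e₄ := m * m' * D * D')
    (w₁ := a * m a') (w₂ := a * m b') (w₃ := b * m (D a')) (w₄ := b * m (D b'))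
    (by simp [ha, ha']) (by simp [ha, hb']) (by simp [hb, ha']) (by simp [hb, hb'])
    (by simpa using hD1') (by simpa using hD1) ?_ (by simpa using hD1') ?_ ?_
  · rw [Ne, mul_assoc _ D D', show D * D' = D' * D from mul_comm D D', ← mul_assoc]
    simpa using hD1
  · rintro ⟨h1, h2⟩
    have h2 : D' = D := by simpa using h2
    subst h2
    rw [mul_assoc (m * m')] at h1
    simp [hDD] at h1
  · intro x
    conv_rhs => rw [← A.apply_symm_apply x]
    rw [hA, hA']
    simp [hcomm D m']
    ring

omit [Finite F] in
theorem exists_coef_ne_zero {f : L ≃ₗ[F] L} {a : Gal(L/F) → L}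
    (h : ∀ x, f x = ∑ g, a g * g x) : ∃ g, a g ≠ 0 := by
  by_contra! hz
  exact f.map_ne_zero_iff.2 one_ne_zero (by simpa [hz] using h 1)

omit [Finite F] in
theorem mono_eq_sum {f : L → L} {u : L} {g : Gal(L/F)} (h : ∀ x, f x = u * g x) (x : L) :
    f x = ∑ k, (if k = g then u else 0) * k x := by
  simp [h]

open Additive in
theorem IsIsotopism.isMono_of_isMono {p p' : Twist F L} {A P Q : L ≃ₗ[F] L} (hp : p.Valid)
    (hp' : p'.Valid) (h : IsIsotopism p p' A P Q) (hA : IsMono F A) :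
    IsMono F P ∧ IsMono F Q := by
  obtain ⟨a, m, hA⟩ := hA
  obtain ⟨φ, hφ⟩ := exists_sum_aut P.toLinearMap
  obtain ⟨β, hβ⟩ := exists_sum_aut Q.toLinearMap
  have ha : a ≠ 0 := by
    rintro rfl
    exact A.map_ne_zero_iff.2 one_ne_zero (by simpa using hA 1)
  have hN := bidiag_eq_of_isotopism p p' (A := A) (P := P) (Q := Q)
    (α := fun g => if g.toMul = m then a else 0)
    (φ := fun g => φ g.toMul) (β := fun g => β g.toMul) (mono_eq_sum hA) hφ hβ h
  obtain ⟨⟨k, hk⟩, l, hl⟩ := bidiag_single (m := ofMul m) (s' := ofMul p'.s) (t' := ofMul p'.t)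
    (show ofMul p.s ≠ 0 from hp.s_ne)
    (show ofMul p.t ≠ 0 from hp.t_ne) (show ofMul p.s ≠ ofMul p.t from hp.s_ne_t)
    (fun m => by simpa using hp.c_ne) (show ofMul p'.s ≠ 0 from hp'.s_ne)
    (show ofMul p'.t ≠ 0 from hp'.t_ne) add_involution_unique hN (by simp [hp'.c_ne]) (by simp)
    (by simpa using ha) (fun k hk => if_neg hk)
  exact ⟨isMono_of_support (f := P) hφ (m := k.toMul) fun g hg => hk (ofMul g) hg,
    isMono_of_support (f := Q) hβ (m := l.toMul) fun g hg => hl (ofMul g) hg⟩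

open Additive in
theorem IsIsotopism.c_ne_zero {p p' : Twist F L} {A P Q : L ≃ₗ[F] L} (hp : p.Valid)
    (h : IsIsotopism p p' A P Q) : p'.c ≠ 0 := by
  intro hc
  obtain ⟨α, hα⟩ := exists_sum_aut A.toLinearMap
  obtain ⟨φ, hφ⟩ := exists_sum_aut P.toLinearMap
  obtain ⟨β, hβ⟩ := exists_sum_aut Q.toLinearMap
  have hN := bidiag_eq_of_isotopism p p' (A := A) (P := P) (Q := Q) (α := fun g => α g.toMul)
    (φ := fun g => φ g.toMul) (β := fun g => β g.toMul) hα hφ hβ h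
  obtain ⟨g, hg⟩ := exists_coef_ne_zero (f := A) hα
  simp only [hc, zero_mul, sub_zero] at hN
  exact hg (bidiag_rank_one (show ofMul p.s ≠ 0 from hp.s_ne)
    (show ofMul p.t ≠ 0 from hp.t_ne) (show ofMul p.s ≠ ofMul p.t from hp.s_ne_t)
    (fun m => by simpa using hp.c_ne) hN (ofMul g))

open Additive in
theorem isMono_of_map_mul {A P Q : L ≃ₗ[F] L} (h : ∀ x y, A (x * y) = P x * Q y) :
    IsMono F A ∧ IsMono F P ∧ IsMono F Q := by
  obtain ⟨α, hα⟩ := exists_sum_aut A.toLinearMap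
  obtain ⟨φ, hφ⟩ := exists_sum_aut P.toLinearMap
  obtain ⟨β, hβ⟩ := exists_sum_aut Q.toLinearMap
  let p : Twist F L := ⟨0, 1, 1⟩
  have hN := bidiag_eq_of_isotopism p p (A := A) (P := P) (Q := Q) (α := fun g => α g.toMul)
    (φ := fun g => φ g.toMul) (β := fun g => β g.toMul) hα hφ hβ (by simpa [p, Twist.mul] using h)
  obtain ⟨k, hk⟩ := exists_coef_ne_zero (f := P) hφ
  obtain ⟨l, hl⟩ := exists_coef_ne_zero (f := Q) hβ
  have key : ∀ k l, φ k ≠ 0 → β l ≠ 0 → k = l := by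
    intro k l hk hl
    by_contra hkl
    have := hN (ofMul k) (ofMul l)
    simp [p, bidiag, hkl, hk, hl] at this
  have hP : IsMono F P := isMono_of_support (f := P) hφ (m := l) fun g hg => by
    by_contra hc
    exact hg (key g l hc hl)
  have hQ : IsMono F Q := isMono_of_support (f := Q) hβ (m := k) fun g hg => by
    by_contra hc
    exact hg (key k g hk hc).symm
  refine ⟨?_, hP, hQ⟩
  obtain ⟨u, g, hu⟩ := hP
  exact ⟨u * Q 1, g, fun x => by rw [← mul_one x, h, hu]; simp; ring⟩

omit [Finite F] [Finite L] in
theorem IsIsotopism.op {p p' : Twist F L} {A P Q : L ≃ₗ[F] L} (h : IsIsotopism p p' A P Q) :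
    IsIsotopism p.op p'.op A Q P := fun x y => by
  have h1 := h y x
  simp only [Twist.mul, Twist.op] at *
  rw [mul_comm x y, mul_right_comm, h1]
  ring

theorem eq_of_trace_mul {a b : L}
    (h : ∀ x, Algebra.trace F L (x * a) = Algebra.trace F L (x * b)) : a = b := by
  refine sub_eq_zero.1 ((traceForm_nondegenerate F L).1 _ fun x => ?_)
  rw [Algebra.traceForm_apply, sub_mul, map_sub, mul_comm, h, mul_comm, sub_self]

theorem exists_adjoint (f : L ≃ₗ[F] L) : ∃ f' : L ≃ₗ[F] L,
    ∀ x y, Algebra.trace F L (f x * y) = Algebra.trace F L (x * f' y) := by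
  let φ := LinearMap.BilinForm.leftAdjointOfNondegenerate (Algebra.traceForm F L)
    (traceForm_nondegenerate F L) f.toLinearMap
  have hφ : ∀ x y, Algebra.trace F L (f x * y) = Algebra.trace F L (x * φ y) := fun x y => by
    have := LinearMap.BilinForm.isAdjointPairLeftAdjointOfNondegenerate (Algebra.traceForm F L)
      (traceForm_nondegenerate F L) f.toLinearMap y x
    simp only [Algebra.traceForm_apply] at this
    rw [mul_comm x, mul_comm (f x)]
    exact this.symm
  have hinj : Function.Injective φ := by
    rw [← LinearMap.ker_eq_bot, LinearMap.ker_eq_bot']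
    intro y hy
    apply eq_of_trace_mul (F := F)
    intro x
    rw [← f.apply_symm_apply x, hφ, hy]
    simp
  exact ⟨LinearEquiv.ofInjectiveEndo φ hinj, hφ⟩

theorem isMono_of_adjoint {f f' : L → L}
    (h : ∀ x y, Algebra.trace F L (f x * y) = Algebra.trace F L (x * f' y)) (hf : IsMono F f') :
    IsMono F f := by
  obtain ⟨u, g, hu⟩ := hf
  refine ⟨g.symm u, g.symm, fun x => eq_of_trace_mul (F := F) fun y => ?_⟩
  rw [mul_comm, h, hu, ← Algebra.trace_eq_of_algEquiv g.symm]
  simp only [map_mul, AlgEquiv.symm_apply_apply]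
  congr 1
  ring

theorem IsIsotopism.isMono {p p' : Twist F L} {A P Q : L ≃ₗ[F] L} (hp : p.Valid)
    (hp' : p'.Valid) (h : IsIsotopism p p' A P Q) : IsMono F A ∧ IsMono F P ∧ IsMono F Q := by
  suffices hA : IsMono F A from ⟨hA, h.isMono_of_isMono hp hp' hA⟩
  have main : ∀ {p p' : Twist F L} {A P Q : L ≃ₗ[F] L}, p.Valid → p'.Valid →
      IsIsotopism p p' A P Q → p.s * p.s ≠ 1 → IsMono F A := by
    intro p p' A P Q hp hp' h hs
    by_cases ht : p.t * p.t = 1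
    · obtain ⟨A', hA'⟩ := exists_adjoint A
      obtain ⟨P', hP'⟩ := exists_adjoint P
      have h' : IsIsotopism p.rot p'.rot P'.symm A'.symm Q := by
        intro z y
        rw [LinearEquiv.symm_apply_eq]
        apply eq_of_trace_mul (F := F)
        intro x
        rw [← hP', ← p.trace_mul, ← p'.trace_mul, ← h, mul_comm (A'.symm z), hA',
          A'.apply_symm_apply, mul_comm z]
      have h1 : IsMono F P'.symm := by
        refine h'.isMono_of_sq_ne hp.rot hp'.rot ?_ ?_
        · exact fun h => hs (inv_injective (by rw [mul_inv_rev, inv_one]; exact h))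
        · rw [Twist.rot, mul_mul_mul_comm, ht, mul_one]
          exact fun h => hs (inv_injective (by rw [mul_inv_rev, inv_one]; exact h))
      have h2 := (h'.isMono_of_isMono hp.rot hp'.rot h1).1.symm
      exact isMono_of_adjoint hA' (by simpa using h2)
    · exact h.isMono_of_sq_ne hp hp' hs ht
  by_cases hs : p.s * p.s = 1
  · exact main hp.op hp'.op h.op fun ht =>
      hp.s_ne_t (eq_of_mul_self_eq_one hs ht hp.s_ne hp.t_ne)
  · exact main hp hp' h hs

open Additive in
theorem IsIsotopism.params {p p' : Twist F L} {A P Q : L ≃ₗ[F] L} (hp : p.Valid)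
    (hp' : p'.Valid) (h : IsIsotopism p p' A P Q) {u v : L} {g k : Gal(L/F)}
    (hA : ∀ x, A x = u * g x) (hQ : ∀ x, Q x = v * k x) :
    (k = g ∧ p.s = p'.s ∧ p.t = p'.t ∧
      u * g p.c = p'.c * p'.s (u / v) * p'.t v) ∨
    (k = g * p'.t⁻¹ ∧ p.s = p'.s⁻¹ ∧ p.t = p'.t⁻¹ ∧
      -u = p'.c * p'.s (-(u * g p.c) / v) * p'.t v) := by
  obtain ⟨w, l, hP⟩ := (h.isMono hp hp').2.1
  have hN := bidiag_eq_of_isotopism p p' (A := A) (P := P) (Q := Q)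
    (α := fun i => if i.toMul = g then u else 0)
    (φ := fun i => if i.toMul = l then w else 0) (β := fun i => if i.toMul = k then v else 0)
    (mono_eq_sum hA) (mono_eq_sum hP) (mono_eq_sum hQ) h
  have hu : u ≠ 0 := fun hu => A.map_ne_zero_iff.2 one_ne_zero (by simpa [hu] using hA 1)
  have hw : w ≠ 0 := fun hw => P.map_ne_zero_iff.2 one_ne_zero (by simpa [hw] using hP 1)
  have hv : v ≠ 0 := fun hv => Q.map_ne_zero_iff.2 one_ne_zero (by simpa [hv] using hQ 1)
  have hst : ofMul p.s ≠ ofMul p.t := hp.s_ne_t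
  have entry : ∀ i j : Gal(L/F), bidiag (fun i : Additive Gal(L/F) => if i.toMul = g then u else 0)
      (fun g => g.toMul p.c) (ofMul p.s) (ofMul p.t) (ofMul i) (ofMul j) ≠ 0 →
      i = g ∧ j = g ∨ i = g * p.s ∧ j = g * p.t := by
    intro i j hij
    by_cases h1 : i = j
    · subst h1
      rw [bidiag_diag hst] at hij
      left
      by_contra hc
      simp_all
    · by_cases h2 : ofMul j = ofMul i - ofMul p.s + ofMul p.t
      · rw [h2, bidiag_off hst] at hij
        have h3 : i / p.s = g := by
          by_contra hc
          simp [← ofMul_div, hc] at hij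
        have h4 : j = i / p.s * p.t := h2
        right
        exact ⟨by rw [← h3, div_mul_cancel], by rw [h4, h3]⟩
      · exact absurd (bidiag_eq_zero (k := ofMul i) (l := ofMul j) (fun h => h1 h) h2) hij
  have e1 := hN (ofMul l) (ofMul k)
  have e2 := hN (ofMul (l * p'.s)) (ofMul (k * p'.t))
  simp [← ofMul_div, hp'.s_ne, hp'.t_ne] at e1 e2
  have x1 := entry l k (by rw [e1]; exact mul_ne_zero hw hv)
  have x2 := entry (l * p'.s) (k * p'.t) (by
    rw [ofMul_mul, ofMul_mul, e2]
    simpa using ⟨⟨hp'.c_ne, hw⟩, hv⟩)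
  have d1 : bidiag (fun i : Additive Gal(L/F) => if i.toMul = g then u else 0)
      (fun g => g.toMul p.c) (ofMul p.s) (ofMul p.t) (ofMul g) (ofMul g) = u := by
    rw [bidiag_diag hst]
    simp
  have d2 : bidiag (fun i : Additive Gal(L/F) => if i.toMul = g then u else 0)
      (fun g => g.toMul p.c) (ofMul p.s) (ofMul p.t) (ofMul g + ofMul p.s)
      (ofMul g + ofMul p.t) = -(u * g p.c) := by
    rw [bidiag_shift hst]
    simp
  rcases x1 with ⟨rfl, rfl⟩ | ⟨hl, hk⟩
  · left
    rcases x2 with ⟨h1, -⟩ | ⟨h1, h2⟩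
    · exact absurd (by simpa using h1) hp'.s_ne
    · have hs : p'.s = p.s := mul_left_cancel h1
      have ht : p'.t = p.t := mul_left_cancel h2
      refine ⟨rfl, hs.symm, ht.symm, ?_⟩
      have hu' : u / v = w := by
        rw [div_eq_iff hv, ← e1, d1]
      rw [hu']
      rw [hs, ht, d2] at e2
      rw [hs, ht]
      exact neg_injective e2
  · right
    rcases x2 with ⟨h1, h2⟩ | ⟨h1, -⟩
    · have hs : p.s = p'.s⁻¹ := by
        rw [hl, mul_assoc, mul_eq_left] at h1
        exact eq_inv_of_mul_eq_one_left h1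
      have ht : p.t = p'.t⁻¹ := by
        rw [hk, mul_assoc, mul_eq_left] at h2
        exact eq_inv_of_mul_eq_one_left h2
      refine ⟨by rw [hk, ht], hs, ht, ?_⟩
      have hw' : -(u * g p.c) / v = w := by
        rw [div_eq_iff hv, ← e1, hl, hk, ofMul_mul, ofMul_mul, d2]
      rw [hw']
      rw [← ofMul_mul, ← ofMul_mul, h1, h2, d1] at e2
      rw [e2, neg_neg]
    · exact absurd (by simpa [hl] using h1) hp'.s_ne

end Twist

section Counting

variable {F L : Type*} [Field F] [Field L] [Algebra F L] [Finite F] [Finite L]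

theorem IsIsotopism.unique {p₁ p₂ p' : Twist F L} {A P₁ P₂ Q₁ Q₂ : L ≃ₗ[F] L} (hp₁ : p₁.Valid)
    (hp₂ : p₂.Valid) (hp' : p'.Valid) (h₁ : IsIsotopism p₁ p' A P₁ Q₁)
    (h₂ : IsIsotopism p₂ p' A P₂ Q₂) {u v : L} {g k₁ k₂ : Gal(L/F)} (hA : ∀ x, A x = u * g x)
    (hQ₁ : ∀ x, Q₁ x = v * k₁ x) (hQ₂ : ∀ x, Q₂ x = v * k₂ x) (hk : k₁ = g ↔ k₂ = g) :
    p₁ = p₂ ∧ Q₁ = Q₂ := by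
  have hu : u ≠ 0 := fun hu => A.map_ne_zero_iff.2 one_ne_zero (by simpa [hu] using hA 1)
  have hv : v ≠ 0 := fun hv => Q₁.map_ne_zero_iff.2 one_ne_zero (by simpa [hv] using hQ₁ 1)
  have ht : g * p'.t⁻¹ ≠ g := by simpa using hp'.t_ne
  suffices H : p₁ = p₂ ∧ k₁ = k₂ from
    ⟨H.1, LinearEquiv.ext fun x => by rw [hQ₁, hQ₂, H.2]⟩
  rcases h₁.params hp₁ hp' hA hQ₁ with ⟨a1, a2, a3, a4⟩ | ⟨a1, a2, a3, a4⟩ <;>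
  rcases h₂.params hp₂ hp' hA hQ₂ with ⟨b1, b2, b3, b4⟩ | ⟨b1, b2, b3, b4⟩
  · exact ⟨Twist.ext (g.injective (mul_left_cancel₀ hu (a4.trans b4.symm))) (a2.trans b2.symm)
      (a3.trans b3.symm), a1.trans b1.symm⟩
  · exact absurd (b1.symm.trans (hk.1 a1)) ht
  · exact absurd (a1.symm.trans (hk.2 b1)) ht
  · refine ⟨Twist.ext ?_ (a2.trans b2.symm) (a3.trans b3.symm), a1.trans b1.symm⟩
    have h := a4.symm.trans b4
    have h := mul_left_cancel₀ hp'.c_ne (mul_right_cancel₀ (by simpa using hv) h)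
    have h := p'.s.injective h
    rw [div_left_inj' hv] at h
    exact g.injective (mul_left_cancel₀ hu (neg_injective h))

/-- The twist of the field multiplication. -/
def Twist.field (F L : Type*) [Field F] [Field L] [Algebra F L] : Twist F L := ⟨0, 1, 1⟩

omit [Finite F] [Finite L] in
theorem Twist.field_mul (x y : L) : (Twist.field F L).mul x y = x * y := by
  simp [Twist.field, Twist.mul]

theorem IsIsotopism.field {A P Q : L ≃ₗ[F] L}
    (h : IsIsotopism (Twist.field F L) (Twist.field F L) A P Q) : ∃ (u v : L) (g : Gal(L/F)),
      (∀ x, A x = u * g x) ∧ ∀ x, Q x = v * g x := by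
  simp only [IsIsotopism, Twist.field_mul] at h
  obtain ⟨⟨u, g, hu⟩, -, v, k, hv⟩ := isMono_of_map_mul h
  refine ⟨u, v, g, hu, fun x => ?_⟩
  have hu0 : u ≠ 0 := fun hu0 => A.map_ne_zero_iff.2 one_ne_zero (by simpa [hu0] using hu 1)
  have h1 := h 1 1
  have h2 := h 1 x
  rw [hv, hu] at h1 h2
  simp only [map_one, mul_one, one_mul] at h1 h2
  rw [← mul_assoc, ← h1] at h2
  rw [hv, mul_left_cancel₀ hu0 h2]

namespace Twist

/-- The linear map `a ↦ A ∘ (y ↦ p.mul a y) ∘ B`. -/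
def codeMap (p : Twist F L) (A B : L ≃ₗ[F] L) : L →ₗ[F] Module.End F L :=
  LinearMap.mk₂ F (fun a y => A (p.mul a (B y)))
    (fun a b y => by rw [← map_add]; congr 1; simp only [mul, map_add]; ring)
    (fun r a y => by rw [← map_smul]; congr 1; simp [mul, smul_sub])
    (fun a y z => by rw [← map_add]; congr 1; simp only [mul, map_add]; ring)
    (fun r a y => by rw [← map_smul]; congr 1; simp [mul, smul_sub])

omit [Finite F] [Finite L] in
theorem codeMap_apply (p : Twist F L) (A B : L ≃ₗ[F] L) (a y : L) :
    p.codeMap A B a y = A (p.mul a (B y)) := rfl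

/-- The twist has no zero divisors. -/
def NoZeroDiv (p : Twist F L) : Prop := ∀ x y, p.mul x y = 0 → x = 0 ∨ y = 0

omit [Finite F] [Finite L] in
theorem Valid.noZeroDiv {p : Twist F L} (hp : p.Valid) [FiniteDimensional F L] : p.NoZeroDiv := by
  intro x y h
  by_contra! hxy
  have h1 := congrArg (Algebra.norm F) (sub_eq_zero.1 h)
  simp only [map_mul, Algebra.norm_eq_of_algEquiv] at h1
  have hx := Algebra.norm_ne_zero_iff (R := F).2 hxy.1
  have hy := Algebra.norm_ne_zero_iff (R := F).2 hxy.2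
  apply hp.norm_ne
  apply mul_right_cancel₀ (mul_ne_zero hx hy)
  rw [one_mul, ← mul_assoc, ← h1]

omit [Finite F] [Finite L] in
theorem noZeroDiv_field : (field F L).NoZeroDiv := fun x y h => by
  rwa [field_mul, mul_eq_zero] at h

omit [Finite F] [Finite L] in
theorem NoZeroDiv.codeMap_injective {p : Twist F L} (hp : p.NoZeroDiv) (A B : L ≃ₗ[F] L) :
    Function.Injective (p.codeMap A B) := by
  rw [← LinearMap.ker_eq_bot, LinearMap.ker_eq_bot']
  intro a ha
  have h := DFunLike.congr_fun ha (B.symm 1)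
  rw [codeMap_apply, B.apply_symm_apply, LinearMap.zero_apply, A.map_eq_zero_iff] at h
  exact (hp _ _ h).resolve_right one_ne_zero

omit [Finite F] in
theorem NoZeroDiv.isUnit_codeMap {p : Twist F L} (hp : p.NoZeroDiv) (A B : L ≃ₗ[F] L) {a : L}
    (ha : a ≠ 0) : IsUnit (p.codeMap A B a) := by
  have := Module.Finite.of_finite (R := F) (M := L)
  rw [LinearMap.isUnit_iff_ker_eq_bot, LinearMap.ker_eq_bot']
  intro y hy
  rw [codeMap_apply, A.map_eq_zero_iff] at hy
  exact B.map_eq_zero_iff.1 ((hp _ _ hy).resolve_left ha)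

end Twist

/-- A full-rank MRD code of endomorphisms of `L`. -/
abbrev MRD (F L : Type*) [Field F] [Field L] [Algebra F L] : Type _ :=
  {C : Submodule F (Module.End F L) //
    Module.finrank F C = Module.finrank F L ∧ ∀ f ∈ C, f ≠ 0 → IsUnit f}

/-- The MRD code obtained from a twist by composing with `A` and `B`. -/
def Twist.code (p : Twist F L) (hp : p.NoZeroDiv) (A B : L ≃ₗ[F] L) : MRD F L :=
  ⟨LinearMap.range (p.codeMap A B), LinearMap.finrank_range_of_inj (hp.codeMap_injective A B), by
    rintro _ ⟨a, rfl⟩ ha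
    exact hp.isUnit_codeMap A B fun h => ha (by rw [h, map_zero])⟩

omit [Finite F] in
theorem Twist.exists_isotopism {p p' : Twist F L} {hp : p.NoZeroDiv} {hp' : p'.NoZeroDiv}
    {A B A' B' : L ≃ₗ[F] L} (h : p.code hp A B = p'.code hp' A' B') :
    ∃ P, IsIsotopism p p' (A.trans A'.symm) P (B.symm.trans B') := by
  have hr : LinearMap.range (p.codeMap A B) = LinearMap.range (p'.codeMap A' B') :=
    congrArg Subtype.val h
  let e := LinearEquiv.ofInjective _ (hp.codeMap_injective A B)
  let e' := LinearEquiv.ofInjective _ (hp'.codeMap_injective A' B')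
  let P := (e.trans (LinearEquiv.ofEq _ _ hr)).trans e'.symm
  refine ⟨P, fun x y => ?_⟩
  have h1 : p'.codeMap A' B' (P x) = p.codeMap A B x := by
    have : e' (P x) = LinearEquiv.ofEq _ _ hr (e x) := e'.apply_symm_apply _
    exact congrArg Subtype.val this
  have h2 := DFunLike.congr_fun h1 (B.symm y)
  rw [codeMap_apply, codeMap_apply, B.apply_symm_apply] at h2
  rw [LinearEquiv.trans_apply, ← h2, A'.symm_apply_apply]
  rfl

theorem card_le_mul_card_range {α β κ : Type*} [Finite α] [Finite κ] (f : α → β)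
    (r : α → α → κ → Prop) (h : ∀ a₀ a, f a = f a₀ → ∃ k, r a₀ a k)
    (hr : ∀ a₀ a a' k, f a = f a₀ → f a' = f a₀ → r a₀ a k → r a₀ a' k → a = a') :
    Nat.card α ≤ Nat.card κ * Nat.card (Set.range f) := by
  classical
  have := Fintype.ofFinite α
  have := Fintype.ofFinite κ
  have hrange : Nat.card (Set.range f) = (Finset.univ.image f).card := by
    rw [← Set.ncard_coe_finset, Finset.coe_image, Finset.coe_univ, Set.image_univ]
    rfl
  rw [hrange, Nat.card_eq_fintype_card, Nat.card_eq_fintype_card, ← Finset.card_univ,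
    ← Finset.card_univ]
  refine Finset.card_le_mul_card_image _ _ fun b hb => ?_
  obtain ⟨a₀, -, rfl⟩ := Finset.mem_image.1 hb
  refine Finset.card_le_card_of_forall_subsingleton (r a₀) (fun a ha => ?_) fun k _ => ?_
  · obtain ⟨k, hk⟩ := h a₀ a (Finset.mem_filter.1 ha).2
    exact ⟨k, Finset.mem_univ k, hk⟩
  · rintro a ⟨ha, hk⟩ a' ⟨ha', hk'⟩
    exact hr a₀ a a' k (Finset.mem_filter.1 ha).2 (Finset.mem_filter.1 ha').2 hk hk'

/-- The map sending `(A, B)` to the code of the field multiplication. -/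
def fieldCode (F L : Type*) [Field F] [Field L] [Algebra F L] [Finite L]
    (x : (L ≃ₗ[F] L) × (L ≃ₗ[F] L)) : MRD F L :=
  (Twist.field F L).code Twist.noZeroDiv_field x.1 x.2

/-- The map sending `(A, B, p)` to the code of the generalized twisted field of `p`. -/
def twistCode (F L : Type*) [Field F] [Field L] [Algebra F L] [Finite L]
    (x : ((L ≃ₗ[F] L) × (L ≃ₗ[F] L)) × {p : Twist F L // p.Valid}) : MRD F L :=
  haveI := Module.Finite.of_finite (R := F) (M := L)
  x.2.1.code x.2.2.noZeroDiv x.1.1 x.1.2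

theorem twistCode_ne_fieldCode (x y) : twistCode F L x ≠ fieldCode F L y := fun h => by
  obtain ⟨P, hP⟩ := Twist.exists_isotopism h
  exact hP.c_ne_zero x.2.2 rfl

omit [Finite F] in
instance : Finite (L ≃ₗ[F] L) := Finite.of_injective _ DFunLike.coe_injective

omit [Finite F] [Finite L] in
theorem exists_unit_mono {f : L ≃ₗ[F] L} {u : L} {g : Gal(L/F)} (h : ∀ x, f x = u * g x) :
    ∃ w : Lˣ, (w : L) = u := by
  refine ⟨Units.mk0 u ?_, rfl⟩
  rintro rfl
  exact f.map_ne_zero_iff.2 one_ne_zero (by simpa using h 1)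

theorem card_fieldCode : Nat.card ((L ≃ₗ[F] L) × (L ≃ₗ[F] L)) ≤
    Nat.card (Lˣ × Lˣ × Gal(L/F)) * Nat.card (Set.range (fieldCode F L)) := by
  refine card_le_mul_card_range _ (fun x₀ x k => (∀ z, x₀.1.symm (x.1 z) = k.1 * k.2.2 z) ∧
    ∀ z, x₀.2 (x.2.symm z) = k.2.1 * k.2.2 z) (fun x₀ x h => ?_) ?_
  · obtain ⟨P, hP⟩ := Twist.exists_isotopism h
    obtain ⟨u, v, g, hA, hQ⟩ := hP.field
    obtain ⟨u, rfl⟩ := exists_unit_mono hA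
    obtain ⟨v, rfl⟩ := exists_unit_mono hQ
    exact ⟨(u, v, g), hA, hQ⟩
  · rintro ⟨A₀, B₀⟩ ⟨A, B⟩ ⟨A', B'⟩ k - - ⟨h1, h2⟩ ⟨h1', h2'⟩
    have hA : A = A' := LinearEquiv.ext fun z => A₀.symm.injective ((h1 z).trans (h1' z).symm)
    have hB : B.symm = B'.symm := LinearEquiv.ext fun z =>
      B₀.injective ((h2 z).trans (h2' z).symm)
    rw [hA, ← B.symm_symm, hB, B'.symm_symm]

theorem card_twistCode : Nat.card (((L ≃ₗ[F] L) × (L ≃ₗ[F] L)) × {p : Twist F L // p.Valid}) ≤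
    Nat.card (Lˣ × Lˣ × Gal(L/F) × Bool) * Nat.card (Set.range (twistCode F L)) := by
  classical
  have : Finite (Twist F L) := Finite.of_injective (fun p => (p.c, p.s, p.t)) fun p p' h => by
    simp only [Prod.mk.injEq] at h
    exact Twist.ext h.1 h.2.1 h.2.2
  refine card_le_mul_card_range _ (fun x₀ x k => (∀ z, x₀.1.1.symm (x.1.1 z) = k.1 * k.2.2.1 z) ∧
    ∃ l : Gal(L/F), (k.2.2.2 = true ↔ l = k.2.2.1) ∧
      ∀ z, x₀.1.2 (x.1.2.symm z) = k.2.1 * l z) (fun x₀ x h => ?_) ?_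
  · obtain ⟨P, hP⟩ := Twist.exists_isotopism h
    obtain ⟨⟨u, g, hA⟩, -, v, l, hQ⟩ := hP.isMono x.2.2 x₀.2.2
    obtain ⟨u, rfl⟩ := exists_unit_mono hA
    obtain ⟨v, rfl⟩ := exists_unit_mono hQ
    exact ⟨(u, v, g, decide (l = g)), hA, l, by simp, hQ⟩
  · rintro ⟨⟨A₀, B₀⟩, p₀, hp₀⟩ ⟨⟨A, B⟩, p, hp⟩ ⟨⟨A', B'⟩, p', hp'⟩ ⟨u, v, g, b⟩ h h'
      ⟨h1, l, hl, h2⟩ ⟨h1', l', hl', h2'⟩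
    obtain ⟨P, hP⟩ := Twist.exists_isotopism h
    obtain ⟨P', hP'⟩ := Twist.exists_isotopism h'
    have hA : A = A' := LinearEquiv.ext fun z => A₀.symm.injective ((h1 z).trans (h1' z).symm)
    subst hA
    obtain ⟨rfl, hQ⟩ := hP.unique hp hp' hp₀ hP' h1 h2 h2' (hl.symm.trans hl')
    have hB : B.symm = B'.symm := LinearEquiv.ext fun z =>
      B₀.injective (DFunLike.congr_fun hQ z)
    rw [← B.symm_symm, hB, B'.symm_symm]

omit [Finite F] in
theorem card_valid : Nat.card {p : Twist F L // p.Valid} =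
    (Nat.card Lˣ - (Units.map (Algebra.norm F (S := L))).ker.carrier.ncard) *
      ((Nat.card Gal(L/F) - 1) * (Nat.card Gal(L/F) - 1) - (Nat.card Gal(L/F) - 1)) := by
  classical
  have := Fintype.ofFinite L
  let e : {p : Twist F L // p.Valid} ≃
      ((Units.map (Algebra.norm F (S := L))).ker.carrierᶜ : Set Lˣ) ×
        ((Finset.univ.erase (1 : Gal(L/F))).offDiag) :=
    { toFun := fun p => (⟨Units.mk0 p.1.c p.2.c_ne, fun h => p.2.norm_ne (by
          simpa [Units.ext_iff] using h)⟩, ⟨(p.1.s, p.1.t), by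
          simp [Finset.mem_offDiag, p.2.s_ne, p.2.t_ne, p.2.s_ne_t]⟩)
      invFun := fun x => ⟨⟨x.1.1, x.2.1.1, x.2.1.2⟩, by
        obtain ⟨⟨c, hc⟩, ⟨s, t⟩, h⟩ := x
        simp only [Finset.mem_offDiag, Finset.mem_erase, Finset.mem_univ, and_true] at h
        exact ⟨h.1, h.2.1, h.2.2, c.ne_zero, fun h => hc (by simpa [Units.ext_iff] using h)⟩⟩
      left_inv := fun p => rfl
      right_inv := fun x => by
        ext <;> rfl }
  rw [Nat.card_congr e, Nat.card_prod, Nat.card_coe_set_eq, Nat.card_eq_fintype_card,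
    Fintype.card_coe, Finset.offDiag_card, Finset.card_erase_of_mem (Finset.mem_univ _),
    Finset.card_univ, Nat.card_eq_fintype_card (α := Gal(L/F)),
    ← Set.ncard_add_ncard_compl (Units.map (Algebra.norm F (S := L))).ker.carrier,
    Nat.add_sub_cancel_left]

omit [Finite F] in
theorem card_ker_norm_mul : (Units.map (Algebra.norm F (S := L))).ker.carrier.ncard *
    (Nat.card F - 1) = Nat.card L - 1 := by
  have h := Subgroup.card_mul_index (Units.map (Algebra.norm F (S := L))).ker
  rw [Subgroup.index_ker, MonoidHom.range_eq_top.2 (FiniteField.unitsMap_norm_surjective F L),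
    Nat.card_congr Subgroup.topEquiv.toEquiv, Nat.card_units, Nat.card_units] at h
  exact h

end Counting

theorem card_linearEquiv {F L : Type*} [Field F] [Fintype F] [AddCommGroup L] [Module F L] {n : ℕ}
    (b : Module.Basis (Fin n) F L) :
    Nat.card (L ≃ₗ[F] L) = ∏ i : Fin n, (Fintype.card F ^ n - Fintype.card F ^ (i : ℕ)) := by
  rw [← Matrix.card_GL_field,
    ← Nat.card_congr (LinearMap.GeneralLinearGroup.generalLinearEquiv F L).toEquiv]
  exact Nat.card_congr (Units.mapEquiv (LinearMap.toMatrixAlgEquiv b).toMulEquiv).toEquiv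

theorem card_unit_subspaces_congr {F R S : Type*} [Field F] [Ring R] [Ring S] [Algebra F R]
    [Algebra F S] (e : R ≃ₐ[F] S) (n : ℕ) :
    Nat.card {C : Submodule F R // Module.finrank F C = n ∧ ∀ M ∈ C, M ≠ 0 → IsUnit M} =
      Nat.card {C : Submodule F S // Module.finrank F C = n ∧ ∀ M ∈ C, M ≠ 0 → IsUnit M} := by
  refine Nat.card_congr ((Submodule.orderIsoMapComap e.toLinearEquiv).toEquiv.subtypeEquiv
    fun C => and_congr ?_ ?_)
  · change _ ↔ Module.finrank F (C.map (e.toLinearEquiv : R →ₗ[F] S)) = n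
    rw [LinearEquiv.finrank_map_eq]
  · change _ ↔ ∀ M ∈ C.map (e.toLinearEquiv : R →ₗ[F] S), M ≠ 0 → IsUnit M
    have h0 (f) : e f = 0 ↔ f = 0 := map_eq_zero_iff e e.injective
    have hu (f) : IsUnit (e f) ↔ IsUnit f := MulEquiv.isUnit_map e
    constructor
    · rintro h _ ⟨f, hf, rfl⟩ hne
      exact (hu f).2 (h f hf fun hf0 => hne ((h0 f).2 hf0))
    · intro h f hf hne
      exact (hu f).1 (h (e f) ⟨f, hf, rfl⟩ fun hf0 => hne ((h0 f).1 hf0))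

theorem card_MRD {F L : Type*} [Field F] [Field L] [Algebra F L] {n : ℕ}
    (b : Module.Basis (Fin n) F L) :
    Nat.card (MRD F L) = Nat.card {C : Submodule F (Matrix (Fin n) (Fin n) F) //
        Module.finrank F C = n ∧ ∀ M ∈ C, M ≠ 0 → IsUnit M} := by
  rw [← card_unit_subspaces_congr (LinearMap.toMatrixAlgEquiv b), MRD,
    Module.finrank_eq_card_basis b, Fintype.card_fin]

theorem card_MRD_ge (F L : Type*) [Field F] [Field L] [Algebra F L] [Finite F] [Finite L] :
    Nat.card (Set.range (fieldCode F L)) + Nat.card (Set.range (twistCode F L)) ≤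
      Nat.card (MRD F L) := by
  have : Finite (Module.End F L) := Finite.of_injective _ DFunLike.coe_injective
  have : Finite (Submodule F (Module.End F L)) := Finite.of_injective _ SetLike.coe_injective
  simp only [Nat.card_coe_set_eq]
  rw [← Set.ncard_union_eq _ (Set.toFinite _) (Set.toFinite _)]
  · exact Set.ncard_le_card _
  · rw [Set.disjoint_left]
    rintro _ ⟨y, rfl⟩ ⟨x, h⟩
    exact twistCode_ne_fieldCode x y h

theorem bound_arith {n q Q k N a b G : ℕ} (hn : 2 ≤ n) (hq : 2 ≤ q) (hQ : 2 ≤ Q)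
    (hk : k * (q - 1) = Q - 1) (h1 : G * G ≤ (Q - 1) * ((Q - 1) * n) * a)
    (h2 : G * G * ((Q - 1 - k) * ((n - 1) * (n - 1) - (n - 1))) ≤
      (Q - 1) * ((Q - 1) * (n * 2)) * b) (hN : a + b ≤ N) :
    (N : ℚ) ≥ ((G : ℚ) ^ 2 / (n * ((Q : ℚ) - 1) ^ 2)) *
        (1 + (Nat.choose (n - 1) 2 : ℚ) * ((Q : ℚ) - 1) * ((q : ℚ) - 2) / ((q : ℚ) - 1)) := by
  obtain ⟨n, rfl⟩ := Nat.exists_eq_add_of_le' hn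
  obtain ⟨q, rfl⟩ := Nat.exists_eq_add_of_le' hq
  obtain ⟨Q, rfl⟩ := Nat.exists_eq_add_of_le' hQ
  have hkQ : Q + 1 - k = k * q := by
    have : k * (q + 1) = Q + 1 := hk
    rw [mul_add] at this
    omega
  have hk' : (k : ℚ) * (q + 1) = Q + 1 := by exact_mod_cast hk
  have hn1 : (n + 1) * (n + 1) - (n + 1) = (n + 1) * n := by rw [mul_add, mul_one, Nat.add_sub_cancel]
  have h1' : (G : ℚ) * G ≤ (Q + 1) * ((Q + 1) * (n + 2)) * a := by exact_mod_cast h1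
  have h2' : (G : ℚ) * G * (k * q * ((n + 1) * n)) ≤ (Q + 1) * ((Q + 1) * ((n + 2) * 2)) * b := by
    have e : (n + 2 - 1) = n + 1 := rfl
    have e' : (Q + 2 - 1) = Q + 1 := rfl
    rw [e, e', hkQ, hn1] at h2
    exact_mod_cast h2
  have hN' : (a : ℚ) + b ≤ N := by exact_mod_cast hN
  refine le_trans ?_ hN'
  have hc : ((n + 2 - 1).choose 2 : ℚ) = (n + 1) * n / 2 := by
    rw [show n + 2 - 1 = n + 1 from rfl, Nat.cast_choose_two]
    push_cast
    ring
  have hqp : (0 : ℚ) < q + 1 := by positivity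
  have hfrac : ((n + 2 - 1).choose 2 : ℚ) * (((Q + 2 : ℕ) : ℚ) - 1) * (((q + 2 : ℕ) : ℚ) - 2) /
      (((q + 2 : ℕ) : ℚ) - 1) = (n + 1) * n / 2 * (k * q) := by
    rw [hc]
    push_cast
    rw [show (q : ℚ) + 2 - 1 = q + 1 by ring, show (Q : ℚ) + 2 - 1 = Q + 1 by ring, ← hk']
    field_simp
    ring
  rw [hfrac]
  push_cast
  rw [div_mul_eq_mul_div, div_le_iff₀ (by
    have : (0 : ℚ) < (Q : ℚ) + 2 - 1 := by linarith [Q.cast_nonneg (α := ℚ)]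
    positivity)]
  linarith

theorem card_matrix_MRD_ge {F L : Type*} [Field F] [Fintype F] [Field L] [Finite L] [Algebra F L]
    {q n : ℕ} (hn : 2 ≤ n) (hq : Fintype.card F = q) (hfin : Module.finrank F L = n) :
    (Nat.card {C : Submodule F (Matrix (Fin n) (Fin n) F) //
        Module.finrank F C = n ∧ ∀ M ∈ C, M ≠ 0 → IsUnit M} : ℚ) ≥
      ((∏ i ∈ Finset.range n, ((q : ℚ) ^ n - q ^ i)) ^ 2 / (n * ((q : ℚ) ^ n - 1) ^ 2)) *
        (1 + (Nat.choose (n - 1) 2 : ℚ) * ((q : ℚ) ^ n - 1) * ((q : ℚ) - 2) / ((q : ℚ) - 1)) := by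
  have hL : Nat.card L = q ^ n := by
    rw [Module.natCard_eq_pow_finrank (K := F), Nat.card_eq_fintype_card, hq, hfin]
  have hGal : Nat.card Gal(L/F) = n := by rw [IsGalois.card_aut_eq_finrank, hfin]
  let b : Module.Basis (Fin n) F L := Module.finBasisOfFinrankEq F L hfin
  have hq2 : 2 ≤ q := hq ▸ Fintype.one_lt_card
  have hG := card_linearEquiv b
  rw [hq] at hG
  have hGQ : ∏ i ∈ Finset.range n, ((q : ℚ) ^ n - q ^ i) = (Nat.card (L ≃ₗ[F] L) : ℕ) := by
    rw [hG, Finset.prod_range, Nat.cast_prod]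
    refine Finset.prod_congr rfl fun i _ => ?_
    rw [Nat.cast_sub (Nat.pow_le_pow_right (by omega) i.2.le)]
    push_cast
    rfl
  have h1 := card_fieldCode (F := F) (L := L)
  have h2 := card_twistCode (F := F) (L := L)
  have h3 := card_ker_norm_mul (F := F) (L := L)
  have hU : Nat.card Lˣ = q ^ n - 1 := by rw [Nat.card_units, hL]
  rw [Nat.card_prod _ {p : Twist F L // p.Valid}, card_valid] at h2
  simp only [Nat.card_prod, hU, hGal, hL, Nat.card_eq_fintype_card (α := Bool),
    Fintype.card_bool, Nat.card_eq_fintype_card (α := F), hq] at h1 h2 h3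
  rw [← card_MRD b, hGQ, ← Nat.cast_pow q n]
  exact bound_arith hn hq2 (hq2.trans (Nat.le_self_pow (by omega) q)) h3 h1 h2 (card_MRD_ge F L)

/-- The number of `n`-dimensional `F_q`-linear subspaces of `F_q^{n×n}` in which every
nonzero matrix is invertible (full-rank MRD codes) is at least
`(|GL_n(q)|^2 / (n·(q^n−1)^2)) · (1 + C(n−1,2)·(q^n−1)(q−2)/(q−1))`. -/
theorem stmt0 (q n : ℕ) (hn : 2 ≤ n) (F : Type) [Field F] [Fintype F]
    (hq : Fintype.card F = q) :
    (Nat.card {C : Submodule F (Matrix (Fin n) (Fin n) F) //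
        Module.finrank F C = n ∧ ∀ M ∈ C, M ≠ 0 → IsUnit M} : ℚ) ≥
      ((∏ i ∈ Finset.range n, ((q : ℚ) ^ n - q ^ i)) ^ 2 / (n * ((q : ℚ) ^ n - 1) ^ 2)) *
        (1 + (Nat.choose (n - 1) 2 : ℚ) * ((q : ℚ) ^ n - 1) * ((q : ℚ) - 2) / ((q : ℚ) - 1)) := by
  obtain ⟨p, hp⟩ := CharP.exists F
  have : Fact p.Prime := ⟨CharP.char_is_prime F p⟩
  have : NeZero n := ⟨by omega⟩
  have : Finite (FiniteField.Extension F p n) := Module.finite_of_finite F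
  exact card_matrix_MRD_ge hn hq (FiniteField.finrank_extension F p n)
end

section
/- Let q be a prime power. The number of 3-dimensional F_q-linear subspaces C of the matrix space F_q^{3×3} in which every nonzero matrix is invertible is exactly (|GL_3(q)|^2 / (3·(q^3−1)^2)) · (1 + (q^3−1)(q−2)/(q−1)). -/
section CubicAlgebra

open Polynomial

variable {k : Type*} [Field k] {B : Type*} [CommRing B] [Algebra k[X] B]

/-- All coordinates of `z` in the basis `1, Y, Y²` respect the total degree bound `D`,
where `Y` has weight one. -/
def WeightLE (bas : Module.Basis (Fin 3) k[X] B) (D : ℕ) (z : B) : Prop :=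
  ∀ (i : Fin 3) (n : ℕ), D < n + i → (bas.repr z i).coeff n = 0

variable {bas : Module.Basis (Fin 3) k[X] B}

theorem WeightLE.mono {D E : ℕ} {z : B} (h : WeightLE bas D z) (hDE : D ≤ E) :
    WeightLE bas E z := fun i n hn => h i n (lt_of_le_of_lt hDE hn)

theorem WeightLE.add {D : ℕ} {z w : B} (hz : WeightLE bas D z) (hw : WeightLE bas D w) :
    WeightLE bas D (z + w) := fun i n hn => by
  simp [hz i n hn, hw i n hn]

theorem WeightLE.sum {ι : Type*} {D : ℕ} (s : Finset ι) {f : ι → B}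
    (h : ∀ i ∈ s, WeightLE bas D (f i)) : WeightLE bas D (∑ i ∈ s, f i) := fun i n hn => by
  simp only [map_sum, Finsupp.coe_finsetSum, Finset.sum_apply, finsetSum_coeff]
  exact Finset.sum_eq_zero fun j hj => h j hj i n hn

theorem coeff_mul_eq_zero_of_forall {A D s : ℕ} {p q : k[X]} (hp : p.natDegree ≤ A)
    (hq : ∀ n, D < n + s → q.coeff n = 0) (n : ℕ) (hn : A + D < n + s) :
    (p * q).coeff n = 0 := by
  rw [coeff_mul]
  refine Finset.sum_eq_zero fun x hx => ?_
  have hx := Finset.HasAntidiagonal.mem_antidiagonal.1 hx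
  by_cases h : A < x.1
  · rw [coeff_eq_zero_of_natDegree_lt (by omega), zero_mul]
  · rw [hq x.2 (by omega), mul_zero]

theorem WeightLE.smul {A D : ℕ} {p : k[X]} (hp : p.natDegree ≤ A) {z : B}
    (h : WeightLE bas D z) : WeightLE bas (A + D) (p • z) := fun i n hn => by
  rw [map_smul, Finsupp.smul_apply, smul_eq_mul]
  exact coeff_mul_eq_zero_of_forall hp (h i) n hn

variable {a b c : k[X]} {Y : B}

theorem repr_mul_gen (hY : ∀ i, bas i = Y ^ (i : ℕ))
    (hrel : Y ^ 3 + a • Y ^ 2 + b • Y + c • (1 : B) = 0) (z : B) :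
    bas.repr (Y * z) 0 = -(c * bas.repr z 2) ∧
    bas.repr (Y * z) 1 = bas.repr z 0 - b * bas.repr z 2 ∧
    bas.repr (Y * z) 2 = bas.repr z 1 - a * bas.repr z 2 := by
  have hz := bas.sum_repr z
  rw [Fin.sum_univ_three] at hz
  set z0 := bas.repr z 0
  set z1 := bas.repr z 1
  set z2 := bas.repr z 2
  have h0 : bas 0 = 1 := by simp [hY]
  have h1 : bas 1 = Y := by simp [hY]
  have h2 : bas 2 = Y ^ 2 := by simp [hY]
  have key : Y * z = (-(c * z2)) • bas 0 + (z0 - b * z2) • bas 1 + (z1 - a * z2) • bas 2 := by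
    rw [← hz, h0, h1, h2]
    simp only [Algebra.smul_def, map_neg, map_mul, map_sub] at hrel ⊢
    linear_combination (algebraMap k[X] B z2) * hrel
  rw [key]
  refine ⟨?_, ?_, ?_⟩ <;> simp

theorem WeightLE.gen_mul (hY : ∀ i, bas i = Y ^ (i : ℕ))
    (hrel : Y ^ 3 + a • Y ^ 2 + b • Y + c • (1 : B) = 0)
    (ha : a.natDegree ≤ 1) (hb : b.natDegree ≤ 2) (hc : c.natDegree ≤ 3)
    {D : ℕ} {z : B} (h : WeightLE bas D z) : WeightLE bas (D + 1) (Y * z) := by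
  obtain ⟨e0, e1, e2⟩ := repr_mul_gen hY hrel z
  have q2 : ∀ n, D < n + 2 → (bas.repr z 2).coeff n = 0 := fun n hn => h 2 n hn
  have q1 : ∀ n, D < n + 1 → (bas.repr z 1).coeff n = 0 := fun n hn => h 1 n hn
  have q0 : ∀ n, D < n → (bas.repr z 0).coeff n = 0 := fun n hn => h 0 n hn
  intro i n hn
  fin_cases i
  · simp only [Fin.zero_eta, e0, coeff_neg, neg_eq_zero] at hn ⊢
    exact coeff_mul_eq_zero_of_forall hc q2 n (by simp at hn; omega)
  · simp only [Fin.mk_one, e1, coeff_sub] at hn ⊢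
    simp at hn
    rw [coeff_mul_eq_zero_of_forall hb q2 n (by omega), q0 n (by omega), sub_zero]
  · simp only [Fin.reduceFinMk, e2, coeff_sub] at hn ⊢
    simp at hn
    rw [coeff_mul_eq_zero_of_forall ha q2 n (by omega), q1 n (by omega), sub_zero]

theorem WeightLE.gen_pow_mul (hY : ∀ i, bas i = Y ^ (i : ℕ))
    (hrel : Y ^ 3 + a • Y ^ 2 + b • Y + c • (1 : B) = 0)
    (ha : a.natDegree ≤ 1) (hb : b.natDegree ≤ 2) (hc : c.natDegree ≤ 3)
    {D : ℕ} {z : B} (h : WeightLE bas D z) (j : ℕ) : WeightLE bas (D + j) (Y ^ j * z) := by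
  induction j with
  | zero => simpa using h
  | succ j ih =>
    rw [pow_succ', mul_assoc]
    exact WeightLE.gen_mul hY hrel ha hb hc ih

theorem WeightLE.one (hY : ∀ i, bas i = Y ^ (i : ℕ)) : WeightLE bas 0 (1 : B) := by
  have h0 : (1 : B) = bas 0 := by simp [hY]
  intro i n hn
  rw [h0, Module.Basis.repr_self, Finsupp.single_apply]
  split_ifs with h
  · subst h
    simp at hn
    rw [coeff_one, if_neg (by omega)]
  · simp

theorem WeightLE.smul_gen_pow (hY : ∀ i, bas i = Y ^ (i : ℕ))
    (hrel : Y ^ 3 + a • Y ^ 2 + b • Y + c • (1 : B) = 0)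
    (ha : a.natDegree ≤ 1) (hb : b.natDegree ≤ 2) (hc : c.natDegree ≤ 3)
    {A : ℕ} {p : k[X]} (hp : p.natDegree ≤ A) (j : ℕ) : WeightLE bas (A + j) (p • Y ^ j) := by
  have := (WeightLE.gen_pow_mul hY hrel ha hb hc (WeightLE.one hY) j).smul hp
  simpa using this

theorem natDegree_norm_le (hY : ∀ i, bas i = Y ^ (i : ℕ))
    (hrel : Y ^ 3 + a • Y ^ 2 + b • Y + c • (1 : B) = 0)
    (ha : a.natDegree ≤ 1) (hb : b.natDegree ≤ 2) (hc : c.natDegree ≤ 3)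
    {D : ℕ} {z : B} (h : WeightLE bas D z) :
    (Algebra.norm k[X] z).natDegree ≤ 3 * (D + 2) := by
  rw [Algebra.norm_eq_matrix_det bas, Matrix.det_apply]
  refine natDegree_sum_le_of_forall_le _ _ fun σ _ => ?_
  refine (natDegree_smul_le _ _).trans ((natDegree_prod_le _ _).trans ?_)
  have : ∀ i j, ((Algebra.leftMulMatrix bas z) i j).natDegree ≤ D + 2 := by
    intro i j
    rw [Algebra.leftMulMatrix_eq_repr_mul, natDegree_le_iff_coeff_eq_zero, hY, mul_comm]
    intro n hn
    exact (WeightLE.gen_pow_mul hY hrel ha hb hc h j) i n (by omega)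
  refine (Finset.sum_le_sum fun i _ => this _ _).trans ?_
  simp

theorem eval_norm_eq_zero (hY : ∀ i, bas i = Y ^ (i : ℕ)) {t : k} (e : B →+* k)
    (he : ∀ p : k[X], e (algebraMap k[X] B p) = p.eval t) {z : B} (hz : e z = 0) :
    (Algebra.norm k[X] z).eval t = 0 := by
  rw [Algebra.norm_eq_matrix_det bas, ← coe_evalRingHom, RingHom.map_det]
  refine Matrix.exists_vecMul_eq_zero_iff.1 ⟨fun i => e (bas i), ?_, ?_⟩
  · intro h
    have := congrFun h 0
    simp [hY] at this
  · ext j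
    have h1 : z * bas j = ∑ i, (bas.repr (z * bas j) i) • bas i := (bas.sum_repr _).symm
    have h2 := congrArg e h1
    rw [RingHom.map_mul, hz, zero_mul, map_sum] at h2
    simp only [Matrix.vecMul, dotProduct, RingHom.mapMatrix_apply, Matrix.map_apply,
      Algebra.leftMulMatrix_eq_repr_mul, Pi.zero_apply, coe_evalRingHom]
    rw [h2]
    refine Finset.sum_congr rfl fun i _ => ?_
    rw [Algebra.smul_def, RingHom.map_mul, he, mul_comm]

theorem dvd_norm_of_mem_span (hY : ∀ i, bas i = Y ^ (i : ℕ)) {t x : k} (e : B →+* k)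
    (he : ∀ p : k[X], e (algebraMap k[X] B p) = p.eval t) (hx : e Y = x) {r : ℕ} {z : B}
    (hz : z ∈ Ideal.span {algebraMap k[X] B ((X - C t) ^ r),
      (Y - algebraMap k[X] B (C x)) ^ r}) :
    (X - C t) ^ r ∣ Algebra.norm k[X] z := by
  rw [Ideal.mem_span_pair] at hz
  obtain ⟨u, v, rfl⟩ := hz
  set w := v * (Y - algebraMap k[X] B (C x)) ^ r with hw
  have h1 : (X - C t) ^ r ∣ Algebra.norm k[X] w := by
    rw [hw, map_mul, map_pow]
    refine Dvd.dvd.mul_left (pow_dvd_pow_of_dvd ?_ r) _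
    rw [dvd_iff_isRoot, IsRoot.def]
    refine eval_norm_eq_zero hY e he ?_
    simp [he, hx]
  rw [← Ideal.mem_span_singleton, ← Ideal.Quotient.eq_zero_iff_mem] at h1 ⊢
  rw [Algebra.norm_eq_matrix_det bas, RingHom.map_det] at h1 ⊢
  rw [← h1]
  congr 1
  ext i j
  simp only [RingHom.mapMatrix_apply, Matrix.map_apply, map_add, Matrix.add_apply]
  rw [add_eq_right, Algebra.leftMulMatrix_eq_repr_mul, mul_comm u, mul_assoc,
    ← Algebra.smul_def, map_smul, Finsupp.smul_apply, smul_eq_mul, map_mul,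
    Ideal.Quotient.eq_zero_iff_mem.2 (Ideal.mem_span_singleton_self _), zero_mul]

end CubicAlgebra

section Stepanov

open Polynomial

variable {k : Type*} [Field k] {B : Type*} [CommRing B] [Algebra k[X] B]
  {bas : Module.Basis (Fin 3) k[X] B} {a b c : k[X]} {Y : B}

theorem repr_sum_smul_pow_coeff (hY : ∀ i, bas i = Y ^ (i : ℕ)) {m : ℕ}
    (f : Fin m → Fin 3 → k) (i : Fin m) (j : Fin 3) :
    (bas.repr (∑ i, ∑ j, (C (f i j) * X ^ (i : ℕ)) • Y ^ (j : ℕ)) j).coeff i = f i j := by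
  simp only [← hY, map_sum, map_smul, Module.Basis.repr_self, Finsupp.coe_finsetSum,
    Finset.sum_apply, Finsupp.smul_apply, finsetSum_coeff, Finsupp.single_apply]
  simp only [smul_eq_mul, mul_ite, mul_one, mul_zero,
    apply_ite (fun q : k[X] => q.coeff (i : ℕ)), coeff_zero,
    Finset.sum_ite_eq', Finset.mem_univ, if_true]
  simp [coeff_C_mul, coeff_X_pow, Fin.val_inj]

theorem exists_cubic_root [IsAlgClosed k] (A B C : k) :
    ∃ x : k, x ^ 3 + A * x ^ 2 + B * x + C = 0 := by
  have hd : (Cubic.toPoly ⟨1, A, B, C⟩ : k[X]).degree ≠ 0 := by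
    rw [Cubic.degree_of_a_ne_zero (one_ne_zero (α := k))]; decide
  obtain ⟨x, hx⟩ := IsAlgClosed.exists_root _ hd
  refine ⟨x, ?_⟩
  simpa [Cubic.toPoly, IsRoot.def] using hx

/-- Functions of small degree multiplied by `r`-th powers of coordinate functions are
linearly independent on an absolutely irreducible cubic. -/
theorem coeff_eq_zero_of_sum_eq_zero [IsAlgClosed k] [IsDomain B] (p e : ℕ) [Fact p.Prime]
    [CharP k p]
    (hY : ∀ i, bas i = Y ^ (i : ℕ))
    (hrel : Y ^ 3 + a • Y ^ 2 + b • Y + c • (1 : B) = 0)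
    (ha : a.natDegree ≤ 1) (hb : b.natDegree ≤ 2) (hc : c.natDegree ≤ 3)
    (hpt : ∀ t x : k, x ^ 3 + a.eval t * x ^ 2 + b.eval t * x + c.eval t = 0 →
      ∃ φ : B →+* k, (∀ p : k[X], φ (algebraMap k[X] B p) = p.eval t) ∧ φ Y = x)
    {r : ℕ} (hr : r = p ^ e) (hr39 : 39 < r)
    (hca : ∀ t, (a.eval t) ^ r = a.eval (t ^ r)) (hcb : ∀ t, (b.eval t) ^ r = b.eval (t ^ r))
    (hcc : ∀ t, (c.eval t) ^ r = c.eval (t ^ r)) {m : ℕ}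
    (f : Fin 10 → Fin 3 → Fin m → Fin 3 → k)
    (h : ∑ a, ∑ b, ∑ i, ∑ j, algebraMap k[X] B (C (f a b i j) * X ^ ((a : ℕ) + i * r)) *
      Y ^ ((b : ℕ) + j * r) = 0) : f = 0 := by
  have hcharB : CharP B p :=
    charP_of_injective_ringHom ((algebraMap k[X] B).comp C).injective p
  have key : ∀ t x : k, x ^ 3 + a.eval t * x ^ 2 + b.eval t * x + c.eval t = 0 →
      ∀ a b, ∑ i, ∑ j, f a b i j * (t ^ r) ^ (i : ℕ) * (x ^ r) ^ (j : ℕ) = 0 := by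
    intro t x htx
    obtain ⟨φ, hφ, hφY⟩ := hpt t x htx
    set g : B := ∑ a : Fin 10, ∑ b : Fin 3,
      (C (∑ i, ∑ j, f a b i j * (t ^ r) ^ (i : ℕ) * (x ^ r) ^ (j : ℕ)) * X ^ (a : ℕ)) •
        Y ^ (b : ℕ) with hg
    have hw : WeightLE bas 11 g := by
      refine WeightLE.sum _ fun i _ => WeightLE.sum _ fun j _ => ?_
      refine (WeightLE.smul_gen_pow hY hrel ha hb hc (A := 9) ?_ _).mono (by omega)
      exact (natDegree_C_mul_X_pow_le _ _).trans (by omega)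
    have hmem : g ∈ Ideal.span {algebraMap k[X] B ((X - C t) ^ r),
        (Y - algebraMap k[X] B (C x)) ^ r} := by
      set I := Ideal.span {algebraMap k[X] B ((X - C t) ^ r),
        (Y - algebraMap k[X] B (C x)) ^ r} with hI
      rw [← Ideal.Quotient.eq_zero_iff_mem]
      have e1 : Ideal.Quotient.mk I (algebraMap k[X] B X) ^ r =
          Ideal.Quotient.mk I (algebraMap k[X] B (C t)) ^ r := by
        have h0 : Ideal.Quotient.mk I (algebraMap k[X] B ((X - C t) ^ r)) = 0 :=
          Ideal.Quotient.eq_zero_iff_mem.2 (Ideal.subset_span (by simp))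
        rwa [hr, sub_pow_char_pow, map_sub, map_sub, ← hr, map_pow, map_pow, map_pow, map_pow,
          sub_eq_zero] at h0
      have e2 : Ideal.Quotient.mk I Y ^ r =
          Ideal.Quotient.mk I (algebraMap k[X] B (C x)) ^ r := by
        have h0 : Ideal.Quotient.mk I ((Y - algebraMap k[X] B (C x)) ^ r) = 0 :=
          Ideal.Quotient.eq_zero_iff_mem.2 (Ideal.subset_span (by simp))
        rwa [hr, sub_pow_char_pow, map_sub, ← hr, map_pow, map_pow, sub_eq_zero] at h0
      rw [← map_zero (Ideal.Quotient.mk I), ← h, hg]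
      simp only [map_sum, map_mul, map_pow, Algebra.smul_def, Finset.sum_mul]
      refine Finset.sum_congr rfl fun a _ => Finset.sum_congr rfl fun b _ =>
        Finset.sum_congr rfl fun i _ => Finset.sum_congr rfl fun j _ => ?_
      rw [pow_add, pow_add, mul_comm (i : ℕ) r, mul_comm (j : ℕ) r, pow_mul, pow_mul, e1, e2]
      ring
    have hn : Algebra.norm k[X] g = 0 := by
      by_contra hne
      have h1 := natDegree_le_of_dvd (dvd_norm_of_mem_span hY φ hφ hφY hmem) hne
      have h2 := natDegree_norm_le hY hrel ha hb hc hw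
      rw [natDegree_pow, natDegree_X_sub_C] at h1
      omega
    rw [Algebra.norm_eq_zero_iff_of_basis bas] at hn
    intro a b
    have := repr_sum_smul_pow_coeff hY
      (fun a b => ∑ i, ∑ j, f a b i j * (t ^ r) ^ (i : ℕ) * (x ^ r) ^ (j : ℕ)) a b
    rw [← this, ← hg, hn]
    simp
  funext a' b' i' j'
  set h' : B := ∑ i, ∑ j, (C (f a' b' i j) * X ^ (i : ℕ)) • Y ^ (j : ℕ) with hh'
  have hn : Algebra.norm k[X] h' = 0 := by
    refine Polynomial.funext fun t => ?_
    obtain ⟨x, hx⟩ := exists_cubic_root (a.eval t) (b.eval t) (c.eval t)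
    obtain ⟨φ, hφ, hφY⟩ := hpt t x hx
    rw [eval_norm_eq_zero hY φ hφ, eval_zero]
    have hr0 : 0 < r := by omega
    obtain ⟨t, rfl⟩ := IsAlgClosed.exists_pow_nat_eq t hr0
    obtain ⟨x, rfl⟩ := IsAlgClosed.exists_pow_nat_eq x hr0
    rw [hh', ← key t x ?_ a' b']
    · simp [Algebra.smul_def, hφ, hφY]
    · rw [← hca, ← hcb, ← hcc] at hx
      rw [← pow_eq_zero_iff hr0.ne', ← hx, hr]
      simp only [add_pow_char_pow, mul_pow]
      ring
  rw [Algebra.norm_eq_zero_iff_of_basis bas] at hn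
  rw [← repr_sum_smul_pow_coeff hY (f a' b') i' j', ← hh', hn]
  simp

theorem eq_zero_of_quadratic_three_roots {c0 c1 c2 x y z : k} (hxy : x ≠ y) (hyz : y ≠ z)
    (hxz : x ≠ z) (h1 : c0 + c1 * x + c2 * x ^ 2 = 0) (h2 : c0 + c1 * y + c2 * y ^ 2 = 0)
    (h3 : c0 + c1 * z + c2 * z ^ 2 = 0) : c0 = 0 ∧ c1 = 0 ∧ c2 = 0 := by
  have e1 : c1 + c2 * (x + y) = 0 :=
    mul_left_cancel₀ (sub_ne_zero.2 hxy) (by linear_combination h1 - h2)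
  have e2 : c1 + c2 * (y + z) = 0 :=
    mul_left_cancel₀ (sub_ne_zero.2 hyz) (by linear_combination h2 - h3)
  have e3 : c2 = 0 := mul_left_cancel₀ (sub_ne_zero.2 hxz) (by linear_combination e1 - e2)
  subst e3
  have e4 : c1 = 0 := by simpa using e1
  subst e4
  exact ⟨by simpa using h1, rfl, rfl⟩

/-- The Frobenius orbit of a root of a cubic without rational roots consists of three
distinct roots. -/
theorem frobenius_orbit_of_no_root (φ : k →+* k) {A B C : k} (hA : φ A = A) (hB : φ B = B)
    (hC : φ C = C) (hno : ∀ x, φ x = x → x ^ 3 + A * x ^ 2 + B * x + C ≠ 0) {x : k}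
    (hx : x ^ 3 + A * x ^ 2 + B * x + C = 0) :
    (φ x) ^ 3 + A * (φ x) ^ 2 + B * (φ x) + C = 0 ∧ φ x ≠ x ∧ φ (φ x) ≠ φ x ∧
      φ (φ x) ≠ x := by
  have h1 : (φ x) ^ 3 + A * (φ x) ^ 2 + B * (φ x) + C = 0 := by
    have := congrArg φ hx
    simpa [hA, hB, hC] using this
  have h2 : φ x ≠ x := fun h => hno x h hx
  refine ⟨h1, h2, fun h => h2 (φ.injective h), fun h => ?_⟩
  have hS : x ^ 2 + x * φ x + (φ x) ^ 2 + A * (x + φ x) + B = 0 :=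
    mul_left_cancel₀ (sub_ne_zero.2 h2) (by linear_combination h1 - hx)
  refine hno (-A - x - φ x) (by rw [map_sub, map_sub, map_neg, hA, h]; ring) ?_
  linear_combination hx + (-A - x - φ x - x) * hS

end Stepanov

section Auxiliary

open Polynomial

variable {k : Type*} [Field k] {B : Type*} [CommRing B] [Algebra k[X] B]
  {bas : Module.Basis (Fin 3) k[X] B} {a b c : k[X]} {Y : B}

theorem exists_finset_pow_card_eq [IsAlgClosed k] (p e : ℕ) [Fact p.Prime] [CharP k p]
    (he : e ≠ 0) : ∃ s : Finset k, s.card = p ^ e ∧ ∀ t ∈ s, t ^ (p ^ e) = t := by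
  classical
  have hp : 1 < p ^ e := Nat.one_lt_pow he (Fact.out (p := p.Prime)).one_lt
  have hsep := galois_poly_separable (K := k) p (p ^ e) (dvd_pow_self p he)
  refine ⟨(X ^ (p ^ e) - X : k[X]).roots.toFinset, ?_, fun t ht => ?_⟩
  · rw [Multiset.toFinset_card_of_nodup (nodup_roots hsep),
      splits_iff_card_roots.1 (IsAlgClosed.splits _),
      FiniteField.X_pow_card_sub_X_natDegree_eq _ hp]
  · rw [Multiset.mem_toFinset] at ht
    have := isRoot_of_mem_roots ht
    simpa [IsRoot.def, sub_eq_zero] using this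

theorem WeightLE.natDegree_repr_le {D : ℕ} {z : B} (hz : WeightLE bas D z) (i : Fin 3) :
    (bas.repr z i).natDegree ≤ D :=
  natDegree_le_iff_coeff_eq_zero.2 fun n hn => hz i n (by omega)

theorem map_eq_sum_repr (hY : ∀ i, bas i = Y ^ (i : ℕ)) {t x : k} {φ : B →+* k}
    (hφ : ∀ p : k[X], φ (algebraMap k[X] B p) = p.eval t) (hφY : φ Y = x) (z : B) :
    φ z = (bas.repr z 0).eval t + (bas.repr z 1).eval t * x + (bas.repr z 2).eval t * x ^ 2 := by
  conv_lhs => rw [← bas.sum_repr z]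
  simp [Fin.sum_univ_three, hY, Algebra.smul_def, hφ, hφY]

/-- The coordinates of a power basis expressing `Y' ^ j`, for a second root `Y'` of the cubic,
in terms of `1` and `Y'`. -/
def conjPowCoord (a b : k[X]) (Y : B) : Fin 2 → Fin 3 → B :=
  ![![1, 0, -(Y ^ 2 + a • Y + b • (1 : B))], ![0, 1, -(Y + a • (1 : B))]]

/-- Existence of auxiliary functions, by counting unknowns and equations. -/
theorem exists_auxiliary (hY : ∀ i, bas i = Y ^ (i : ℕ))
    (hrel : Y ^ 3 + a • Y ^ 2 + b • Y + c • (1 : B) = 0)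
    (ha : a.natDegree ≤ 1) (hb : b.natDegree ≤ 2) (hc : c.natDegree ≤ 3)
    {r : ℕ} (hr : 11 ≤ r) :
    ∃ f : Fin 10 × Fin 3 × Fin (r - 2) × Fin 3 → k, f ≠ 0 ∧ ∀ s,
      ∑ v, (C (f v) * X ^ ((v.1 : ℕ) * r + v.2.2.1)) • (Y ^ ((v.2.1 : ℕ) * r) *
        conjPowCoord a b Y s v.2.2.2) = 0 := by
  classical
  have hw : ∀ s j, WeightLE bas 2 (conjPowCoord a b Y s j) := by
    have key : ∀ p q r : k[X], p.natDegree ≤ 2 → q.natDegree ≤ 1 → r.natDegree ≤ 0 →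
        WeightLE bas 2 (p • Y ^ 0 + q • Y ^ 1 + r • Y ^ 2) := fun p q r hp hq hr =>
      ((WeightLE.smul_gen_pow hY hrel ha hb hc hp 0).add
        (WeightLE.smul_gen_pow hY hrel ha hb hc hq 1)).add
        (WeightLE.smul_gen_pow hY hrel ha hb hc hr 2)
    intro s j
    fin_cases s <;> fin_cases j
    · convert key 1 0 0 (by simp) (by simp) (by simp) using 1; simp [conjPowCoord]
    · convert key 0 0 0 (by simp) (by simp) (by simp) using 1; simp [conjPowCoord]
    · convert key (-b) (-a) (-1) (by simpa) (by simpa) (by simp) using 1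
      simp [conjPowCoord]; ring
    · convert key 0 0 0 (by simp) (by simp) (by simp) using 1; simp [conjPowCoord]
    · convert key 1 0 0 (by simp) (by simp) (by simp) using 1; simp [conjPowCoord]
    · convert key (-a) (-1) 0 (by simpa using ha.trans (by omega)) (by simp) (by simp) using 1
      simp [conjPowCoord]
  have hu : ∀ (s : Fin 2) (v : Fin 10 × Fin 3 × Fin (r - 2) × Fin 3) (l : k),
      WeightLE bas (12 * r - 1) ((C l * X ^ ((v.1 : ℕ) * r + v.2.2.1)) •
        (Y ^ ((v.2.1 : ℕ) * r) * conjPowCoord a b Y s v.2.2.2)) := by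
    intro s v l
    refine (WeightLE.smul (natDegree_C_mul_X_pow_le _ _)
      (WeightLE.gen_pow_mul hY hrel ha hb hc (hw s v.2.2.2) _)).mono ?_
    have h1 : (v.1 : ℕ) * r ≤ 9 * r := Nat.mul_le_mul_right _ (by omega)
    have h2 : (v.2.1 : ℕ) * r ≤ 2 * r := Nat.mul_le_mul_right _ (by omega)
    omega
  let M : Matrix (Fin 2 × Fin 3 × Fin (12 * r)) (Fin 10 × Fin 3 × Fin (r - 2) × Fin 3) k :=
    fun e v => (bas.repr ((X ^ ((v.1 : ℕ) * r + v.2.2.1) : k[X]) • (Y ^ ((v.2.1 : ℕ) * r) *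
        conjPowCoord a b Y e.1 v.2.2.2)) e.2.1).coeff e.2.2
  have hker : LinearMap.ker M.mulVecLin ≠ ⊥ := by
    apply LinearMap.ker_ne_bot_of_finrank_lt
    simp only [Module.finrank_fintype_fun_eq_card, Fintype.card_prod, Fintype.card_fin]
    omega
  obtain ⟨f, hf, hf0⟩ := Submodule.exists_mem_ne_zero_of_ne_bot hker
  refine ⟨f, hf0, fun s => ?_⟩
  have hW := WeightLE.sum (bas := bas) Finset.univ fun v _ => hu s v (f v)
  refine bas.repr.injective (Finsupp.ext fun i => Polynomial.ext fun n => ?_)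
  rw [map_zero, Finsupp.zero_apply, coeff_zero]
  by_cases hn : 12 * r - 1 < n + i
  · exact hW i n hn
  · have := congrFun (LinearMap.mem_ker.1 hf) (s, i, ⟨n, by omega⟩)
    rw [Matrix.mulVecLin_apply, Matrix.mulVec, dotProduct] at this
    rw [map_sum, Finsupp.coe_finsetSum, Finset.sum_apply, finsetSum_coeff]
    refine Eq.trans (Finset.sum_congr rfl fun v _ => ?_) this
    rw [mul_smul, map_smul, Finsupp.smul_apply, smul_eq_mul, coeff_C_mul, mul_comm]

/-- An absolutely irreducible cubic with Frobenius-equivariant coefficients has a rational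
point. -/
theorem exists_rational_point [IsAlgClosed k] [IsDomain B] (p e : ℕ) [Fact p.Prime]
    [CharP k p]
    (hY : ∀ i, bas i = Y ^ (i : ℕ))
    (hrel : Y ^ 3 + a • Y ^ 2 + b • Y + c • (1 : B) = 0)
    (ha : a.natDegree ≤ 1) (hb : b.natDegree ≤ 2) (hc : c.natDegree ≤ 3)
    (hpt : ∀ t x : k, x ^ 3 + a.eval t * x ^ 2 + b.eval t * x + c.eval t = 0 →
      ∃ φ : B →+* k, (∀ p : k[X], φ (algebraMap k[X] B p) = p.eval t) ∧ φ Y = x)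
    {r : ℕ} (hr : r = p ^ e) (hr39 : 39 < r)
    (hca : ∀ t, (a.eval t) ^ r = a.eval (t ^ r)) (hcb : ∀ t, (b.eval t) ^ r = b.eval (t ^ r))
    (hcc : ∀ t, (c.eval t) ^ r = c.eval (t ^ r)) :
    ∃ t x : k, t ^ (r ^ 2) = t ∧ x ^ (r ^ 2) = x ∧
      x ^ 3 + a.eval t * x ^ 2 + b.eval t * x + c.eval t = 0 := by
  classical
  by_contra! hno
  have hr0 : 0 < r := by omega
  obtain ⟨f, hf0, hf⟩ := exists_auxiliary hY hrel ha hb hc (r := r) (by omega)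
  choose g hg using fun v => IsAlgClosed.exists_pow_nat_eq (f v) hr0
  have hfix : ∀ {P : k[X]}, (∀ t, (P.eval t) ^ r = P.eval (t ^ r)) → ∀ {t : k},
      t ^ (r ^ 2) = t → (P.eval t) ^ (r ^ 2) = P.eval t := by
    intro P hP t ht
    rw [pow_two, pow_mul, hP, hP, ← pow_mul, ← pow_two, ht]
  set G : B := ∑ v, (C (g v) * X ^ ((v.1 : ℕ) + v.2.2.1 * r)) •
    Y ^ ((v.2.1 : ℕ) + v.2.2.2 * r) with hG
  have hroot : ∀ t x x' : k, t ^ (r ^ 2) = t →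
      x ^ 3 + a.eval t * x ^ 2 + b.eval t * x + c.eval t = 0 →
      x' = x ^ (r ^ 2) →
      (bas.repr G 0).eval t + (bas.repr G 1).eval t * x + (bas.repr G 2).eval t * x ^ 2 = 0 := by
    intro t x x' ht hx hx'
    obtain ⟨φ, hφ, hφY⟩ := hpt t x hx
    rw [← map_eq_sum_repr hY hφ hφY]
    have hQ : r ^ 2 = p ^ (e * 2) := by rw [hr, pow_mul]
    obtain ⟨h1, h2, -, -⟩ := frobenius_orbit_of_no_root (iterateFrobenius k p (e * 2))
      (A := a.eval t) (B := b.eval t) (C := c.eval t) (x := x)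
      (by rw [iterateFrobenius_def, ← hQ, hfix hca ht])
      (by rw [iterateFrobenius_def, ← hQ, hfix hcb ht])
      (by rw [iterateFrobenius_def, ← hQ, hfix hcc ht])
      (fun y hy => hno t y ht (by rwa [iterateFrobenius_def, ← hQ] at hy)) hx
    rw [iterateFrobenius_def, ← hQ, ← hx'] at h1 h2
    have hS : x' ^ 2 = -(x ^ 2 + a.eval t * x + b.eval t) - (x + a.eval t) * x' :=
      mul_left_cancel₀ (sub_ne_zero.2 h2) (by linear_combination h1 - hx)
    have hw : ∀ j : Fin 3, φ (conjPowCoord a b Y 0 j) + φ (conjPowCoord a b Y 1 j) * x' =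
        x' ^ (j : ℕ) := by
      intro j
      fin_cases j
      · simp [conjPowCoord]
      · simp [conjPowCoord]
      · simp [conjPowCoord, Algebra.smul_def, hφ, hφY, hS]; ring
    have hE : ∀ s, ∑ v, f v * t ^ ((v.1 : ℕ) * r + v.2.2.1) * (x ^ ((v.2.1 : ℕ) * r) *
        φ (conjPowCoord a b Y s v.2.2.2)) = 0 := by
      intro s
      have := congrArg φ (hf s)
      simpa [Algebra.smul_def, hφ, hφY] using this
    have hsum : (∑ v, g v * t ^ ((v.1 : ℕ) + v.2.2.1 * r) *
        x ^ ((v.2.1 : ℕ) + v.2.2.2 * r)) ^ r = 0 := by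
      have hfrob : ∀ h : Fin 10 × Fin 3 × Fin (r - 2) × Fin 3 → k,
          (∑ v, h v) ^ r = ∑ v, h v ^ r := fun h => by
        have := map_sum (iterateFrobenius k p e) h Finset.univ
        simpa only [iterateFrobenius_def, ← hr] using this
      have h0 := congrArg₂ (fun y z => y + z * x') (hE 0) (hE 1)
      simp only [Finset.sum_mul, ← Finset.sum_add_distrib, zero_mul, add_zero] at h0
      rw [hfrob, ← h0]
      refine Finset.sum_congr rfl fun v _ => ?_
      have e1 : (t ^ ((v.1 : ℕ) + v.2.2.1 * r)) ^ r = t ^ ((v.1 : ℕ) * r + v.2.2.1) := by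
        rw [← pow_mul, add_mul, pow_add, pow_add, mul_assoc, ← pow_two, mul_comm _ (r ^ 2),
          pow_mul _ (r ^ 2), ht]
      have e2 : (x ^ ((v.2.1 : ℕ) + v.2.2.2 * r)) ^ r =
          x ^ ((v.2.1 : ℕ) * r) * x' ^ (v.2.2.2 : ℕ) := by
        rw [← pow_mul, add_mul, pow_add, mul_assoc, ← pow_two, mul_comm _ (r ^ 2),
          pow_mul _ (r ^ 2), ← hx']
      rw [mul_pow, mul_pow, hg, e1, e2, ← hw]
      ring
    rw [pow_eq_zero_iff hr0.ne'] at hsum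
    rw [← hsum]
    simp [hG, Algebra.smul_def, hφ, hφY]
  have hcoord : ∀ t : k, t ^ (r ^ 2) = t → (bas.repr G 0).eval t = 0 ∧
      (bas.repr G 1).eval t = 0 ∧ (bas.repr G 2).eval t = 0 := by
    intro t ht
    obtain ⟨x, hx⟩ := exists_cubic_root (a.eval t) (b.eval t) (c.eval t)
    have hQ : r ^ 2 = p ^ (e * 2) := by rw [hr, pow_mul]
    have orb := fun {x : k} hx => frobenius_orbit_of_no_root (iterateFrobenius k p (e * 2))
      (A := a.eval t) (B := b.eval t) (C := c.eval t) (x := x)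
      (by rw [iterateFrobenius_def, ← hQ, hfix hca ht])
      (by rw [iterateFrobenius_def, ← hQ, hfix hcb ht])
      (by rw [iterateFrobenius_def, ← hQ, hfix hcc ht])
      (fun y hy => hno t y ht (by rwa [iterateFrobenius_def, ← hQ] at hy)) hx
    obtain ⟨h1, h2, h3, h4⟩ := orb hx
    obtain ⟨h5, -, -, -⟩ := orb h1
    exact eq_zero_of_quadratic_three_roots h2.symm h3.symm h4.symm (hroot t _ _ ht hx rfl)
      (hroot t _ _ ht h1 rfl) (hroot t _ _ ht h5 rfl)
  have hGW : WeightLE bas (11 + (r - 1) * r) G := by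
    refine WeightLE.sum _ fun v _ => ?_
    refine (WeightLE.smul_gen_pow hY hrel ha hb hc (natDegree_C_mul_X_pow_le _ _) _).mono ?_
    have h1 : (v.2.2.1 : ℕ) * r ≤ (r - 3) * r := Nat.mul_le_mul_right _ (by omega)
    have h2 : (v.2.2.2 : ℕ) * r ≤ 2 * r := Nat.mul_le_mul_right _ (by omega)
    have h3 : (r - 1) * r = (r - 3) * r + 2 * r := by rw [← add_mul]; congr 1; omega
    omega
  have he0 : e ≠ 0 := by rintro rfl; simp at hr; omega
  obtain ⟨S, hS, hSf⟩ := exists_finset_pow_card_eq (k := k) p (e * 2) (by omega)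
  have hQ : r ^ 2 = p ^ (e * 2) := by rw [hr, pow_mul]
  have hlt : 11 + (r - 1) * r < S.card := by
    rw [hS, ← hQ]
    have : r ^ 2 = (r - 1) * r + r := by
      rw [pow_two, ← Nat.succ_mul]; congr 1; omega
    omega
  rw [← hQ] at hSf
  have hG0 : G = 0 := by
    refine bas.repr.injective (Finsupp.ext fun i => ?_)
    rw [map_zero, Finsupp.zero_apply]
    refine Polynomial.eq_zero_of_natDegree_lt_card_of_eval_eq_zero' _ S (fun t ht => ?_)
      ((hGW.natDegree_repr_le i).trans_lt hlt)
    obtain ⟨h0, h1, h2⟩ := hcoord t (hSf t ht)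
    fin_cases i
    exacts [h0, h1, h2]
  have := coeff_eq_zero_of_sum_eq_zero p e hY hrel ha hb hc hpt hr hr39 hca hcb hcc
    (fun i j k l => g (i, j, k, l)) (by
      rw [← hG0, hG]
      simp only [Fintype.sum_prod_type, Algebra.smul_def])
  refine hf0 (funext fun v => ?_)
  have hv := congrFun (congrFun (congrFun (congrFun this v.1) v.2.1) v.2.2.1) v.2.2.2
  rw [← hg]
  simp only [Pi.zero_apply] at hv ⊢
  rw [hv, zero_pow hr0.ne']

end Auxiliary

section CubicCurve

open Polynomial

variable {k : Type*} [Field k]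

/-- A plane cubic, monic in `Y`, with Frobenius-equivariant coefficients either has a rational
point or contains a line. -/
theorem exists_poly_root_of_no_rational_point [IsAlgClosed k] (p e : ℕ) [Fact p.Prime]
    [CharP k p] {a b c : k[X]}
    (ha : a.natDegree ≤ 1) (hb : b.natDegree ≤ 2) (hc : c.natDegree ≤ 3)
    {r : ℕ} (hr : r = p ^ e) (hr39 : 39 < r)
    (hca : ∀ t, (a.eval t) ^ r = a.eval (t ^ r)) (hcb : ∀ t, (b.eval t) ^ r = b.eval (t ^ r))
    (hcc : ∀ t, (c.eval t) ^ r = c.eval (t ^ r))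
    (hno : ∀ t x : k, t ^ (r ^ 2) = t → x ^ (r ^ 2) = x →
      x ^ 3 + a.eval t * x ^ 2 + b.eval t * x + c.eval t ≠ 0) :
    ∃ ρ : k[X], ρ ^ 3 + a * ρ ^ 2 + b * ρ + c = 0 := by
  by_contra! hroot
  set G : k[X][X] := Cubic.toPoly ⟨1, a, b, c⟩ with hG
  have hmon : G.Monic := Cubic.monic_of_a_eq_one rfl
  have hdeg : G.natDegree = 3 := Cubic.natDegree_of_a_ne_zero (one_ne_zero (α := k[X]))
  have hev : ∀ ρ, G.eval ρ = ρ ^ 3 + a * ρ ^ 2 + b * ρ + c := fun ρ => by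
    simp [hG, Cubic.toPoly]
  have hirr : Irreducible G := by
    refine (hmon.irreducible_iff_natDegree' ).2 ⟨?_, ?_⟩
    · intro h; rw [h] at hdeg; simp at hdeg
    · intro f g hf hg hfg hmem
      rw [hdeg] at hmem
      have h1 : g.natDegree = 1 := by simpa using hmem
      have h2 : g = X + C (g.coeff 0) := hg.eq_X_add_C h1
      refine hroot (-(g.coeff 0)) ?_
      rw [← hev, ← hfg, eval_mul, h2]
      simp
  have : IsDomain (AdjoinRoot G) := AdjoinRoot.isDomain_of_prime hirr.prime
  let bas : Module.Basis (Fin 3) k[X] (AdjoinRoot G) :=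
    (AdjoinRoot.powerBasisAux' hmon).reindex (finCongr hdeg)
  obtain ⟨t, x, ht, hx, h⟩ := exists_rational_point (bas := bas) (a := a) (b := b) (c := c)
    (Y := AdjoinRoot.root G) p e (fun i => by
        have := (AdjoinRoot.powerBasis' hmon).basis_eq_pow ((finCongr hdeg).symm i)
        rw [AdjoinRoot.powerBasis'_gen] at this
        rw [Module.Basis.reindex_apply]
        exact this)
    (by
      have := AdjoinRoot.eval₂_root G
      simpa [hG, Cubic.toPoly, Algebra.smul_def] using this)
    ha hb hc (fun t x hx => ⟨AdjoinRoot.lift (evalRingHom t) x (by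
        simpa [hG, Cubic.toPoly] using hx), fun p => by
          rw [AdjoinRoot.algebraMap_eq, AdjoinRoot.lift_of]; rfl, AdjoinRoot.lift_root _⟩)
    hr hr39 hca hcb hcc
  exact hno t x ht hx h

end CubicCurve

section TwistedCubic

open Polynomial

/-- The ternary cubic form `dXYZ + β₀Y²Z + β₁Z²X + β₂X²Y + γ₀YZ² + γ₁ZX² + γ₂XY²`. -/
def twistedCubic {R : Type*} [CommRing R] (d : R) (b g v : Fin 3 → R) : R :=
  d * v 0 * v 1 * v 2 + b 0 * v 1 ^ 2 * v 2 + b 1 * v 2 ^ 2 * v 0 + b 2 * v 0 ^ 2 * v 1 +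
    g 0 * v 1 * v 2 ^ 2 + g 1 * v 2 * v 0 ^ 2 + g 2 * v 0 * v 1 ^ 2

/-- The derivative of `twistedCubic` at `v` in the direction `w`. -/
def twistedCubicPolar {R : Type*} [CommRing R] (d : R) (b g v w : Fin 3 → R) : R :=
  d * (w 0 * v 1 * v 2 + v 0 * w 1 * v 2 + v 0 * v 1 * w 2) +
    b 0 * (2 * v 1 * w 1 * v 2 + v 1 ^ 2 * w 2) + b 1 * (2 * v 2 * w 2 * v 0 + v 2 ^ 2 * w 0) +
    b 2 * (2 * v 0 * w 0 * v 1 + v 0 ^ 2 * w 1) +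
    g 0 * (w 1 * v 2 ^ 2 + 2 * v 1 * v 2 * w 2) + g 1 * (w 2 * v 0 ^ 2 + 2 * v 2 * v 0 * w 0) +
    g 2 * (w 0 * v 1 ^ 2 + 2 * v 0 * v 1 * w 1)

theorem twistedCubic_add {R : Type*} [CommRing R] (d : R) (b g v w : Fin 3 → R) (s t : R) :
    twistedCubic d b g (s • v + t • w) = s ^ 3 * twistedCubic d b g v +
      s ^ 2 * t * twistedCubicPolar d b g v w + s * t ^ 2 * twistedCubicPolar d b g w v +
      t ^ 3 * twistedCubic d b g w := by
  simp only [twistedCubic, twistedCubicPolar, Pi.add_apply, Pi.smul_apply, smul_eq_mul]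
  ring

/-- The Frobenius map twisted by a cyclic permutation of the coordinates. -/
def twist {k : Type*} [Semiring k] (φ : k →+* k) (v : Fin 3 → k) : Fin 3 → k :=
  ![φ (v 2), φ (v 0), φ (v 1)]

variable {k : Type*} [Field k]

theorem twistedCubic_twist {φ : k →+* k} {d : k} {b g : Fin 3 → k} (hd : φ d = d)
    (hb : twist φ b = b) (hg : twist φ g = g) (v : Fin 3 → k) :
    twistedCubic d b g (twist φ v) = φ (twistedCubic d b g v) := by
  conv_lhs => rw [← hd, ← hb, ← hg]
  simp only [twistedCubic, twist, map_add, map_mul, map_pow, Matrix.cons_val]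
  ring

theorem twistedCubicPolar_twist {φ : k →+* k} {d : k} {b g : Fin 3 → k} (hd : φ d = d)
    (hb : twist φ b = b) (hg : twist φ g = g) (v w : Fin 3 → k) :
    twistedCubicPolar d b g (twist φ v) (twist φ w) = φ (twistedCubicPolar d b g v w) := by
  conv_lhs => rw [← hd, ← hb, ← hg]
  simp only [twistedCubicPolar, twist, map_add, map_mul, map_pow, map_ofNat, Matrix.cons_val]
  ring

theorem exists_ne_zero_pow_mul_eq [IsAlgClosed k] {M : ℕ} (hM : 1 < M) {c : k} (hc : c ≠ 0) :
    ∃ μ : k, μ ≠ 0 ∧ μ ^ M * c = μ := by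
  obtain ⟨μ, hμ⟩ := IsAlgClosed.exists_pow_nat_eq c⁻¹ (n := M - 1) (by omega)
  have h0 : μ ≠ 0 := by
    rintro rfl
    rw [zero_pow (by omega)] at hμ
    exact inv_ne_zero hc hμ.symm
  refine ⟨μ, h0, ?_⟩
  have : μ ^ M = μ ^ (M - 1) * μ := by rw [← pow_succ]; congr 1; omega
  rw [this, hμ]
  field_simp

/-- If a cubic has no point fixed by a Frobenius map, then neither does it have a point fixed
by the square of that map. -/
theorem no_fixed_zero_sq [IsAlgClosed k] {V : Type*} [AddCommGroup V] [Module k V]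
    {f : V → k} {A : V → V → k}
    (hf : ∀ (v w : V) (s t : k), f (s • v + t • w) = s ^ 3 * f v + s ^ 2 * t * A v w +
      s * t ^ 2 * A w v + t ^ 3 * f w)
    {M : ℕ} (hM : 1 < M) {Ψ : V → V} (hadd : ∀ v w, Ψ (v + w) = Ψ v + Ψ w)
    (hsmul : ∀ (c : k) v, Ψ (c • v) = c ^ M • Ψ v) (hfΨ : ∀ v, f (Ψ v) = f v ^ M)
    (hAΨ : ∀ v w, A (Ψ v) (Ψ w) = A v w ^ M)
    (hno : ∀ v, f v = 0 → Ψ v = v → v = 0) (v : V) (hv : f v = 0) (hΨ : Ψ (Ψ v) = v) :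
    v = 0 := by
  by_contra hv0
  have hfw : f (Ψ v) = 0 := by rw [hfΨ, hv, zero_pow (by omega)]
  have hf' : ∀ s t : k, f (s • v + t • Ψ v) = s * t * (s * A v (Ψ v) + t * A (Ψ v) v) := by
    intro s t
    rw [hf, hv, hfw]; ring
  have hΨ' : ∀ s t : k, Ψ (s • v + t • Ψ v) = t ^ M • v + s ^ M • Ψ v := by
    intro s t
    rw [hadd, hsmul, hsmul, hΨ, add_comm]
  by_cases hcol : ∃ c : k, Ψ v = c • v
  · obtain ⟨c, hc⟩ := hcol
    have hc0 : c ≠ 0 := by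
      rintro rfl
      have h0 : Ψ 0 = 0 := by
        have := hsmul 0 0
        rwa [smul_zero, zero_pow (by omega), zero_smul] at this
      rw [zero_smul] at hc
      rw [hc, h0] at hΨ
      exact hv0 hΨ.symm
    obtain ⟨μ, hμ, hμc⟩ := exists_ne_zero_pow_mul_eq hM hc0
    refine smul_ne_zero hμ hv0 (hno (μ • v) ?_ ?_)
    · have := hf' μ 0
      simpa using this
    · rw [hsmul, hc, smul_smul, hμc]
  · have hB : A (Ψ v) v = A v (Ψ v) ^ M := by
      have := hAΨ v (Ψ v); rwa [hΨ] at this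
    have hA : A v (Ψ v) = A (Ψ v) v ^ M := by
      have := hAΨ (Ψ v) v; rwa [hΨ] at this
    set a := A v (Ψ v) with ha
    set b := A (Ψ v) v with hb
    by_cases ha0 : a = 0
    · have hb0 : b = 0 := by rw [hB, ha0, zero_pow (by omega)]
      have h1 := hno ((1 : k) • v + (1 : k) • Ψ v) (by rw [hf', ha0, hb0]; ring)
        (by rw [hΨ', one_pow])
      refine hcol ⟨-1, ?_⟩
      rw [one_smul, one_smul] at h1
      rw [neg_one_smul]
      exact (neg_eq_of_add_eq_zero_right h1).symm
    · obtain ⟨μ, hμ, hμc⟩ := exists_ne_zero_pow_mul_eq hM (neg_ne_zero.2 (one_ne_zero (α := k)))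
      have h1 := hno ((μ * b) • v + (μ * -a) • Ψ v) (by rw [hf']; ring)
        (by
          have e1 : (-a) ^ M * μ ^ M = μ * b := by
            have : (-a) ^ M = - b := by
              have h2 := hsmul (-1) v
              rw [neg_one_smul] at h2
              have h3 : Ψ (-v) = - Ψ v := by
                have := hadd v (-v)
                have h0 : Ψ 0 = 0 := by
                  have := hsmul 0 0
                  rwa [smul_zero, zero_pow (by omega), zero_smul] at this
                rw [add_neg_cancel, h0] at this
                exact (neg_eq_of_add_eq_zero_right this.symm).symm
              rw [h3, ← neg_one_smul k (Ψ v)] at h2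
              have h4 : Ψ v ≠ 0 := fun h => hcol ⟨0, by rw [h, zero_smul]⟩
              have h5 := smul_left_injective k h4 h2
              rw [← mul_neg_one, mul_pow, ← h5, ← hB]; ring
            rw [this]; linear_combination b * hμc
          rw [hΨ', mul_pow, mul_pow, mul_comm (μ ^ M), e1, ← hA]
          congr 2
          linear_combination -a * hμc)
      have hba : μ * -a ≠ 0 := mul_ne_zero hμ (neg_ne_zero.2 ha0)
      refine hcol ⟨-((μ * -a)⁻¹ * (μ * b)), ?_⟩
      rw [neg_smul, mul_smul, ← smul_neg, ← eq_neg_of_add_eq_zero_right h1, smul_smul,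
        inv_mul_cancel₀ hba, one_smul]

end TwistedCubic

section Line

open Polynomial

variable {k : Type*} [Field k]

theorem twist_iterate_add (φ : k →+* k) (n : ℕ) (v w : Fin 3 → k) :
    (twist φ)^[n] (v + w) = (twist φ)^[n] v + (twist φ)^[n] w := by
  induction n generalizing v w with
  | zero => rfl
  | succ n ih =>
    have : twist φ (v + w) = twist φ v + twist φ w := by
      ext i; fin_cases i <;> simp [twist]
    rw [Function.iterate_succ_apply, this, ih]; rfl

theorem twist_iterate_smul {φ : k →+* k} {q : ℕ} (hφ : ∀ x, φ x = x ^ q) (n : ℕ) (c : k)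
    (v : Fin 3 → k) : (twist φ)^[n] (c • v) = c ^ (q ^ n) • (twist φ)^[n] v := by
  induction n generalizing c v with
  | zero => simp
  | succ n ih =>
    have : twist φ (c • v) = c ^ q • twist φ v := by
      ext i; fin_cases i <;> simp [twist, hφ, mul_pow]
    rw [Function.iterate_succ_apply, this, ih, ← pow_mul, ← pow_succ']; rfl

theorem twist_iterate_equivariant {φ : k →+* k} {q : ℕ} (hφ : ∀ x, φ x = x ^ q)
    {f : (Fin 3 → k) → k} (hf : ∀ v, f (twist φ v) = φ (f v)) (n : ℕ) (v : Fin 3 → k) :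
    f ((twist φ)^[n] v) = f v ^ (q ^ n) := by
  induction n generalizing v with
  | zero => simp
  | succ n ih => rw [Function.iterate_succ_apply, ih, hf, hφ, ← pow_mul, ← pow_succ']

theorem twist_iterate_equivariant₂ {φ : k →+* k} {q : ℕ} (hφ : ∀ x, φ x = x ^ q)
    {f : (Fin 3 → k) → (Fin 3 → k) → k} (hf : ∀ v w, f (twist φ v) (twist φ w) = φ (f v w))
    (n : ℕ) (v w : Fin 3 → k) :
    f ((twist φ)^[n] v) ((twist φ)^[n] w) = f v w ^ (q ^ n) := by
  induction n generalizing v w with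
  | zero => simp
  | succ n ih =>
    rw [Function.iterate_succ_apply, Function.iterate_succ_apply, ih, hf, hφ, ← pow_mul,
      ← pow_succ']

theorem no_fixed_zero_iterate [IsAlgClosed k] {φ : k →+* k} {q : ℕ} (hq : 1 < q)
    (hφ : ∀ x, φ x = x ^ q) {d : k} {b g : Fin 3 → k} (hd : φ d = d)
    (hb : twist φ b = b) (hg : twist φ g = g)
    (hno : ∀ v, twistedCubic d b g v = 0 → twist φ v = v → v = 0) (j : ℕ) :
    ∀ v, twistedCubic d b g v = 0 → (twist φ)^[2 ^ j] v = v → v = 0 := by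
  induction j with
  | zero => simpa using hno
  | succ j ih =>
    intro v hv hfix
    refine no_fixed_zero_sq (twistedCubic_add d b g) (Nat.one_lt_pow (pow_ne_zero j two_ne_zero) hq)
      (twist_iterate_add φ (2 ^ j)) (twist_iterate_smul hφ (2 ^ j))
      (twist_iterate_equivariant hφ (twistedCubic_twist hd hb hg) _)
      (twist_iterate_equivariant₂ hφ (twistedCubicPolar_twist hd hb hg) _) ih v hv ?_
    rwa [← Function.iterate_add_apply, ← two_mul, ← pow_succ']

theorem twistedCubic_map {R S : Type*} [CommRing R] [CommRing S] (f : R →+* S) (d : R)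
    (b g v : Fin 3 → R) :
    f (twistedCubic d b g v) = twistedCubic (f d) (f ∘ b) (f ∘ g) (f ∘ v) := by
  simp [twistedCubic]

theorem twistedCubicPolar_map {R S : Type*} [CommRing R] [CommRing S] (f : R →+* S) (d : R)
    (b g v w : Fin 3 → R) : f (twistedCubicPolar d b g v w) =
      twistedCubicPolar (f d) (f ∘ b) (f ∘ g) (f ∘ v) (f ∘ w) := by
  simp [twistedCubicPolar, map_ofNat]

theorem natDegree_le_one_of_cubic {a b c ρ : k[X]} (ha : a.natDegree ≤ 1)
    (hb : b.natDegree ≤ 2) (hc : c.natDegree ≤ 3)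
    (h : ρ ^ 3 + a * ρ ^ 2 + b * ρ + c = 0) : ρ.natDegree ≤ 1 := by
  by_contra! hn
  have h1 : (ρ ^ 3).natDegree = 3 * ρ.natDegree := natDegree_pow _ _
  have h2 : ρ ^ 3 = -(a * ρ ^ 2 + b * ρ + c) := by linear_combination h
  have h3 : (a * ρ ^ 2).natDegree ≤ 1 + 2 * ρ.natDegree :=
    natDegree_mul_le.trans (add_le_add ha natDegree_pow_le)
  have h4 : (b * ρ).natDegree ≤ 2 + ρ.natDegree := natDegree_mul_le.trans (by omega)
  have h5 : (a * ρ ^ 2 + b * ρ + c).natDegree ≤ 1 + 2 * ρ.natDegree :=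
    natDegree_add_le_of_degree_le (natDegree_add_le_of_degree_le h3 (by omega)) (by omega)
  rw [h2, natDegree_neg] at h1
  omega

theorem eq_zero_of_forall_cubic_eq_zero [Infinite k] {A B C D : k}
    (h : ∀ t : k, A * t ^ 3 + B * t ^ 2 + C * t + D = 0) :
    A = 0 ∧ B = 0 ∧ C = 0 ∧ D = 0 := by
  have h0 : Cubic.toPoly ⟨A, B, C, D⟩ = 0 := by
    refine Polynomial.funext fun t => ?_
    simpa [Cubic.toPoly] using h t
  have h1 := (Cubic.toPoly_eq_zero_iff _).1 h0
  exact ⟨congrArg Cubic.a h1, congrArg Cubic.b h1, congrArg Cubic.c h1, congrArg Cubic.d h1⟩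

theorem exists_line [IsAlgClosed k] (p s : ℕ) [Fact p.Prime] [CharP k p] {q : ℕ}
    (hqp : q = p ^ s) (hs : s ≠ 0) {φ : k →+* k} (hφ : ∀ x, φ x = x ^ q) {d : k}
    {b g : Fin 3 → k} (hd : φ d = d) (hb : twist φ b = b) (hg : twist φ g = g)
    (hno : ∀ v, twistedCubic d b g v = 0 → twist φ v = v → v = 0) {e : k}
    (he3 : φ (φ (φ e)) = e) (he : φ e ≠ e) :
    ∃ l : Fin 3 → k, l ≠ 0 ∧
      ∀ v : Fin 3 → k, l 0 * v 0 + l 1 * v 1 + l 2 * v 2 = 0 → twistedCubic d b g v = 0 := by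
  have hq : 1 < q := hqp ▸ Nat.one_lt_pow hs (Fact.out (p := p.Prime)).one_lt
  have hnoj := no_fixed_zero_iterate hq hφ hd hb hg hno 4
  set E : Fin 3 → k := ![e, φ e, φ (φ e)] with hE
  have hEt : twist φ E = E := by
    ext i; fin_cases i <;> simp [twist, hE, he3]
  have h01 : E 1 - E 0 ≠ 0 := sub_ne_zero.2 he
  have h12 : E 2 - E 1 ≠ 0 := sub_ne_zero.2 fun h => he (φ.injective h)
  have h02 : E 2 - E 0 ≠ 0 := sub_ne_zero.2 fun h => he (by
    have h' : φ (φ e) = e := h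
    rw [h'] at he3; exact he3)
  -- the point `x + t e + e²` and its conjugates
  set pt : k → k → Fin 3 → k := fun t x i => x + t * E i + E i ^ 2 with hpt
  have hpt_twist : ∀ t x, twist φ (pt t x) = pt (φ t) (φ x) := by
    intro t x
    conv_rhs => rw [hpt, ← hEt]
    ext i; fin_cases i <;> simp [twist, hpt]
  have hpt_iter : ∀ n t x, (twist φ)^[n] (pt t x) = pt (t ^ q ^ n) (x ^ q ^ n) := by
    intro n
    induction n with
    | zero => simp
    | succ n ih =>
      intro t x
      rw [Function.iterate_succ_apply, hpt_twist, ih, hφ, hφ, ← pow_mul, ← pow_mul, ← pow_succ']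
  have hpt0 : ∀ t x, pt t x ≠ 0 := by
    intro t x h
    have := eq_zero_of_quadratic_three_roots (c0 := x) (c1 := t) (c2 := 1)
      (sub_ne_zero.1 h01).symm (sub_ne_zero.1 h12).symm (sub_ne_zero.1 h02).symm
      (by simpa [hpt] using congrFun h 0) (by simpa [hpt] using congrFun h 1)
      (by simpa [hpt] using congrFun h 2)
    exact one_ne_zero this.2.2
  have h1t : twist φ (1 : Fin 3 → k) = 1 := by
    ext i; fin_cases i <;> simp [twist]
  set K := twistedCubic d b g 1 with hK
  have hK0 : K ≠ 0 := fun h => one_ne_zero (hno _ h h1t)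
  have hKφ : φ K = K := by rw [hK, ← twistedCubic_twist hd hb hg, h1t]
  have hKφ' : φ K⁻¹ = K⁻¹ := by rw [map_inv₀, hKφ]
  let P : Fin 3 → k[X] := fun i => C (E i) * X + C (E i ^ 2)
  have hPt : ∀ t : k, (evalRingHom t) ∘ P = pt t 0 := fun t => by
    ext i; simp [P, hpt]; ring
  have hcomp : ∀ (t : k) (f : Fin 3 → k), (evalRingHom t) ∘ (C ∘ f) = f := fun t f => by
    ext i; simp
  let pa : k[X] := C K⁻¹ * twistedCubicPolar (C d) (C ∘ b) (C ∘ g) 1 P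
  let pb : k[X] := C K⁻¹ * twistedCubicPolar (C d) (C ∘ b) (C ∘ g) P 1
  let pc : k[X] := C K⁻¹ * twistedCubic (C d) (C ∘ b) (C ∘ g) P
  have ha : ∀ t, pa.eval t = K⁻¹ * twistedCubicPolar d b g 1 (pt t 0) := fun t => by
    have := twistedCubicPolar_map (evalRingHom t) (C d) (C ∘ b) (C ∘ g) 1 P
    rw [hcomp, hcomp, hPt] at this
    simp only [pa, eval_mul, eval_C]
    rw [← coe_evalRingHom, this, coe_evalRingHom, eval_C]
    congr 2
    ext i; simp
  have hb' : ∀ t, pb.eval t = K⁻¹ * twistedCubicPolar d b g (pt t 0) 1 := fun t => by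
    have := twistedCubicPolar_map (evalRingHom t) (C d) (C ∘ b) (C ∘ g) P 1
    rw [hcomp, hcomp, hPt] at this
    simp only [pb, eval_mul, eval_C]
    rw [← coe_evalRingHom, this, coe_evalRingHom, eval_C]
    congr 2
    ext i; simp
  have hc : ∀ t, pc.eval t = K⁻¹ * twistedCubic d b g (pt t 0) := fun t => by
    have := twistedCubic_map (evalRingHom t) (C d) (C ∘ b) (C ∘ g) P
    rw [hcomp, hcomp, hPt] at this
    simp only [pc, eval_mul, eval_C]
    rw [← coe_evalRingHom, this, coe_evalRingHom, eval_C]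
  have hPdeg : ∀ i, (P i).natDegree ≤ 1 := fun i => natDegree_linear_le
  have hpow8 : ∀ {x : k}, φ x = x → ∀ n, x ^ q ^ n = x := by
    intro x hx n
    induction n with
    | zero => simp
    | succ n ih => rw [pow_succ, pow_mul, ih, ← hφ, hx]
  have h1i : ∀ n, (twist φ)^[n] (1 : Fin 3 → k) = 1 := fun n =>
    Function.iterate_fixed h1t n
  have hexp : ∀ t x, x ^ 3 + pa.eval t * x ^ 2 + pb.eval t * x + pc.eval t =
      K⁻¹ * twistedCubic d b g (pt t x) := by
    intro t x
    have hsplit : pt t x = x • (1 : Fin 3 → k) + (1 : k) • pt t 0 := by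
      ext i; simp [hpt]; ring
    rw [hsplit, twistedCubic_add, ha, hb', hc, ← hK]
    field_simp
  have hr : 39 < q ^ 8 := lt_of_lt_of_le (by norm_num) (Nat.pow_le_pow_left hq 8)
  have dega : pa.natDegree ≤ 1 := by
    simp only [pa, twistedCubicPolar, P, Pi.one_apply, Function.comp_apply]
    compute_degree
  have degb : pb.natDegree ≤ 2 := by
    simp only [pb, twistedCubicPolar, P, Pi.one_apply, Function.comp_apply]
    compute_degree
  have degc : pc.natDegree ≤ 3 := by
    simp only [pc, twistedCubic, P, Function.comp_apply]
    compute_degree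
  obtain ⟨ρ, hρ⟩ := exists_poly_root_of_no_rational_point p (s * 8) (a := pa) (b := pb) (c := pc)
    (r := q ^ 8) dega degb degc (by rw [hqp, pow_mul]) hr
    (fun t => by
      rw [ha, ha, mul_pow, hpow8 hKφ', ← twist_iterate_equivariant₂ hφ
        (twistedCubicPolar_twist hd hb hg), h1i, hpt_iter, zero_pow (by positivity)])
    (fun t => by
      rw [hb', hb', mul_pow, hpow8 hKφ', ← twist_iterate_equivariant₂ hφ
        (twistedCubicPolar_twist hd hb hg), h1i, hpt_iter, zero_pow (by positivity)])
    (fun t => by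
      rw [hc, hc, mul_pow, hpow8 hKφ', ← twist_iterate_equivariant hφ
        (twistedCubic_twist hd hb hg), hpt_iter, zero_pow (by positivity)])
    (fun t x ht hx h => by
      rw [hexp, mul_eq_zero, or_iff_right (inv_ne_zero hK0)] at h
      refine hpt0 t x (hnoj _ h ?_)
      rw [← pow_mul] at ht hx
      rw [hpt_iter]
      norm_num at ht hx ⊢
      rw [ht, hx])
  have hρ1 := natDegree_le_one_of_cubic dega degb degc hρ
  obtain ⟨ρ1, ρ0, rfl⟩ := exists_eq_X_add_C_of_natDegree_le_one hρ1
  set m : Fin 3 → k := fun i => ρ1 + E i with hm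
  set n : Fin 3 → k := fun i => ρ0 + E i ^ 2 with hn
  have hline : ∀ t : k, twistedCubic d b g (t • m + (1 : k) • n) = 0 := by
    intro t
    have h := hexp t (ρ1 * t + ρ0)
    have h' := congrArg (eval t) hρ
    simp only [eval_add, eval_mul, eval_pow, eval_C, eval_X, eval_zero] at h'
    rw [h', eq_comm, mul_eq_zero, or_iff_right (inv_ne_zero hK0)] at h
    rw [← h]
    congr 1
    ext i; simp [hm, hn, hpt]; ring
  obtain ⟨e1, e2, e3, e4⟩ := eq_zero_of_forall_cubic_eq_zero
    (A := twistedCubic d b g m) (B := twistedCubicPolar d b g m n)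
    (C := twistedCubicPolar d b g n m) (D := twistedCubic d b g n) (fun t => by
      rw [← hline t, twistedCubic_add]; ring)
  have hV : (E 1 - E 0) * (E 2 - E 0) * (E 2 - E 1) ≠ 0 := mul_ne_zero (mul_ne_zero h01 h02) h12
  set l : Fin 3 → k := ![m 1 * n 2 - m 2 * n 1, m 2 * n 0 - m 0 * n 2, m 0 * n 1 - m 1 * n 0]
    with hl
  have hlV : l 0 + l 1 + l 2 = (E 1 - E 0) * (E 2 - E 0) * (E 2 - E 1) := by
    simp [hl, hm, hn]; ring
  refine ⟨l, fun h => ?_, fun v hv => ?_⟩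
  · rw [← hlV, h] at hV; simp at hV
  · set V := l 0 + l 1 + l 2 with hVdef
    rw [← hlV] at hV
    have hdec : v = (V⁻¹ * (v 1 * n 2 - v 2 * n 1 + (v 2 * n 0 - v 0 * n 2) +
        (v 0 * n 1 - v 1 * n 0))) • m + (V⁻¹ * (m 1 * v 2 - m 2 * v 1 + (m 2 * v 0 - m 0 * v 2) +
        (m 0 * v 1 - m 1 * v 0))) • n := by
      have hl0 : l 0 = m 1 * n 2 - m 2 * n 1 := rfl
      have hl1 : l 1 = m 2 * n 0 - m 0 * n 2 := rfl
      have hl2 : l 2 = m 0 * n 1 - m 1 * n 0 := rfl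
      ext i
      apply mul_left_cancel₀ hV
      simp only [Pi.add_apply, Pi.smul_apply, smul_eq_mul]
      rw [mul_add, mul_assoc V⁻¹, mul_assoc V⁻¹, mul_inv_cancel_left₀ hV,
        mul_inv_cancel_left₀ hV, hVdef]
      rw [hl0, hl1, hl2] at hv ⊢
      fin_cases i <;> simp only [Fin.mk_one, Fin.zero_eta, Fin.reduceFinMk] <;>
        linear_combination hv
    rw [hdec, twistedCubic_add, e1, e2, e3, e4]
    ring

end Line

section Classification

open Polynomial

variable {k : Type*} [Field k]

theorem twistedCubic_coeff_of_coordinate_line [Infinite k] (φ : k →+* k)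
    {d b0 b1 b2 g0 g1 g2 l1 l2 : k}
    (hb0 : φ b0 = b1) (hb1 : φ b1 = b2) (hg0 : φ g0 = g1) (hg1 : φ g1 = g2) (hg2 : φ g2 = g0)
    (hb2 : φ b2 = b0) (hl : ¬ (l1 = 0 ∧ l2 = 0))
    (h : ∀ s t, s * t ^ 2 * (-d * l1 * l2 + b1 * l1 ^ 2 + g2 * l2 ^ 2) +
      s ^ 2 * t * (b2 * l2 - g1 * l1) + t ^ 3 * l1 * l2 * (g0 * l1 - b0 * l2) = 0) :
    (b0 = 0 ∧ g0 = 0) ∨ (b0 ≠ 0 ∧ g0 ≠ 0 ∧ b0 * g1 = b1 * g2 ∧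
      d * (b0 * g1) = b0 * b1 * b2 + g0 * g1 * g2) := by
  obtain ⟨-, h1, h2, h3⟩ := eq_zero_of_forall_cubic_eq_zero (A := 0) (B := b2 * l2 - g1 * l1)
    (C := -d * l1 * l2 + b1 * l1 ^ 2 + g2 * l2 ^ 2) (D := l1 * l2 * (g0 * l1 - b0 * l2))
    (fun s => by linear_combination h s 1)
  have z1 : b2 = 0 → b0 = 0 := fun h => by rw [← hb2, h, map_zero]
  have z2 : b1 = 0 → b0 = 0 := fun h => z1 (by rw [← hb1, h, map_zero])
  have z3 : g2 = 0 → g0 = 0 := fun h => by rw [← hg2, h, map_zero]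
  have z4 : g1 = 0 → g0 = 0 := fun h => z3 (by rw [← hg1, h, map_zero])
  by_cases hl1 : l1 = 0
  · have hl2 : l2 ≠ 0 := fun h => hl ⟨hl1, h⟩
    subst hl1
    exact Or.inl ⟨z1 (by simpa [hl2] using h1), z3 (by simpa [hl2] using h2)⟩
  by_cases hl2 : l2 = 0
  · subst hl2
    exact Or.inl ⟨z2 (by simpa [hl1] using h2), z4 (by simpa [hl1] using h1)⟩
  replace h3 : g0 * l1 - b0 * l2 = 0 := by simpa [hl1, hl2] using h3
  by_cases hb : b0 = 0
  · refine Or.inl ⟨hb, ?_⟩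
    simpa [hb, hl1] using h3
  have hg : g0 ≠ 0 := by
    rintro rfl
    simp [hb, hl2] at h3
  have e1 : b2 * g0 = b0 * g1 := mul_right_cancel₀ hl1 (by linear_combination b2 * h3 + b0 * h1)
  have e2 : b0 * g1 = b1 * g2 := by
    have := congrArg φ e1
    rwa [map_mul, map_mul, hb2, hb0, hg0, hg1] at this
  refine Or.inr ⟨hb, hg, e2, mul_left_cancel₀ (mul_ne_zero hl1 hl1) ?_⟩
  have e3 : b0 * (d * g0 * b0 - b1 * b0 ^ 2 - g2 * g0 ^ 2) * l1 ^ 2 = 0 := by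
    linear_combination (-b0 ^ 3) * h2 + (d * b0 ^ 2 * l1 - b0 * g2 * (g0 * l1 + b0 * l2)) * h3
  have e4 : d * g0 * b0 - b1 * b0 ^ 2 - g2 * g0 ^ 2 = 0 := by
    simpa [hb, hl1] using e3
  have e5 : b0 * (d * (b0 * g1) - (b0 * b1 * b2 + g0 * g1 * g2)) = 0 := by
    linear_combination b2 * e4 - (d * b0 - g2 * g0) * e1
  have e6 := (mul_eq_zero.1 e5).resolve_left hb
  linear_combination l1 * l1 * e6

/-- Classification of the twisted cubics without rational points. -/
theorem twistedCubic_classification [IsAlgClosed k] (p s : ℕ) [Fact p.Prime] [CharP k p] {q : ℕ}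
    (hqp : q = p ^ s) (hs : s ≠ 0) {φ : k →+* k} (hφ : ∀ x, φ x = x ^ q) {d : k}
    {b g : Fin 3 → k} (hd : φ d = d) (hb : twist φ b = b) (hg : twist φ g = g)
    (hno : ∀ v, twistedCubic d b g v = 0 → twist φ v = v → v = 0) {e : k}
    (he3 : φ (φ (φ e)) = e) (he : φ e ≠ e) :
    (b 0 = 0 ∧ g 0 = 0) ∨ (b 0 ≠ 0 ∧ g 0 ≠ 0 ∧ b 0 * g 1 = b 1 * g 2 ∧
      d * (b 0 * g 1) = b 0 * b 1 * b 2 + g 0 * g 1 * g 2) := by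
  have hq : 1 < q := hqp ▸ Nat.one_lt_pow hs (Fact.out (p := p.Prime)).one_lt
  obtain ⟨l, hl0, hl⟩ := exists_line p s hqp hs hφ hd hb hg hno he3 he
  have hb0 : φ (b 0) = b 1 := by conv_rhs => rw [← hb]; simp [twist]
  have hb1 : φ (b 1) = b 2 := by conv_rhs => rw [← hb]; simp [twist]
  have hb2 : φ (b 2) = b 0 := by conv_rhs => rw [← hb]; simp [twist]
  have hg0 : φ (g 0) = g 1 := by conv_rhs => rw [← hg]; simp [twist]
  have hg1 : φ (g 1) = g 2 := by conv_rhs => rw [← hg]; simp [twist]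
  have hg2 : φ (g 2) = g 0 := by conv_rhs => rw [← hg]; simp [twist]
  have hl' : ∀ x y z, l 0 * x + l 1 * y + l 2 * z = 0 → d * x * y * z + b 0 * y ^ 2 * z +
      b 1 * z ^ 2 * x + b 2 * x ^ 2 * y + g 0 * y * z ^ 2 + g 1 * z * x ^ 2 + g 2 * x * y ^ 2 = 0 :=
    fun x y z h => hl ![x, y, z] h
  have hz : ¬ (l 0 = 0 ∧ l 1 = 0 ∧ l 2 = 0) := fun h => hl0 (by
    ext i; fin_cases i
    exacts [h.1, h.2.1, h.2.2])
  by_cases h0 : l 0 = 0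
  · exact twistedCubic_coeff_of_coordinate_line φ hb0 hb1 hg0 hg1 hg2 hb2
      (fun h => hz ⟨h0, h.1, h.2⟩) fun s t => by
        have := hl' s (t * l 2) (-(t * l 1)) (by rw [h0]; ring)
        linear_combination this
  by_cases h1 : l 1 = 0
  · rcases twistedCubic_coeff_of_coordinate_line φ hb1 hb2 hg1 hg2 hg0 hb0 (d := d)
      (l1 := l 2) (l2 := l 0) (fun h => hz ⟨h.2, h1, h.1⟩) (fun s t => by
        have := hl' (-(t * l 2)) s (t * l 0) (by rw [h1]; ring)
        linear_combination this) with h | ⟨u1, u2, u3, u4⟩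
    · exact Or.inl ⟨by rw [← hb2, ← hb1, h.1]; simp, by rw [← hg2, ← hg1, h.2]; simp⟩
    · have e1 : b 2 * g 0 = b 0 * g 1 := by
        have := congrArg φ u3
        rwa [map_mul, map_mul, hb1, hb2, hg0, hg2] at this
      refine Or.inr ⟨fun h => u1 (by rw [← hb0, h, map_zero]),
        fun h => u2 (by rw [← hg0, h, map_zero]), by rw [u3, e1], ?_⟩
      rw [← e1, ← u3, u4]; ring
  by_cases h2 : l 2 = 0
  · rcases twistedCubic_coeff_of_coordinate_line φ hb2 hb0 hg2 hg0 hg1 hb1 (d := d)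
      (l1 := l 0) (l2 := l 1) (fun h => hz ⟨h.1, h.2, h2⟩) (fun s t => by
        have := hl' (t * l 1) (-(t * l 0)) s (by rw [h2]; ring)
        linear_combination this) with h | ⟨u1, u2, u3, u4⟩
    · exact Or.inl ⟨by rw [← hb2, h.1]; simp, by rw [← hg2, h.2]; simp⟩
    · have e1 : b 0 * g 1 = b 1 * g 2 := by
        have := congrArg φ u3
        rwa [map_mul, map_mul, hb2, hb0, hg0, hg1] at this
      refine Or.inr ⟨fun h => u1 (by rw [← hb1, ← hb0, h]; simp),
        fun h => u2 (by rw [← hg1, ← hg0, h]; simp), e1, ?_⟩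
      rw [← u3, u4]; ring
  have r2 : b 2 * l 1 = g 2 * l 0 := by
    have := hl' (l 1) (-l 0) 0 (by ring)
    apply mul_left_cancel₀ (mul_ne_zero h0 h1)
    linear_combination -this
  have r0 : b 0 * l 2 = g 0 * l 1 := by
    have := hl' 0 (l 2) (-l 1) (by ring)
    apply mul_left_cancel₀ (mul_ne_zero h1 h2)
    linear_combination -this
  have r1 : b 1 * l 0 = g 1 * l 2 := by
    have := hl' (-l 2) 0 (l 0) (by ring)
    apply mul_left_cancel₀ (mul_ne_zero h0 h2)
    linear_combination -this
  by_cases hbz : b 0 = 0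
  · exact Or.inl ⟨hbz, by simpa [hbz, h1] using r0⟩
  exfalso
  have hb1z : b 1 ≠ 0 := fun h => hbz (by rw [← hb2, ← hb1, h]; simp)
  have hb2z : b 2 ≠ 0 := fun h => hbz (by rw [← hb2, h]; simp)
  set ρ := l 1 / l 0 with hρ
  have hρ2 : ρ = g 2 / b 2 := by rw [hρ]; field_simp; linear_combination r2
  have hρφ : φ ρ = l 2 / l 1 := by
    rw [hρ2, map_div₀, hg2, hb2]; field_simp; linear_combination -r0
  have hρφφ : φ (φ ρ) = l 0 / l 2 := by
    rw [hρ2, map_div₀, hg2, hb2, map_div₀, hg0, hb0]; field_simp; linear_combination -r1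
  have hinj : ¬ ∃ x : k, x ≠ 0 ∧ φ (φ (φ x)) = x ∧ x + ρ * φ x + ρ * φ ρ * φ (φ x) = 0 := by
    rintro ⟨x, hx0, hx3, hx⟩
    have := hno ![x, φ x, φ (φ x)] (hl' _ _ _ (show l 0 * x + l 1 * φ x + l 2 * φ (φ x) = 0 by
      rw [hρφ, hρ] at hx
      field_simp at hx
      linear_combination hx)) (by
      ext i; fin_cases i <;> simp [twist, hx3])
    exact hx0 (congrFun this 0)
  classical
  obtain ⟨S, hS, hSf⟩ := exists_finset_pow_card_eq (k := k) p (s * 3) (by omega)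
  have hφ3 : ∀ x, x ^ (p ^ (s * 3)) = φ (φ (φ x)) := fun x => by
    rw [hφ, hφ, hφ, ← pow_mul, ← pow_mul, pow_mul p, ← hqp]; congr 1; ring
  have hpoly : (C ρ * X ^ q - X : k[X]).natDegree ≤ q := by
    compute_degree
    omega
  have hρ0 : ρ ≠ 0 := div_ne_zero h1 h0
  have hpoly0 : (C ρ * X ^ q - X : k[X]) ≠ 0 := fun h => by
    have := congrArg (fun P : k[X] => P.coeff q) h
    simp [coeff_X, hρ0, hq.ne] at this
  have hcard : (C ρ * X ^ q - X : k[X]).roots.toFinset.card < S.card := by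
    refine lt_of_le_of_lt ((Multiset.toFinset_card_le _).trans ((card_roots' _).trans hpoly)) ?_
    rw [hS, pow_mul, ← hqp]
    calc q = q ^ 1 := (pow_one q).symm
      _ < q ^ 3 := Nat.pow_lt_pow_right hq (by norm_num)
  obtain ⟨x, hx, y, hy, hxy, hT⟩ := Finset.exists_ne_map_eq_of_card_lt_of_maps_to hcard
    (f := fun x => x + ρ * φ x + ρ * φ ρ * φ (φ x)) (fun x hx => by
      have hx3 := hSf x hx
      rw [hφ3] at hx3
      have hN : ρ * φ ρ * φ (φ ρ) = 1 := by rw [hρφφ, hρφ, hρ]; field_simp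
      rw [Finset.mem_coe, Multiset.mem_toFinset, mem_roots hpoly0, IsRoot.def]
      simp only [eval_sub, eval_mul, eval_C, eval_pow, eval_X]
      rw [← hφ]
      simp only [map_add, map_mul, hx3]
      linear_combination x * hN)
  refine hinj ⟨x - y, sub_ne_zero.2 hxy, ?_, ?_⟩
  · rw [map_sub, map_sub, map_sub, ← hφ3, ← hφ3, hSf x hx, hSf y hy]
  · simp only [map_sub]
    linear_combination hT

end Classification

section FiniteTwistedCubic

open Polynomial

variable {L : Type*} [Field L]

/-- The orbit of `x` under an endomorphism of order three. -/
def orbitVec (σ : L →+* L) (x : L) : Fin 3 → L := ![x, σ x, σ (σ x)]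

theorem mem_range_algebraMap_of_pow_card_eq [Finite L] {k : Type*} [Field k] [Algebra L k] {x : k}
    (hx : x ^ Nat.card L = x) : x ∈ Set.range (algebraMap L k) := by
  have := Fintype.ofFinite L
  rw [Nat.card_eq_fintype_card] at hx
  have hne := FiniteField.X_pow_card_sub_X_ne_zero L (p := Fintype.card L) Fintype.one_lt_card
  have hs : (X ^ Fintype.card L - X : L[X]).Splits := by
    rw [splits_iff_card_roots, FiniteField.roots_X_pow_card_sub_X,
      FiniteField.X_pow_card_sub_X_natDegree_eq L Fintype.one_lt_card]
    rfl
  have hr := hs.roots_map (algebraMap L k)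
  have : x ∈ ((X ^ Fintype.card L - X : L[X]).map (algebraMap L k)).roots := by
    rw [mem_roots (map_ne_zero hne)]
    simp [hx]
  rw [hr, Multiset.mem_map] at this
  obtain ⟨a, -, rfl⟩ := this
  exact ⟨a, rfl⟩

theorem twistedCubic_orbitVec_split {σ : L →+* L} (h3 : ∀ x, σ (σ (σ x)) = x) {c : L}
    (hc : σ c = c) (u x : L) :
    twistedCubic (c * (1 - u * σ u * σ (σ u))) (orbitVec σ (-(c * u)))
      (orbitVec σ (c * (u * σ u))) (orbitVec σ x) =
      c * ((x - u * σ x) * σ (x - u * σ x) * σ (σ (x - u * σ x))) := by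
  simp only [twistedCubic, orbitVec, Matrix.cons_val, map_neg, map_mul, map_sub, hc, h3]
  ring

variable [Finite L] {q : ℕ} {σ : L →+* L}

theorem exists_eq_mul_map_of_norm_eq_one (hq : 1 < q) (hσ : ∀ x, σ x = x ^ q)
    (hL : Nat.card L = q ^ 3) {u : L} (hu : u * σ u * σ (σ u) = 1) (h3 : ∀ x, σ (σ (σ x)) = x) :
    ∃ x, x ≠ 0 ∧ x = u * σ x := by
  have := Fintype.ofFinite L
  have hP0 : (X + C u * X ^ q + C (u * σ u) * X ^ (q ^ 2) : L[X]) ≠ 0 := fun h => by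
    have := congrArg (fun P : L[X] => P.coeff 1) h
    simp only [coeff_add, coeff_C_mul, coeff_X_pow, coeff_X_one, coeff_zero, if_neg hq.ne,
      if_neg (Nat.one_lt_pow two_ne_zero hq).ne] at this
    simp at this
  have hdeg : (X + C u * X ^ q + C (u * σ u) * X ^ (q ^ 2) : L[X]).natDegree ≤ q ^ 2 := by
    compute_degree
    exact max_le (by nlinarith) (max_le (by nlinarith) le_rfl)
  obtain ⟨y, hy⟩ : ∃ y, (X + C u * X ^ q + C (u * σ u) * X ^ (q ^ 2) : L[X]).eval y ≠ 0 := by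
    by_contra! h
    refine hP0 (eq_zero_of_natDegree_lt_card_of_eval_eq_zero' _ Finset.univ (fun i _ => h i) ?_)
    rw [Finset.card_univ, ← Nat.card_eq_fintype_card, hL]
    exact hdeg.trans_lt (Nat.pow_lt_pow_right hq (by norm_num))
  have e : (X + C u * X ^ q + C (u * σ u) * X ^ (q ^ 2) : L[X]).eval y =
      y + u * σ y + u * σ u * σ (σ y) := by
    simp only [eval_add, eval_mul, eval_C, eval_pow, eval_X, hσ y, hσ (y ^ q)]
    rw [← pow_mul, sq q]
  refine ⟨_, hy, ?_⟩
  rw [e]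
  simp only [map_add, map_mul, h3]
  linear_combination (-y) * hu

theorem exists_map_ne (hq : 1 < q) (hσ : ∀ x, σ x = x ^ q) (hL : Nat.card L = q ^ 3) :
    ∃ e, σ e ≠ e := by
  have := Fintype.ofFinite L
  by_contra! h
  refine FiniteField.X_pow_card_sub_X_ne_zero L hq
    (eq_zero_of_natDegree_lt_card_of_eval_eq_zero' _ Finset.univ (fun i _ => ?_) ?_)
  · simp [← hσ, h]
  · rw [FiniteField.X_pow_card_sub_X_natDegree_eq L hq, Finset.card_univ,
      ← Nat.card_eq_fintype_card, hL]
    exact lt_self_pow₀ hq (by norm_num)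

theorem twistedCubic_orbitVec_classification {p s : ℕ} [Fact p.Prime] [CharP L p]
    (hqp : q = p ^ s) (hs : s ≠ 0) (hσ : ∀ x, σ x = x ^ q) (hL : Nat.card L = q ^ 3)
    (h3 : ∀ x, σ (σ (σ x)) = x) {d β γ : L} (hd : σ d = d)
    (h : ∀ x, x ≠ 0 → twistedCubic d (orbitVec σ β) (orbitVec σ γ) (orbitVec σ x) ≠ 0) :
    (β = 0 ∧ γ = 0) ∨ (β ≠ 0 ∧ γ ≠ 0 ∧ β * σ γ = σ β * σ (σ γ) ∧
      d * (β * σ γ) = β * σ β * σ (σ β) + γ * σ γ * σ (σ γ)) := by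
  have hq : 1 < q := hqp ▸ Nat.one_lt_pow hs (Fact.out : p.Prime).one_lt
  obtain ⟨e, he⟩ := exists_map_ne hq hσ hL
  let ι := algebraMap L (AlgebraicClosure L)
  have : CharP (AlgebraicClosure L) p := charP_of_injective_ringHom ι.injective p
  let φ := iterateFrobenius (AlgebraicClosure L) p s
  have hφ : ∀ x, φ x = x ^ q := fun x => by rw [iterateFrobenius_def, hqp]
  have hφι : ∀ x, φ (ι x) = ι (σ x) := fun x => by rw [hφ, hσ, map_pow]
  have hcomp : ∀ x, ι ∘ orbitVec σ x = ![ι x, ι (σ x), ι (σ (σ x))] := fun x => by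
    ext i; fin_cases i <;> rfl
  have htw : ∀ x, twist φ (ι ∘ orbitVec σ x) = ι ∘ orbitVec σ x := fun x => by
    rw [hcomp]
    ext i
    fin_cases i <;> simp [twist, hφι, h3]
  have key := twistedCubic_classification p s hqp hs hφ (d := ι d) (b := ι ∘ orbitVec σ β)
    (g := ι ∘ orbitVec σ γ) (by rw [hφι, hd]) (htw β) (htw γ) (fun v hv hv' => by
      have h0 : φ (v 2) = v 0 := congrFun hv' 0
      have h1 : φ (v 0) = v 1 := congrFun hv' 1
      have h2 : φ (v 1) = v 2 := congrFun hv' 2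
      obtain ⟨x, hx⟩ := mem_range_algebraMap_of_pow_card_eq (L := L) (x := v 0) (by
        rw [hL, pow_succ, pow_two, pow_mul, pow_mul, ← hφ, ← hφ, ← hφ, h1, h2, h0])
      have hvx : v = ι ∘ orbitVec σ x := by
        rw [hcomp, ← hφι (σ x), ← hφι x, show ι x = v 0 from hx, h1, h2]
        ext i; fin_cases i <;> rfl
      rw [hvx, ← twistedCubic_map, map_eq_zero] at hv
      by_cases hx0 : x = 0
      · rw [hvx, hx0]
        ext i; fin_cases i <;> simp [orbitVec]
      · exact absurd hv (h x hx0)) (e := ι e) (by simp only [hφι, h3])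
      (by rw [hφι]; exact fun h => he (ι.injective h))
  simp only [hcomp, Matrix.cons_val, ← map_mul ι, ← map_add ι, map_eq_zero, ne_eq,
    ι.injective.eq_iff] at key
  exact key

theorem twistedCubic_orbitVec_ne_zero_iff {p s : ℕ} [Fact p.Prime] [CharP L p]
    (hqp : q = p ^ s) (hs : s ≠ 0) (hσ : ∀ x, σ x = x ^ q) (hL : Nat.card L = q ^ 3)
    (h3 : ∀ x, σ (σ (σ x)) = x) {d β γ : L} (hd : σ d = d) :
    (∀ x, x ≠ 0 → twistedCubic d (orbitVec σ β) (orbitVec σ γ) (orbitVec σ x) ≠ 0) ↔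
    ∃ c u : L, c ≠ 0 ∧ σ c = c ∧ u * σ u * σ (σ u) ≠ 1 ∧ d = c * (1 - u * σ u * σ (σ u)) ∧
      β = -(c * u) ∧ γ = c * (u * σ u) := by
  have hq : 1 < q := hqp ▸ Nat.one_lt_pow hs (Fact.out : p.Prime).one_lt
  constructor
  · intro h
    obtain ⟨c, u, hc, hcσ, h1, h2, h4⟩ : ∃ c u : L, c ≠ 0 ∧ σ c = c ∧
        d = c * (1 - u * σ u * σ (σ u)) ∧ β = -(c * u) ∧ γ = c * (u * σ u) := by
      obtain ⟨rfl, rfl⟩ | ⟨hβ, hγ, e1, e2⟩ :=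
        twistedCubic_orbitVec_classification hqp hs hσ hL h3 hd h
      · refine ⟨d, 0, ?_, hd, by simp, by simp, by simp⟩
        rintro rfl
        exact h 1 one_ne_zero (by simp [twistedCubic, orbitVec])
      · have e3 := congrArg σ e1
        simp only [map_mul, h3] at e3
        have hβ1 : σ β ≠ 0 := (map_ne_zero σ).2 hβ
        have hβ2 : σ (σ β) ≠ 0 := (map_ne_zero σ).2 hβ1
        have hγ1 : σ γ ≠ 0 := (map_ne_zero σ).2 hγ
        have hγ2 : σ (σ γ) ≠ 0 := (map_ne_zero σ).2 hγ1
        have hc : σ β * σ (σ β) / σ γ ≠ 0 := div_ne_zero (mul_ne_zero hβ1 hβ2) hγ1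
        have hcσ : σ (σ β * σ (σ β) / σ γ) = σ β * σ (σ β) / σ γ := by
          simp only [map_div₀, map_mul, h3]
          rw [div_eq_div_iff hγ2 hγ1]
          linear_combination σ (σ β) * e1
        generalize hcd : σ β * σ (σ β) / σ γ = c at hc hcσ
        have hcd' : σ β * σ (σ β) = c * σ γ := by rw [← hcd]; field_simp
        have hcσ2 : σ (σ c) = c := by rw [hcσ, hcσ]
        refine ⟨c, -β / c, hc, hcσ, ?_, by field_simp; try ring, ?_⟩
        · simp only [map_div₀, map_neg, hcσ]
          field_simp
          refine mul_right_cancel₀ (mul_ne_zero hβ hγ1) ?_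
          have t1 : c * γ = β * σ β := by
            refine mul_right_cancel₀ hβ2 ?_
            linear_combination (-c) * (e1.trans e3) - β * hcd'
          have t2 : c * σ (σ γ) = σ (σ β) * β := by
            have := congrArg σ hcd'
            simp only [map_mul, h3, hcσ] at this
            exact this.symm
          linear_combination c ^ 2 * e2 + c ^ 2 * β * hcd' + c * σ γ * σ (σ γ) * t1 +
            β * σ β * σ γ * t2
        · simp only [map_div₀, map_neg, hcσ]
          field_simp
          have t1 : c * γ = β * σ β := by
            refine mul_right_cancel₀ hβ2 ?_
            linear_combination (-c) * (e1.trans e3) - β * hcd'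
          linear_combination t1
    refine ⟨c, u, hc, hcσ, fun hu => ?_, h1, h2, h4⟩
    obtain ⟨x, hx0, hx⟩ := exists_eq_mul_map_of_norm_eq_one hq hσ hL hu h3
    refine h x hx0 ?_
    rw [h1, h2, h4, twistedCubic_orbitVec_split h3 hcσ, sub_eq_zero.2 hx]
    simp
  · rintro ⟨c, u, hc, hcσ, hu, rfl, rfl, rfl⟩ x hx0
    rw [twistedCubic_orbitVec_split h3 hcσ]
    have : x - u * σ x ≠ 0 := fun h => hu (by
      have e0 := sub_eq_zero.1 h
      have e1 := congrArg σ e0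
      have e2 := congrArg σ e1
      simp only [map_mul, h3] at e1 e2
      refine mul_right_cancel₀ hx0 ?_
      rw [one_mul]
      conv_rhs => rw [e0, e1, e2]
      ring)
    exact mul_ne_zero hc (mul_ne_zero (mul_ne_zero this ((map_ne_zero σ).2 this))
      ((map_ne_zero σ).2 ((map_ne_zero σ).2 this)))

end FiniteTwistedCubic

section CubicExtension

set_option linter.unusedSectionVars false

variable {K L : Type*} [Field K] [Field L] [Finite K] [Finite L] [Algebra K L] {σ : L →+* L}

theorem frobenius_algebraMap (hσ : ∀ x, σ x = x ^ Nat.card K) (a : K) :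
    σ (algebraMap K L a) = algebraMap K L a := by
  rw [hσ, ← map_pow]
  have := Fintype.ofFinite K
  rw [Nat.card_eq_fintype_card, FiniteField.pow_card]

theorem card_cubic_extension (h3 : Module.finrank K L = 3) : Nat.card L = Nat.card K ^ 3 := by
  rw [Module.natCard_eq_pow_finrank (K := K), h3]

theorem frobenius_cube (h3 : Module.finrank K L = 3) (hσ : ∀ x, σ x = x ^ Nat.card K) (x : L) :
    σ (σ (σ x)) = x := by
  have := Fintype.ofFinite L
  rw [hσ, hσ, hσ, ← pow_mul, ← pow_mul, ← pow_two, ← pow_succ', ← card_cubic_extension h3,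
    Nat.card_eq_fintype_card, FiniteField.pow_card]

theorem algebraMap_trace_cubic (h3 : Module.finrank K L = 3) (hσ : ∀ x, σ x = x ^ Nat.card K)
    (x : L) : algebraMap K L (Algebra.trace K L x) = x + σ x + σ (σ x) := by
  rw [FiniteField.algebraMap_trace_eq_sum_pow, h3, hσ (σ x), hσ x]
  simp [Finset.sum_range_succ, ← pow_mul, pow_two]

theorem algebraMap_norm_cubic (h3 : Module.finrank K L = 3) (hσ : ∀ x, σ x = x ^ Nat.card K)
    (x : L) : algebraMap K L (Algebra.norm K x) = x * σ x * σ (σ x) := by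
  rw [FiniteField.algebraMap_norm_eq_prod_pow, h3, hσ (σ x), hσ x]
  simp [Finset.prod_range_succ, ← pow_mul, pow_two]

theorem card_norm_eq_one (h3 : Module.finrank K L = 3) :
    Nat.card {u : L // Algebra.norm K u = 1} = Nat.card K ^ 2 + Nat.card K + 1 := by
  have hq : 1 < Nat.card K := Finite.one_lt_card
  have hf := FiniteField.unitsMap_norm_surjective K L
  have h := Subgroup.card_mul_index (Units.map (Algebra.norm K : L →* K)).ker
  rw [Subgroup.index_ker, MonoidHom.range_eq_top.2 hf, Subgroup.card_top, Nat.card_units,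
    Nat.card_units, card_cubic_extension h3] at h
  have e : Nat.card {u : L // Algebra.norm K u = 1} =
      Nat.card (Units.map (Algebra.norm K : L →* K)).ker := by
    refine (Nat.card_congr (Equiv.ofBijective
      (fun v => ⟨((v : Lˣ) : L), by
        have := v.2
        rw [MonoidHom.mem_ker, Units.ext_iff] at this
        exact this⟩) ⟨fun v w h => ?_, fun u => ?_⟩)).symm
    · exact Subtype.ext (Units.ext (congrArg Subtype.val h))
    · have hu : (u : L) ≠ 0 := by
        rintro h
        have := u.2
        rw [h, Algebra.norm_zero] at this
        exact zero_ne_one this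
      refine ⟨⟨Units.mk0 u hu, ?_⟩, rfl⟩
      rw [MonoidHom.mem_ker, Units.ext_iff]
      exact u.2
  rw [e]
  obtain ⟨n, hn⟩ : ∃ n, Nat.card K = n + 2 := ⟨Nat.card K - 2, by omega⟩
  rw [hn] at h ⊢
  refine Nat.eq_of_mul_eq_mul_right (show 0 < n + 1 by omega) ?_
  have h1 : n + 2 - 1 = n + 1 := by omega
  have h2 : (n + 2) ^ 3 - 1 = ((n + 2) ^ 2 + (n + 2) + 1) * (n + 1) := by
    zify [Nat.one_le_pow 3 (n + 2) (by omega)]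
    ring
  rw [h1, h2] at h
  exact h

theorem card_ker_trace_cubic (h3 : Module.finrank K L = 3) :
    Nat.card (LinearMap.ker (Algebra.trace K L)) = Nat.card K ^ 2 := by
  have h := LinearMap.finrank_range_add_finrank_ker (Algebra.trace K L)
  rw [LinearMap.range_eq_top.2 (Algebra.trace_surjective K L), finrank_top, h3,
    Module.finrank_self] at h
  rw [Module.natCard_eq_pow_finrank (K := K), show Module.finrank K _ = 2 by omega]

theorem norm_mul_trace_eq_twistedCubic (h3 : Module.finrank K L = 3)
    (hσ : ∀ x, σ x = x ^ Nat.card K) (a b c : L) {x : L} (hx : x ≠ 0) :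
    algebraMap K L (Algebra.norm K x * Algebra.trace K L ((a * x + b * σ x + c * σ (σ x)) / x)) =
      twistedCubic (algebraMap K L (Algebra.trace K L a)) (orbitVec σ b) (orbitVec σ c)
        (orbitVec σ x) := by
  have h1 : σ x ≠ 0 := (map_ne_zero σ).2 hx
  have h2 : σ (σ x) ≠ 0 := (map_ne_zero σ).2 h1
  rw [map_mul, algebraMap_norm_cubic h3 hσ, algebraMap_trace_cubic h3 hσ,
    algebraMap_trace_cubic h3 hσ]
  simp only [map_div₀, map_add, map_mul, frobenius_cube h3 hσ, twistedCubic, orbitVec,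
    Matrix.cons_val]
  field_simp
  ring

theorem card_trace_div_ne_zero (h3 : Module.finrank K L = 3) (hσ : ∀ x, σ x = x ^ Nat.card K) :
    Nat.card {t : L × L × L // ∀ x, x ≠ 0 →
      Algebra.trace K L ((t.1 * x + t.2.1 * σ x + t.2.2 * σ (σ x)) / x) ≠ 0} =
    (Nat.card K - 1) * (Nat.card K ^ 3 - (Nat.card K ^ 2 + Nat.card K + 1)) * Nat.card K ^ 2 := by
  have hL := card_cubic_extension h3
  have hF := Fintype.ofFinite K
  obtain ⟨p, hp⟩ := CharP.exists K
  obtain ⟨s, hpp, hqp⟩ := FiniteField.card K p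
  have : Fact p.Prime := ⟨hpp⟩
  have : CharP L p := charP_of_injective_algebraMap (algebraMap K L).injective p
  rw [← Nat.card_eq_fintype_card] at hqp
  have hiff : ∀ a b c : L,
      (∀ x, x ≠ 0 → Algebra.trace K L ((a * x + b * σ x + c * σ (σ x)) / x) ≠ 0)
      ↔ ∃ k u : L, k ≠ 0 ∧ σ k = k ∧ u * σ u * σ (σ u) ≠ 1 ∧
        algebraMap K L (Algebra.trace K L a) = k * (1 - u * σ u * σ (σ u)) ∧
        b = -(k * u) ∧ c = k * (u * σ u) := fun a b c => by
    rw [← twistedCubic_orbitVec_ne_zero_iff hqp s.ne_zero hσ hL (frobenius_cube h3 hσ)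
      (frobenius_algebraMap hσ _)]
    refine forall₂_congr fun x hx => ?_
    rw [← norm_mul_trace_eq_twistedCubic h3 hσ a b c hx, Ne, Ne, map_eq_zero (algebraMap K L),
      mul_eq_zero,
      Algebra.norm_eq_zero_iff, or_iff_right hx]
  obtain ⟨e, he⟩ := Algebra.trace_surjective K L 1
  have e1 : Nat.card {k : K // k ≠ 0} = Nat.card K - 1 := by
    rw [← Nat.card_units, Nat.card_congr (unitsEquivNeZero (G₀ := K))]
  have e2 : Nat.card {u : L // Algebra.norm K u ≠ 1} =
      Nat.card K ^ 3 - (Nat.card K ^ 2 + Nat.card K + 1) := by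
    classical
    have := Fintype.ofFinite L
    rw [← card_norm_eq_one h3, ← hL, Nat.card_eq_fintype_card, Nat.card_eq_fintype_card,
      Nat.card_eq_fintype_card, Fintype.card_subtype_compl]
  rw [← e1, ← e2, ← card_ker_trace_cubic h3, ← Nat.card_prod, ← Nat.card_prod]
  symm
  refine Nat.card_congr (Equiv.ofBijective (fun t =>
    ⟨((t.1.1.1 * (1 - Algebra.norm K t.1.2.1)) • e + (t.2 : L),
    -(algebraMap K L t.1.1 * t.1.2), algebraMap K L t.1.1 * (t.1.2 * σ t.1.2)), ?_⟩) ⟨?_, ?_⟩)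
  · refine (hiff _ _ _).2 ⟨algebraMap K L t.1.1, t.1.2, ?_, frobenius_algebraMap hσ _, ?_, ?_,
      rfl, rfl⟩
    · rw [Ne, map_eq_zero]; exact t.1.1.2
    · rw [← algebraMap_norm_cubic h3 hσ, Ne, ← map_one (algebraMap K L),
        (algebraMap K L).injective.eq_iff]
      exact t.1.2.2
    · rw [← algebraMap_norm_cubic h3 hσ, map_add, map_smul, he, LinearMap.mem_ker.1 t.2.2]
      simp
  · rintro ⟨⟨⟨k, hk⟩, ⟨u, hu⟩⟩, ⟨a, ha⟩⟩ ⟨⟨⟨k', hk'⟩, ⟨u', hu'⟩⟩, ⟨a', ha'⟩⟩ h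
    simp only [Subtype.mk.injEq, Prod.mk.injEq, neg_inj] at h
    obtain ⟨h1, h2, h4⟩ := h
    have ht := congrArg (Algebra.trace K L) h1
    simp only [map_add, map_smul, he, LinearMap.mem_ker.1 ha, LinearMap.mem_ker.1 ha',
      add_zero, smul_eq_mul, mul_one] at ht
    have hn := congrArg (Algebra.norm K) h2
    have hkk : k = k' := by
      by_cases hu0 : u = 0
      · have hu0' : u' = 0 := by
          rw [hu0, mul_zero] at h2
          exact (mul_eq_zero.1 h2.symm).resolve_left ((map_ne_zero _).2 hk')
        simpa [hu0, hu0'] using ht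
      · have h5 : σ u = σ u' := by
          refine mul_left_cancel₀ (mul_ne_zero ((map_ne_zero (algebraMap K L)).2 hk) hu0) ?_
          linear_combination h4 - σ u' * h2
        rw [σ.injective h5] at h2
        exact (algebraMap K L).injective (mul_right_cancel₀ (σ.injective h5 ▸ hu0) h2)
    subst hkk
    have huu : u = u' := mul_left_cancel₀ ((map_ne_zero (algebraMap K L)).2 hk) h2
    subst huu
    simpa using h1
  · rintro ⟨⟨a, b, c⟩, ht⟩
    obtain ⟨k, u, hk, hkσ, hu, hd, hb, hc⟩ := (hiff _ _ _).1 ht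
    obtain ⟨k, rfl⟩ := mem_range_algebraMap_of_pow_card_eq (L := K) (x := k) (by rw [← hσ, hkσ])
    rw [← algebraMap_norm_cubic h3 hσ] at hu hd
    rw [← map_one (algebraMap K L), ← map_sub, ← map_mul,
      (algebraMap K L).injective.eq_iff] at hd
    refine ⟨⟨⟨⟨k, fun h => hk (by rw [h, map_zero])⟩, ⟨u, fun h => hu (by rw [h, map_one])⟩⟩,
      ⟨a - Algebra.trace K L a • e, ?_⟩⟩, ?_⟩
    · rw [LinearMap.mem_ker, map_sub, map_smul, he]
      simp
    · simp only [← hd, Subtype.mk.injEq, Prod.mk.injEq]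
      exact ⟨by simp, hb.symm, hc.symm⟩

end CubicExtension

section CubicEndomorphism

set_option linter.unusedSectionVars false

variable {K L : Type*} [Field K] [Field L] [Finite K] [Finite L] [Algebra K L]

open Polynomial in
theorem eq_zero_of_frobenius_combination_eq_zero {σ : L →+* L} (h3 : Module.finrank K L = 3)
    (hσ : ∀ x, σ x = x ^ Nat.card K) {a b c : L} (h : ∀ x, a * x + b * σ x + c * σ (σ x) = 0) :
    a = 0 ∧ b = 0 ∧ c = 0 := by
  have := Fintype.ofFinite L
  have hq : 1 < Nat.card K := Finite.one_lt_card
  have hL := card_cubic_extension h3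
  generalize Nat.card K = q at *
  have hq2 : q < q ^ 2 := by nlinarith
  have hP : (C a * X + C b * X ^ q + C c * X ^ (q ^ 2) : L[X]) = 0 := by
    refine eq_zero_of_natDegree_lt_card_of_eval_eq_zero' _ Finset.univ (fun x _ => ?_)
      (lt_of_le_of_lt (b := q ^ 2) ?_ ?_)
    · rw [← h x, hσ (σ x), hσ x, ← pow_mul, ← pow_two]
      simp
    · compute_degree
      exact max_le (by omega) (max_le hq2.le le_rfl)
    · rw [Finset.card_univ, ← Nat.card_eq_fintype_card, hL]
      exact Nat.pow_lt_pow_right hq (by norm_num)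
  have hc (n : ℕ) := congrArg (fun P : L[X] => P.coeff n) hP
  simp only [coeff_add, coeff_C_mul, coeff_X_pow, coeff_zero, coeff_X] at hc
  refine ⟨?_, ?_, ?_⟩
  · simpa [hq.ne, (hq.trans hq2).ne] using hc 1
  · simpa [hq.ne, hq2.ne] using hc q
  · have := hc (q ^ 2)
    rwa [if_neg (hq.trans hq2).ne, if_neg hq2.ne', if_pos rfl, mul_zero, mul_zero, mul_one,
      zero_add, zero_add] at this

theorem exists_trace_mul_ne_zero_iff (h3 : Module.finrank K L = 3) {θ : L}
    (hθ : θ ∉ Set.range (algebraMap K L)) : ∃ u : L, u ≠ 0 ∧ ∀ y : L,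
      Algebra.trace K L (u * y) ≠ 0 ↔
        ∀ a : Fin 3 → K, a 0 • (1 : L) + a 1 • θ + a 2 • y = 0 → a = 0 := by
  have hli : LinearIndependent K ![(1 : L), θ] := by
    rw [LinearIndependent.pair_iff]
    intro s t h
    have ht : t = 0 := by
      by_contra ht
      refine hθ ⟨-s / t, ?_⟩
      rw [Algebra.smul_def, Algebra.smul_def] at h
      have : algebraMap K L t ≠ 0 := (map_ne_zero _).2 ht
      rw [map_div₀, map_neg]
      field_simp
      linear_combination -h
    refine ⟨?_, ht⟩
    simpa [ht] using h
  have hdim := finrank_span_eq_card hli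
  rw [Fintype.card_fin] at hdim
  have hlt : Submodule.span K (Set.range ![(1 : L), θ]) < ⊤ := by
    rw [lt_top_iff_ne_top]
    intro h
    rw [h, finrank_top, h3] at hdim
    omega
  obtain ⟨f, hf0, hf⟩ := Submodule.exists_le_ker_of_lt_top _ hlt
  have hker : Submodule.span K (Set.range ![(1 : L), θ]) = LinearMap.ker f := by
    refine Submodule.eq_of_le_of_finrank_le hf ?_
    have h1 := LinearMap.finrank_range_add_finrank_ker f
    have h2 : LinearMap.range f = ⊤ := LinearMap.range_eq_top.2 (LinearMap.surjective hf0)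
    rw [h2, finrank_top, h3, Module.finrank_self] at h1
    omega
  obtain ⟨u, hu⟩ : ∃ u, Algebra.traceForm K L u = f := by
    refine ⟨(LinearMap.BilinForm.toDual _ (traceForm_nondegenerate K L)).symm f, ?_⟩
    ext y
    exact LinearMap.BilinForm.apply_toDual_symm_apply _ _ 
  have hfu : ∀ y, Algebra.trace K L (u * y) = f y := fun y => by
    rw [← hu, Algebra.traceForm_apply]
  have hf1 : f 1 = 0 := hf (Submodule.subset_span ⟨0, rfl⟩)
  have hfθ : f θ = 0 := hf (Submodule.subset_span ⟨1, rfl⟩)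
  refine ⟨u, ?_, fun y => ?_⟩
  · rintro rfl
    exact hf0 (by rw [← hu, map_zero])
  rw [hfu]
  constructor
  · intro hy a ha
    have h2 : a 2 = 0 := by
      have := congrArg f ha
      simpa [hf1, hfθ, hy] using this
    have := LinearIndependent.pair_iff.1 hli (a 0) (a 1) (by simpa [h2] using ha)
    ext i
    fin_cases i
    exacts [this.1, this.2, h2]
  · intro h hy
    have : y ∈ Submodule.span K (Set.range ![(1 : L), θ]) := by
      rw [hker]; exact hy
    rw [Matrix.range_cons, Matrix.range_cons, Matrix.range_empty, Set.union_empty,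
      Set.singleton_union, Submodule.mem_span_pair] at this
    obtain ⟨s, t, hst⟩ := this
    have := congrFun (h ![s, t, -1] (by simp [hst])) 2
    simp at this

theorem card_independent_endomorphism (h3 : Module.finrank K L = 3) {θ : L}
    (hθ : θ ∉ Set.range (algebraMap K L)) :
    Nat.card {ν : L →ₗ[K] L // ∀ x, x ≠ 0 → ∀ a : Fin 3 → K,
      a 0 • x + a 1 • (θ * x) + a 2 • ν x = 0 → a = 0} =
    (Nat.card K - 1) * (Nat.card K ^ 3 - (Nat.card K ^ 2 + Nat.card K + 1)) * Nat.card K ^ 2 := by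
  have := Fintype.ofFinite K
  let τ : L →ₐ[K] L := FiniteField.frobeniusAlgHom K L
  have hσ : ∀ x, (τ : L →+* L) x = x ^ Nat.card K := fun x => by
    rw [Nat.card_eq_fintype_card]; rfl
  obtain ⟨u, hu0, hu⟩ := exists_trace_mul_ne_zero_iff h3 hθ
  let Λ : L × L × L → (L →ₗ[K] L) := fun t =>
    LinearMap.mulLeft K (u⁻¹ * t.1) + LinearMap.mulLeft K (u⁻¹ * t.2.1) ∘ₗ τ.toLinearMap +
      LinearMap.mulLeft K (u⁻¹ * t.2.2) ∘ₗ τ.toLinearMap ∘ₗ τ.toLinearMap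
  have hΛ : ∀ t x, Λ t x = u⁻¹ * (t.1 * x + t.2.1 * τ x + t.2.2 * τ (τ x)) := fun t x => by
    simp only [Λ, LinearMap.add_apply, LinearMap.comp_apply, LinearMap.mulLeft_apply,
      AlgHom.toLinearMap_apply]
    ring
  have hbij : Function.Bijective Λ := by
    have : Finite (L →ₗ[K] L) := Module.finite_of_finite K
    refine Function.Injective.bijective_of_nat_card_le (fun s t hst => ?_) ?_
    · have := eq_zero_of_frobenius_combination_eq_zero h3 hσ (a := s.1 - t.1) (b := s.2.1 - t.2.1)
        (c := s.2.2 - t.2.2) (fun x => by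
          have := congrArg (fun ν : L →ₗ[K] L => ν x) hst
          simp only [hΛ] at this
          have := mul_left_cancel₀ (inv_ne_zero hu0) this
          simp only [RingHom.coe_coe]
          linear_combination this)
      simp only [sub_eq_zero] at this
      exact Prod.ext this.1 (Prod.ext this.2.1 this.2.2)
    · rw [Module.natCard_eq_pow_finrank (K := K), Module.finrank_linearMap, h3, Nat.card_prod,
        Nat.card_prod, card_cubic_extension h3]
      apply le_of_eq
      ring
  rw [← card_trace_div_ne_zero h3 hσ]
  symm
  refine Nat.card_congr (Equiv.subtypeEquiv (Equiv.ofBijective Λ hbij) fun t => ?_)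
  refine forall₂_congr fun x hx => ?_
  rw [show (t.1 * x + t.2.1 * (τ : L →+* L) x + t.2.2 * (τ : L →+* L) ((τ : L →+* L) x)) / x =
    u * (Λ t x / x) by rw [hΛ]; simp only [RingHom.coe_coe]; field_simp, hu]
  refine forall_congr' fun a => ?_
  refine imp_congr_left ?_
  rw [← mul_eq_zero_iff_right hx]
  simp only [Equiv.ofBijective_apply, Algebra.smul_def]
  rw [show (algebraMap K L (a 0) * 1 + algebraMap K L (a 1) * θ + algebraMap K L (a 2) *
    (Λ t x / x)) * x = algebraMap K L (a 0) * x + algebraMap K L (a 1) * (θ * x) +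
      algebraMap K L (a 2) * Λ t x by field_simp]

end CubicEndomorphism

section EigenvalueFree

set_option linter.unusedSectionVars false

variable {K L : Type*} [Field K] [Field L] [Finite K] [Finite L] [Algebra K L]

open Polynomial in
theorem exists_conj_lmul_eq (h3 : Module.finrank K L = 3) {B : Module.End K L}
    (hB : ∀ c, ¬ B.HasEigenvalue c) :
    ∃ θ ∉ Set.range (algebraMap K L), ∃ g : L ≃ₗ[K] L, g.conj (Algebra.lmul K L θ) = B := by
  have hdeg : B.charpoly.natDegree = 3 := by rw [LinearMap.charpoly_natDegree, h3]
  have hroot : ∀ c, ¬ B.charpoly.IsRoot c := fun c h =>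
    hB c ((Module.End.hasEigenvalue_iff_isRoot_charpoly B c).2 h)
  have hirr : Irreducible B.charpoly := by
    rw [B.charpoly_monic.irreducible_iff_roots_eq_zero_of_degree_le_three (by omega) (by omega)]
    exact Multiset.eq_zero_of_forall_notMem fun c hc => hroot c (isRoot_of_mem_roots hc)
  have := Fact.mk hirr
  have hfin : Module.finrank K (AdjoinRoot B.charpoly) = 3 := by
    rw [(AdjoinRoot.powerBasis hirr.ne_zero).finrank, AdjoinRoot.powerBasis_dim, hdeg]
  have : Module.Finite K (AdjoinRoot B.charpoly) :=
    Module.finite_of_finrank_pos (by rw [hfin]; norm_num)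
  obtain ⟨f⟩ := FiniteField.nonempty_algHom_of_finrank_dvd (F := K) (K := AdjoinRoot B.charpoly)
    (L := L) (by rw [hfin, h3])
  have hf : Function.Bijective f := ⟨f.toRingHom.injective,
    (LinearMap.injective_iff_surjective_of_finrank_eq_finrank (f := f.toLinearMap)
      (by rw [hfin, h3])).1 f.toRingHom.injective⟩
  let E := AlgEquiv.ofBijective f hf
  let ρ₀ : AdjoinRoot B.charpoly →ₐ[K] Module.End K L :=
    Ideal.Quotient.liftₐ (Ideal.span {B.charpoly}) (aeval B) (fun P hP => by
      obtain ⟨Q, rfl⟩ := Ideal.mem_span_singleton'.1 hP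
      rw [map_mul, B.aeval_self_charpoly, mul_zero])
  have hρ₀ : ρ₀ (AdjoinRoot.root _) = B := aeval_X (R := K) B
  let ρ : L →ₐ[K] Module.End K L := ρ₀.comp E.symm.toAlgHom
  have hρ : ρ (E (AdjoinRoot.root _)) = B :=
    (congrArg ρ₀ (E.symm_apply_apply _)).trans hρ₀
  have hθ : E (AdjoinRoot.root _) ∉ Set.range (algebraMap K L) := by
    rintro ⟨c, hc⟩
    rw [← hc, AlgHom.commutes] at hρ
    refine hB c (Module.End.hasEigenvalue_of_hasEigenvector (x := 1) ⟨?_, one_ne_zero⟩)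
    rw [Module.End.mem_eigenspace_iff, ← hρ]
    rfl
  let g₀ : L →ₗ[K] L := (LinearMap.applyₗ (1 : L)) ∘ₗ ρ.toLinearMap
  have hg₀ : Function.Injective g₀ := by
    rw [← LinearMap.ker_eq_bot, LinearMap.ker_eq_bot']
    intro y hy
    by_contra hy0
    have h1 : ρ y⁻¹ (ρ y 1) = 1 := by
      rw [← Module.End.mul_apply, ← map_mul, inv_mul_cancel₀ hy0, map_one ρ]
      rfl
    have h2 : ρ y 1 = 0 := hy
    rw [h2, map_zero] at h1
    exact zero_ne_one h1
  refine ⟨_, hθ, LinearEquiv.ofInjectiveEndo g₀ hg₀, ?_⟩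
  rw [LinearEquiv.conj_apply, LinearEquiv.comp_toLinearMap_symm_eq]
  ext x
  change ρ (_ * x) 1 = B (ρ x 1)
  rw [map_mul, hρ]
  rfl

theorem not_hasEigenvalue_conj_lmul {θ : L} (hθ : θ ∉ Set.range (algebraMap K L))
    (g : L ≃ₗ[K] L) (c : K) : ¬ (g.conj (Algebra.lmul K L θ)).HasEigenvalue c := by
  intro h
  obtain ⟨x, hx, hx0⟩ := h.exists_hasEigenvector
  rw [Module.End.mem_eigenspace_iff, LinearEquiv.conj_apply_apply, ← LinearEquiv.eq_symm_apply,
    map_smul, Algebra.smul_def] at hx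
  exact hθ ⟨c, (mul_right_cancel₀ (g.symm.map_ne_zero_iff.2 hx0) hx).symm⟩

theorem exists_algEquiv_of_semiconj (h3 : Module.finrank K L = 3) {θ θ₀ : L}
    (hθ : θ ∉ Set.range (algebraMap K L)) (h : L ≃ₗ[K] L) (hh : ∀ x, h (θ * x) = θ₀ * h x) :
    ∃ τ : L ≃ₐ[K] L, τ θ = θ₀ ∧ ∀ x, h x = h 1 * τ x := by
  have hw : h 1 ≠ 0 := h.map_ne_zero_iff.2 one_ne_zero
  let S : Subalgebra K L :=
    { carrier := {y | ∀ x, h (y * x) * h 1 = h y * h x}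
      mul_mem' := fun {a b} ha hb x => by
        refine mul_right_cancel₀ hw ?_
        have e1 := ha (b * x)
        rw [← mul_assoc] at e1
        have e2 := hb x
        have e3 := ha b
        linear_combination h 1 * e1 + h a * e2 - h x * e3
      add_mem' := fun {a b} ha hb x => by
        rw [add_mul, map_add, map_add, add_mul, add_mul, ha x, hb x]
      algebraMap_mem' := fun c x => by
        rw [← Algebra.smul_def, map_smul, Algebra.algebraMap_eq_smul_one, map_smul,
          smul_mul_assoc, smul_mul_assoc, mul_comm] }
  have := Subalgebra.isSimpleOrder_of_finrank_prime K L (by rw [h3]; exact Nat.prime_three)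
  have hθS : θ ∈ S := fun x => by
    have := hh 1
    rw [mul_one] at this
    rw [this, hh]
    ring
  have hS : S = ⊤ := (eq_bot_or_eq_top S).resolve_left fun hS => hθ (by
    rwa [hS, Algebra.mem_bot] at hθS)
  have hmul : ∀ y x, h (y * x) * h 1 = h y * h x := fun y => by
    have : y ∈ S := hS ▸ Algebra.mem_top
    exact this
  let τ₀ : L →ₐ[K] L := AlgHom.ofLinearMap (LinearMap.mulLeft K (h 1)⁻¹ ∘ₗ h.toLinearMap)
    (by simp [hw]) (fun x y => by
      simp only [LinearMap.comp_apply, LinearMap.mulLeft_apply, LinearEquiv.coe_coe]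
      field_simp
      rw [mul_comm, hmul])
  have hτ : ∀ x, τ₀ x = (h 1)⁻¹ * h x := fun x => rfl
  refine ⟨AlgEquiv.ofBijective τ₀ (Finite.injective_iff_bijective.1 τ₀.toRingHom.injective), ?_,
    fun x => ?_⟩
  · rw [AlgEquiv.coe_ofBijective, hτ]
    have := hh 1
    rw [mul_one] at this
    rw [this]
    field_simp
  · rw [AlgEquiv.coe_ofBijective, hτ]
    field_simp

/-- The pairs of a linear automorphism and a generator of `L`, mapped to a conjugate of the
multiplication by that generator. -/
def conjLmul (t : (L ≃ₗ[K] L) × {θ : L // θ ∉ Set.range (algebraMap K L)}) :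
    {B : Module.End K L // ∀ c, ¬ B.HasEigenvalue c} :=
  ⟨t.1.conj (Algebra.lmul K L t.2.1), not_hasEigenvalue_conj_lmul t.2.2 t.1⟩

theorem conjLmul_eq_iff (t : (L ≃ₗ[K] L) × {θ : L // θ ∉ Set.range (algebraMap K L)})
    (B : {B : Module.End K L // ∀ c, ¬ B.HasEigenvalue c}) :
    conjLmul t = B ↔ ∀ x, t.1 (t.2.1 * x) = B.1 (t.1 x) := by
  have h : (conjLmul t).1 = (t.1.toLinearMap ∘ₗ Algebra.lmul K L t.2.1) ∘ₗ t.1.symm.toLinearMap :=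
    rfl
  rw [Subtype.ext_iff, h, LinearEquiv.comp_toLinearMap_symm_eq, LinearMap.ext_iff]
  rfl

theorem card_conjLmul_fiber (h3 : Module.finrank K L = 3)
    (B : {B : Module.End K L // ∀ c, ¬ B.HasEigenvalue c}) :
    Nat.card {t : (L ≃ₗ[K] L) × {θ : L // θ ∉ Set.range (algebraMap K L)} // conjLmul t = B} =
      3 * (Nat.card K ^ 3 - 1) := by
  obtain ⟨θ₀, hθ₀, g₀, hg₀⟩ := exists_conj_lmul_eq h3 B.2
  have hg : ∀ x, g₀ (θ₀ * x) = B.1 (g₀ x) :=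
    (conjLmul_eq_iff (g₀, ⟨θ₀, hθ₀⟩) B).1 (Subtype.ext hg₀)
  rw [← card_cubic_extension h3, ← Nat.card_units, ← h3, ← IsGalois.card_aut_eq_finrank K L,
    ← Nat.card_prod]
  symm
  have hm : ∀ (w : Lˣ), Function.Injective (LinearMap.mulLeft K (w : L)) := fun w x y hxy =>
    mul_left_cancel₀ w.ne_zero hxy
  refine Nat.card_congr (Equiv.ofBijective (fun s => ⟨((s.1.toLinearEquiv.trans
    (LinearEquiv.ofInjectiveEndo _ (hm s.2))).trans g₀, ⟨s.1.symm θ₀, ?_⟩), ?_⟩) ⟨?_, ?_⟩)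
  · rintro ⟨c, hc⟩
    refine hθ₀ ⟨c, ?_⟩
    rw [← s.1.commutes, hc, AlgEquiv.apply_symm_apply]
  · refine (conjLmul_eq_iff _ _).2 fun x => ?_
    change g₀ (s.2 * s.1 (s.1.symm θ₀ * x)) = B.1 (g₀ (s.2 * s.1 x))
    rw [← hg, map_mul s.1, AlgEquiv.apply_symm_apply]
    congr 1
    ring
  · intro s t hst
    have hst := congrArg (fun t => t.1.1) hst
    have hx : ∀ x, (s.2 : L) * s.1 x = t.2 * t.1 x := fun x =>
      g₀.injective (congrArg (fun g : L ≃ₗ[K] L => g x) hst)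
    have h2 : s.2 = t.2 := Units.ext (by simpa using hx 1)
    refine Prod.ext (AlgEquiv.ext fun x => ?_) h2
    have := hx x
    rw [h2] at this
    exact mul_left_cancel₀ t.2.ne_zero this
  · rintro ⟨⟨g, θ, hθ⟩, ht⟩
    have ht' := (conjLmul_eq_iff _ _).1 ht
    obtain ⟨τ, hτ, hx⟩ := exists_algEquiv_of_semiconj h3 hθ (g.trans g₀.symm) (θ₀ := θ₀) (by
      intro x
      change g₀.symm (g (θ * x)) = θ₀ * g₀.symm (g x)
      rw [LinearEquiv.symm_apply_eq, hg, LinearEquiv.apply_symm_apply]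
      exact ht' x)
    refine ⟨(τ, Units.mk0 _ ((g.trans g₀.symm).map_ne_zero_iff.2 one_ne_zero)), ?_⟩
    refine Subtype.ext (Prod.ext (LinearEquiv.ext fun x => ?_) (Subtype.ext ?_))
    · change g₀ (_ * τ x) = g x
      rw [Units.val_mk0, ← hx]
      exact LinearEquiv.apply_symm_apply _ _
    · change τ.symm θ₀ = θ
      rw [← hτ, AlgEquiv.symm_apply_apply]

theorem card_eigenvalue_free (h3 : Module.finrank K L = 3) :
    Nat.card {B : Module.End K L // ∀ c, ¬ B.HasEigenvalue c} * (3 * (Nat.card K ^ 3 - 1)) =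
      Nat.card (L ≃ₗ[K] L) * (Nat.card K ^ 3 - Nat.card K) := by
  have : Finite (Module.End K L) := Module.finite_of_finite K
  have : Finite (L ≃ₗ[K] L) := Finite.of_injective (fun g => (g : L → L)) DFunLike.coe_injective
  have := Fintype.ofFinite {B : Module.End K L // ∀ c, ¬ B.HasEigenvalue c}
  have hT : Nat.card {θ : L // θ ∉ Set.range (algebraMap K L)} = Nat.card K ^ 3 - Nat.card K := by
    classical
    have := Fintype.ofFinite L
    rw [Nat.card_eq_fintype_card, Fintype.card_subtype_compl, ← Nat.card_eq_fintype_card,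
      ← Nat.card_eq_fintype_card, card_cubic_extension h3]
    congr 1
    exact (Nat.card_congr (Equiv.ofInjective _ (algebraMap K L).injective)).symm
  rw [← hT, ← Nat.card_prod, ← Nat.card_congr (Equiv.sigmaFiberEquiv (conjLmul (K := K) (L := L))),
    Nat.card_sigma, Finset.sum_congr rfl (fun B _ => card_conjLmul_fiber h3 B), Finset.sum_const,
    Finset.card_univ, ← Nat.card_eq_fintype_card, smul_eq_mul]

theorem card_unit_pencil (h3 : Module.finrank K L = 3) :
    Nat.card {t : Module.End K L × Module.End K L // ∀ a : Fin 3 → K, a ≠ 0 →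
      IsUnit (a 0 • (1 : Module.End K L) + a 1 • t.1 + a 2 • t.2)} =
    Nat.card {B : Module.End K L // ∀ c, ¬ B.HasEigenvalue c} * ((Nat.card K - 1) *
      (Nat.card K ^ 3 - (Nat.card K ^ 2 + Nat.card K + 1)) * Nat.card K ^ 2) := by
  have : Finite (Module.End K L) := Module.finite_of_finite K
  have := Fintype.ofFinite {B : Module.End K L // ∀ c, ¬ B.HasEigenvalue c}
  let e : {t : Module.End K L × Module.End K L // ∀ a : Fin 3 → K, a ≠ 0 →
      IsUnit (a 0 • (1 : Module.End K L) + a 1 • t.1 + a 2 • t.2)} ≃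
      Σ B : {B : Module.End K L // ∀ c, ¬ B.HasEigenvalue c},
        {N : Module.End K L // ∀ a : Fin 3 → K, a ≠ 0 →
          IsUnit (a 0 • (1 : Module.End K L) + a 1 • B.1 + a 2 • N)} :=
    { toFun := fun t => ⟨⟨t.1.1, fun c hc => by
        obtain ⟨x, hx, hx0⟩ := hc.exists_hasEigenvector
        have hu := t.2 ![-c, 1, 0] (fun h => one_ne_zero (congrFun h 1))
        rw [LinearMap.isUnit_iff_ker_eq_bot, LinearMap.ker_eq_bot'] at hu
        refine hx0 (hu x ?_)
        rw [Module.End.mem_eigenspace_iff] at hx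
        simp [hx]⟩, ⟨t.1.2, t.2⟩⟩
      invFun := fun s => ⟨(s.1.1, s.2.1), s.2.2⟩
      left_inv := fun _ => rfl
      right_inv := fun _ => rfl }
  rw [Nat.card_congr e, Nat.card_sigma, Finset.sum_congr rfl (fun B _ => ?_), Finset.sum_const,
    Finset.card_univ, ← Nat.card_eq_fintype_card, smul_eq_mul]
  obtain ⟨θ, hθ, g, hg⟩ := exists_conj_lmul_eq h3 B.2
  rw [← card_independent_endomorphism h3 hθ]
  symm
  refine Nat.card_congr (Equiv.subtypeEquiv g.conj.toEquiv fun ν => ?_)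
  rw [← hg]
  have key : ∀ (a : Fin 3 → K) (x : L), (a 0 • (1 : Module.End K L) +
      a 1 • g.conj (Algebra.lmul K L θ) + a 2 • g.conj ν) (g x) =
      g (a 0 • x + a 1 • (θ * x) + a 2 • ν x) := fun a x => by
    simp
  constructor
  · intro h a ha
    rw [LinearMap.isUnit_iff_ker_eq_bot, LinearMap.ker_eq_bot']
    intro y hy
    obtain ⟨x, rfl⟩ := g.surjective y
    by_contra hx0
    refine ha (h x (fun h => hx0 (by rw [h, map_zero])) a ?_)
    exact g.map_eq_zero_iff.1 ((key a x).symm.trans hy)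
  · intro h x hx0 a hx
    by_contra ha
    have hu := h a ha
    rw [LinearMap.isUnit_iff_ker_eq_bot, LinearMap.ker_eq_bot'] at hu
    refine hx0 (g.map_eq_zero_iff.1 (hu (g x) ((key a x).trans ?_)))
    rw [hx, map_zero]

end EigenvalueFree

section UnitSubspaces

variable {K A : Type*} [Field K] [Ring A] [Algebra K A]

theorem linearIndependent_of_isUnit_sum [Nontrivial A] {f : Fin 3 → A}
    (hf : ∀ a : Fin 3 → K, a ≠ 0 → IsUnit (∑ i, a i • f i)) : LinearIndependent K f := by
  rw [Fintype.linearIndependent_iff]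
  intro a ha i
  by_contra hi
  have := hf a (fun h => hi (congrFun h i))
  rw [ha] at this
  exact not_isUnit_zero this

theorem card_unit_subspaces_mul_card_bases [Fintype K] [Finite A] [Nontrivial A] :
    Nat.card {C : Submodule K A // Module.finrank K C = 3 ∧ ∀ M ∈ C, M ≠ 0 → IsUnit M} *
      ∏ i : Fin 3, (Fintype.card K ^ 3 - Fintype.card K ^ i.val) =
    Nat.card {f : Fin 3 → A // ∀ a : Fin 3 → K, a ≠ 0 → IsUnit (∑ i, a i • f i)} := by
  have : Finite (Submodule K A) := Finite.of_injective _ SetLike.coe_injective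
  have := Fintype.ofFinite
    {C : Submodule K A // Module.finrank K C = 3 ∧ ∀ M ∈ C, M ≠ 0 → IsUnit M}
  have hc : ∀ C : {C : Submodule K A // Module.finrank K C = 3 ∧ ∀ M ∈ C, M ≠ 0 → IsUnit M},
      Nat.card {f : Fin 3 → C.1 // LinearIndependent K f} =
        ∏ i : Fin 3, (Fintype.card K ^ 3 - Fintype.card K ^ i.val) := fun C => by
    rw [card_linearIndependent (by rw [C.2.1]), C.2.1]
  have hli : ∀ s : (Σ C : {C : Submodule K A // Module.finrank K C = 3 ∧ ∀ M ∈ C, M ≠ 0 → IsUnit M},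
      {f : Fin 3 → C.1 // LinearIndependent K f}),
      LinearIndependent K (fun i => (s.2.1 i : A)) := fun s =>
    s.2.2.map' s.1.1.subtype (Submodule.ker_subtype _)
  rw [Nat.card_eq_fintype_card, ← Finset.card_univ, ← smul_eq_mul, ← Finset.sum_const,
    ← Finset.sum_congr rfl (fun C _ => hc C), ← Nat.card_sigma]
  refine Nat.card_congr (Equiv.ofBijective (fun s => ⟨fun i => s.2.1 i, fun a ha => ?_⟩) ⟨?_, ?_⟩)
  · refine s.1.2.2 _ (Submodule.sum_mem _ fun i _ => Submodule.smul_mem _ _ (s.2.1 i).2) fun h => ?_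
    exact ha (funext (Fintype.linearIndependent_iff.1 (hli s) a h))
  · intro s t hst
    have hspan : ∀ s : (Σ C : {C : Submodule K A //
        Module.finrank K C = 3 ∧ ∀ M ∈ C, M ≠ 0 → IsUnit M},
        {f : Fin 3 → C.1 // LinearIndependent K f}),
        Submodule.span K (Set.range fun i => (s.2.1 i : A)) = s.1.1 := fun s => by
      refine Submodule.eq_of_le_of_finrank_eq (Submodule.span_le.2 ?_) ?_
      · rintro _ ⟨i, rfl⟩
        exact (s.2.1 i).2
      · rw [finrank_span_eq_card (hli s), s.1.2.1, Fintype.card_fin]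
    have hst' := congrArg Subtype.val hst
    have hC : s.1 = t.1 := Subtype.ext ((hspan s).symm.trans
      ((congrArg (fun f : Fin 3 → A => Submodule.span K (Set.range f)) hst').trans (hspan t)))
    obtain ⟨C, f⟩ := s
    obtain ⟨C', f'⟩ := t
    obtain rfl : C = C' := hC
    congr 1
    exact Subtype.ext (funext fun i => Subtype.ext (congrFun hst' i))
  · rintro ⟨f, hf⟩
    have hlf := linearIndependent_of_isUnit_sum hf
    refine ⟨⟨⟨Submodule.span K (Set.range f), ?_, fun M hM hM0 => ?_⟩,
      ⟨fun i => ⟨f i, Submodule.subset_span ⟨i, rfl⟩⟩, linearIndependent_span hlf⟩⟩, rfl⟩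
    · rw [finrank_span_eq_card hlf, Fintype.card_fin]
    · obtain ⟨a, rfl⟩ := (Submodule.mem_span_range_iff_exists_fun K).1 hM
      refine hf a fun h => hM0 ?_
      simp [h]

theorem card_unit_triples : 
    Nat.card {f : Fin 3 → A // ∀ a : Fin 3 → K, a ≠ 0 → IsUnit (∑ i, a i • f i)} =
    Nat.card Aˣ * Nat.card {t : A × A // ∀ a : Fin 3 → K, a ≠ 0 →
      IsUnit (a 0 • (1 : A) + a 1 • t.1 + a 2 • t.2)} := by
  rw [← Nat.card_prod]
  symm
  refine Nat.card_congr (Equiv.ofBijective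
    (fun s => ⟨![s.1, s.1 * s.2.1.1, s.1 * s.2.1.2], fun a ha => ?_⟩) ⟨?_, ?_⟩)
  · have : ∑ i, a i • ![(s.1 : A), s.1 * s.2.1.1, s.1 * s.2.1.2] i =
        s.1 * (a 0 • (1 : A) + a 1 • s.2.1.1 + a 2 • s.2.1.2) := by
      simp [Fin.sum_univ_three, mul_add]
    rw [this]
    exact s.1.isUnit.mul (s.2.2 a ha)
  · rintro ⟨U, ⟨⟨B, N⟩, hs⟩⟩ ⟨U', ⟨⟨B', N'⟩, ht⟩⟩ h
    have h := congrArg Subtype.val h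
    have h0 : (U : A) = U' := congrFun h 0
    have h1 : (U : A) * B = U' * B' := congrFun h 1
    have h2 : (U : A) * N = U' * N' := congrFun h 2
    obtain rfl : U = U' := Units.ext h0
    obtain rfl := U.mul_right_inj.1 h1
    obtain rfl := U.mul_right_inj.1 h2
    rfl
  · rintro ⟨f, hf⟩
    obtain ⟨U, hU⟩ : IsUnit (f 0) := by
      have := hf ![1, 0, 0] (fun h => one_ne_zero (congrFun h 0))
      simpa [Fin.sum_univ_three] using this
    refine ⟨⟨U, ⟨(↑U⁻¹ * f 1, ↑U⁻¹ * f 2), fun a ha => ?_⟩⟩, Subtype.ext (funext fun i => ?_)⟩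
    · have := U⁻¹.isUnit.mul (hf a ha)
      rw [Fin.sum_univ_three, ← hU] at this
      simpa [mul_add] using this
    · fin_cases i
      exacts [hU, U.mul_inv_cancel_left _, U.mul_inv_cancel_left _]

end UnitSubspaces

/-- The number of 3-dimensional `F_q`-linear subspaces of `F_q^{3×3}` in which every
nonzero matrix is invertible equals
`(|GL_3(q)|^2 / (3·(q^3−1)^2)) · (1 + (q^3−1)(q−2)/(q−1))`. -/
theorem stmt1 (q : ℕ) (F : Type) [Field F] [Fintype F] (hq : Fintype.card F = q) :
    (Nat.card {C : Submodule F (Matrix (Fin 3) (Fin 3) F) //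
        Module.finrank F C = 3 ∧ ∀ M ∈ C, M ≠ 0 → IsUnit M} : ℚ) =
      ((∏ i ∈ Finset.range 3, ((q : ℚ) ^ 3 - q ^ i)) ^ 2 / (3 * ((q : ℚ) ^ 3 - 1) ^ 2)) *
        (1 + ((q : ℚ) ^ 3 - 1) * ((q : ℚ) - 2) / ((q : ℚ) - 1)) := by
  obtain ⟨p, hp⟩ := CharP.exists F
  have : Fact p.Prime := ⟨CharP.char_is_prime F p⟩
  let L := FiniteField.Extension F p 3
  have h3 : Module.finrank F L = 3 := FiniteField.finrank_extension F p 3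
  have hq1 : 1 < q := hq ▸ Fintype.one_lt_card
  have hcard : Nat.card F = q := by rw [Nat.card_eq_fintype_card, hq]
  let e : Module.End F L ≃ₐ[F] Matrix (Fin 3) (Fin 3) F :=
    LinearMap.toMatrixAlgEquiv (Module.finBasisOfFinrankEq F L h3)
  have hGL : Nat.card (Matrix (Fin 3) (Fin 3) F)ˣ = ∏ i : Fin 3, (q ^ 3 - q ^ i.val) := by
    rw [← hq]
    exact Matrix.card_GL_field 3
  have hlt : ∀ i : Fin 3, q ^ i.val < q ^ 3 := fun i => Nat.pow_lt_pow_right hq1 i.2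
  have hpos : 0 < ∏ i : Fin 3, (q ^ 3 - q ^ i.val) :=
    Finset.prod_pos fun i _ => Nat.sub_pos_of_lt (hlt i)
  have hX := card_unit_subspaces_mul_card_bases (K := F) (A := Matrix (Fin 3) (Fin 3) F)
  rw [card_unit_triples, hGL, hq, mul_comm] at hX
  have hX' := Nat.eq_of_mul_eq_mul_left hpos hX
  have hY : Nat.card {t : Module.End F L × Module.End F L // ∀ a : Fin 3 → F, a ≠ 0 →
      IsUnit (a 0 • (1 : Module.End F L) + a 1 • t.1 + a 2 • t.2)} =
      Nat.card {t : Matrix (Fin 3) (Fin 3) F × Matrix (Fin 3) (Fin 3) F // ∀ a : Fin 3 → F, a ≠ 0 →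
      IsUnit (a 0 • (1 : Matrix (Fin 3) (Fin 3) F) + a 1 • t.1 + a 2 • t.2)} := by
    refine Nat.card_congr (Equiv.subtypeEquiv (e.toEquiv.prodCongr e.toEquiv) fun t => ?_)
    refine forall₂_congr fun a _ => ?_
    rw [← MulEquiv.isUnit_map e]
    simp
  have hG : Nat.card (L ≃ₗ[F] L) = ∏ i : Fin 3, (q ^ 3 - q ^ i.val) := by
    rw [← hGL]
    exact Nat.card_congr ((LinearMap.GeneralLinearGroup.generalLinearEquiv F L).symm.toEquiv.trans
      (Units.mapEquiv (e : Module.End F L ≃* Matrix (Fin 3) (Fin 3) F)).toEquiv)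
  have hP := card_unit_pencil h3
  have hB := card_eigenvalue_free h3
  rw [hcard, hG] at hB
  rw [hcard, hY, ← hX'] at hP
  have hP' := congrArg (Nat.cast : ℕ → ℚ) hP
  have hB' := congrArg (Nat.cast : ℕ → ℚ) hB
  have hprod : ((∏ i : Fin 3, (q ^ 3 - q ^ i.val) : ℕ) : ℚ) =
      ∏ i ∈ Finset.range 3, ((q : ℚ) ^ 3 - q ^ i) := by
    rw [Nat.cast_prod, Finset.prod_range]
    refine Finset.prod_congr rfl fun i _ => ?_
    rw [Nat.cast_sub (hlt i).le, Nat.cast_pow, Nat.cast_pow]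
  have hle : q ^ 2 + q + 1 ≤ q ^ 3 := by
    nlinarith [Nat.mul_le_mul hq1 (le_refl (q * q)), Nat.mul_le_mul hq1 (le_refl q)]
  have hle' : q ≤ q ^ 3 := Nat.le_self_pow (by norm_num) q
  rw [Nat.cast_mul, Nat.cast_mul, Nat.cast_mul, hprod,
    Nat.cast_sub (Nat.one_le_pow _ _ (by omega)), Nat.cast_sub hle'] at hB'
  rw [Nat.cast_mul, Nat.cast_mul, Nat.cast_mul, Nat.cast_sub hq1.le, Nat.cast_sub hle] at hP'
  push_cast at hP' hB'
  rw [hP']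
  have hqQ : (1 : ℚ) < q := by exact_mod_cast hq1
  have n1 : (q : ℚ) - 1 ≠ 0 := by linarith
  have n2 : (q : ℚ) ^ 3 - 1 ≠ 0 := by
    have : (1 : ℚ) < (q : ℚ) ^ 3 := one_lt_pow₀ hqQ (by norm_num)
    linarith
  have hE : (Nat.card {B : Module.End F L // ∀ c, ¬ B.HasEigenvalue c} : ℚ) =
      (∏ i ∈ Finset.range 3, ((q : ℚ) ^ 3 - q ^ i)) * ((q : ℚ) ^ 3 - q) /
        (3 * ((q : ℚ) ^ 3 - 1)) := by
    rw [eq_div_iff (by simpa using n2), hB']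
  rw [hE]
  simp only [Finset.prod_range_succ, Finset.prod_range_zero, pow_zero, pow_one, one_mul]
  field_simp
  ring
end
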